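/- Let (G_n) be a sequence of weighted graphs with |G_n| = n and β_max = sup_{i,j,n} β_ij(n) < ∞, converging to an irreducible graphon W with ‖T_W‖ > 1, and fix an integer k ≥ 2 with (1−1/k)²‖T_W‖ > 1. Let σ > 0 be a constant with σ < 10^{−10}/β_max³ and σ < (1−1/k)·ρ((1−1/k)²W)/3, and such that for all sufficiently large n at most n/(10β_max) vertices v of G_n have weighted degree d_v = Σ_w β_vw(n) less than 50kβ_max σ n. For each n, let L be a uniformly random subset of [n] of size n/k, let R = [n]∖L, and let C₁ be the vertex set of the largest component of the random graph G_n(1/n)[R] (the subgraph of G_n(1/n) induced by R). Then there is a constant γ > 0 such that with high probability the number of vertices v ∈ L with Σ_{w∈C₁} β_vw(n) ≤ γn is at most 3σn. -/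

import Mathlib

open MeasureTheory Filter Topology

noncomputable section

namespace Percolation

/-- The symmetrized lift of a two-variable real function to `Sym2`. If `f` is symmetric,
`sym2Val f s(a, b) = f a b`. -/
def sym2Val {α : Type*} (f : α → α → ℝ) : Sym2 α → ℝ :=
  Sym2.lift ⟨fun a b => (f a b + f b a) / 2, fun a b => by simp [add_comm]⟩

/-- The product over the edges of `F` of a symmetric function of the endpoints. -/
def edgeProd {k : ℕ} (F : SimpleGraph (Fin k)) (f : Fin k → Fin k → ℝ) : ℝ := by
  classical exact ∏ e ∈ F.edgeFinset, sym2Val f e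

/-- The homomorphism density `t(F, G)` of a finite simple graph `F` in the weighted graph
on `[n]` with edge weights `β`. -/
def homDensityG {n k : ℕ} (β : Fin n → Fin n → ℝ) (F : SimpleGraph (Fin k)) : ℝ :=
  (∑ v : Fin k → Fin n, edgeProd F fun i j => β (v i) (v j)) / (n : ℝ) ^ k

/-- The unit interval `[0,1] ⊆ ℝ`. -/
def I01 : Set ℝ := Set.Icc 0 1

/-- The homomorphism density `t(F, W)` of a finite simple graph `F` in a graphon `W`. -/
def homDensityW {k : ℕ} (W : ℝ → ℝ → ℝ) (F : SimpleGraph (Fin k)) : ℝ :=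
  ∫ x : Fin k → ℝ in Set.univ.pi fun _ => I01, edgeProd F fun i j => W (x i) (x j)

/-- `G_n → W`: convergence of the homomorphism densities for every finite simple graph. -/
def ConvergesTo (β : ∀ n : ℕ, Fin n → Fin n → ℝ) (W : ℝ → ℝ → ℝ) : Prop :=
  ∀ (k : ℕ) (F : SimpleGraph (Fin k)),
    Tendsto (fun n => homDensityG (β n) F) atTop (nhds (homDensityW W F))

/-- `W` is a graphon: a bounded symmetric measurable function with nonnegative values. -/
def IsGraphon (W : ℝ → ℝ → ℝ) : Prop :=
  Measurable (Function.uncurry W) ∧ (∀ x y, 0 ≤ W x y) ∧ (∀ x y, W x y = W y x) ∧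
    ∃ M : ℝ, ∀ x y, W x y ≤ M

/-- The Bernoulli measure on `Bool` with success probability `p`. -/
def bern (p : ℝ) : Measure Bool :=
  ENNReal.ofReal p • Measure.dirac true + ENNReal.ofReal (1 - p) • Measure.dirac false

/-- The law of the random graph in which each pair `{v, w}` is an edge independently
with probability `min (p * β v w) 1`; a point of the sample space records for each
unordered pair whether it is an edge. -/
def percMeasure {V : Type*} [Fintype V] [DecidableEq V] (β : V → V → ℝ) (p : ℝ) :
    Measure (Sym2 V → Bool) :=
  Measure.pi fun e => bern (min (p * sym2Val β e) 1)

/-- The simple graph determined by a point of the sample space. -/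
def graphOf {V : Type*} (ω : Sym2 V → Bool) : SimpleGraph V :=
  SimpleGraph.fromRel fun i j => ω s(i, j)

/-- The number of vertices of the component of `v` in `G`. -/
def compSize {V : Type*} (G : SimpleGraph V) (v : V) : ℕ := {w | G.Reachable v w}.ncard

/-- The number of vertices of the largest component of `G`. -/
def C1 {V : Type*} [Fintype V] (G : SimpleGraph V) : ℕ :=
  Finset.univ.sup fun v => compSize G v

/-- The number of vertices of the second largest component of `G` (zero if `G` is
connected): the largest value of `min (|C_v|, |C_w|)` over vertices `v`, `w` lying in
distinct components. -/
def C2 {V : Type*} (G : SimpleGraph V) : ℕ :=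
  sSup {m | ∃ v w : V, ¬G.Reachable v w ∧ m = min (compSize G v) (compSize G w)}

/-- The operator `T_W` with kernel `W` applied to `f`. -/
def applyT (W : ℝ → ℝ → ℝ) (f : ℝ → ℝ) (x : ℝ) : ℝ := ∫ y in I01, W x y * f y

/-- The `L²[0,1]` norm of a function. -/
def l2norm (f : ℝ → ℝ) : ℝ := Real.sqrt (∫ x in I01, f x ^ 2)

/-- The `L²`-operator norm `‖T_W‖` of the integral operator with kernel `W`. -/
def opNorm (W : ℝ → ℝ → ℝ) : ℝ :=
  sSup {r | ∃ f : ℝ → ℝ, Measurable f ∧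
    MeasureTheory.IntegrableOn (fun x => f x ^ 2) I01 ∧
    l2norm f ≤ 1 ∧ r = l2norm (applyT W f)}

/-- The survival probability `ρ(W)` of the multitype Poisson branching process with
kernel `W`: the supremum of `∫ f` over measurable `f : [0,1] → [0,1]` satisfying the
functional equation `f(x) = 1 - exp(-∫ W(x,y) f(y) dy)` almost everywhere. -/
def survival (W : ℝ → ℝ → ℝ) : ℝ :=
  sSup {r | ∃ f : ℝ → ℝ, Measurable f ∧ (∀ x, f x ∈ Set.Icc (0 : ℝ) 1) ∧
    (∀ᵐ x ∂volume.restrict I01, f x = 1 - Real.exp (-∫ y in I01, W x y * f y)) ∧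
    r = ∫ x in I01, f x}

/-- A graphon `W` is irreducible if there is no measurable `A ⊆ [0,1]` with
`0 < μ(A) < 1` such that `W = 0` a.e. on `A × ([0,1] \ A)`. -/
def Irreducible (W : ℝ → ℝ → ℝ) : Prop :=
  ¬∃ A : Set ℝ, MeasurableSet A ∧ A ⊆ I01 ∧ 0 < volume A ∧ volume A < 1 ∧
    ∀ᵐ p : ℝ × ℝ, p.1 ∈ A → p.2 ∈ I01 \ A → W p.1 p.2 = 0

end Percolation
namespace Percolation

open MeasureTheory

instance instMeasurableSpaceFinsetFin (n : ℕ) : MeasurableSpace (Finset (Fin n)) := ⊤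

/-- The uniform probability measure on the subsets of `[n]` of size `n / k`. -/
def unifSubset (n k : ℕ) : Measure (Finset (Fin n)) :=
  ((Finset.univ.filter fun S : Finset (Fin n) => S.card = n / k).card : ENNReal)⁻¹ •
    ∑ S ∈ Finset.univ.filter fun S : Finset (Fin n) => S.card = n / k, Measure.dirac S

end Percolation

set_option linter.unusedSectionVars false
set_option linter.unusedVariables false

namespace GiantAux

open Percolation

section Iter
variable {Ω : Type*} [MeasurableSpace Ω]

/-- Iterated kernels: `iter m` has `m` internal vertices. -/
def iter (μ : Measure Ω) (W : Ω → Ω → ℝ) : ℕ → Ω → Ω → ℝ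
  | 0 => W
  | m + 1 => fun z y => ∫ x, W z x * iter μ W m x y ∂μ

/-- Walk product through internal vertices `x`. -/
def chain (W : Ω → Ω → ℝ) (m : ℕ) (z y : Ω) (x : Fin m → Ω) : ℝ :=
  ∏ l : Fin (m + 1), W ((Fin.cons z (Fin.snoc x y : Fin (m + 1) → Ω) : Fin (m + 2) → Ω) l.castSucc)
    ((Fin.cons z (Fin.snoc x y : Fin (m + 1) → Ω) : Fin (m + 2) → Ω) l.succ)

lemma chain_zero (W : Ω → Ω → ℝ) (z y : Ω) (x : Fin 0 → Ω) : chain W 0 z y x = W z y := by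
  simp [chain, Fin.snoc]

lemma chain_succ (W : Ω → Ω → ℝ) (m : ℕ) (z y : Ω) (a : Ω) (x : Fin m → Ω) :
    chain W (m + 1) z y (Fin.cons a x : Fin (m + 1) → Ω) = W z a * chain W m a y x := by
  unfold chain
  rw [← Fin.cons_snoc_eq_snoc_cons, Fin.prod_univ_succ]
  simp only [Fin.castSucc_zero, Fin.cons_zero, Fin.cons_succ, ← Fin.succ_castSucc]

variable {μ : Measure Ω} [IsProbabilityMeasure μ] {W : Ω → Ω → ℝ} {B : ℝ}

lemma iter_meas (hm : Measurable (Function.uncurry W)) (m : ℕ) :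
    Measurable (Function.uncurry (iter μ W m)) := by
  induction m with
  | zero => exact hm
  | succ m ih =>
    have h : Measurable (fun q : (Ω × Ω) × Ω => W q.1.1 q.2 * iter μ W m q.2 q.1.2) := by
      apply Measurable.mul
      · exact hm.comp (by fun_prop : Measurable fun q : (Ω × Ω) × Ω => (q.1.1, q.2))
      · exact ih.comp (by fun_prop : Measurable fun q : (Ω × Ω) × Ω => (q.2, q.1.2))
    exact (h.stronglyMeasurable.integral_prod_right (ν := μ)).measurable

lemma iter_nonneg (h0 : ∀ x y, 0 ≤ W x y) (m : ℕ) (x y : Ω) : 0 ≤ iter μ W m x y := by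
  induction m generalizing x y with
  | zero => exact h0 x y
  | succ m ih => exact integral_nonneg fun t => mul_nonneg (h0 _ _) (ih _ _)

lemma integrable_of_bdd {X : Type*} [MeasurableSpace X] {ν : Measure X} [IsFiniteMeasure ν]
    {f : X → ℝ} (hf : Measurable f) (C : ℝ) (h0 : ∀ x, 0 ≤ f x) (h : ∀ x, f x ≤ C) :
    Integrable f ν :=
  Integrable.of_bound hf.aestronglyMeasurable C
    (Eventually.of_forall fun x => by rw [Real.norm_eq_abs, abs_of_nonneg (h0 x)]; exact h x)

lemma integral_le_of_bdd {X : Type*} [MeasurableSpace X] {ν : Measure X} [IsProbabilityMeasure ν]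
    {f : X → ℝ} (hf : Measurable f) (C : ℝ) (h0 : ∀ x, 0 ≤ f x) (h : ∀ x, f x ≤ C) :
    ∫ x, f x ∂ν ≤ C := by
  calc ∫ x, f x ∂ν ≤ ∫ _, C ∂ν :=
        integral_mono (integrable_of_bdd hf C h0 h) (integrable_const _) h
    _ = C := by simp

lemma iter_le (hm : Measurable (Function.uncurry W)) (h0 : ∀ x y, 0 ≤ W x y)
    (hB : ∀ x y, W x y ≤ B) (m : ℕ) (x y : Ω) :
    iter μ W m x y ≤ B ^ (m + 1) := by
  induction m generalizing x y with
  | zero => simpa [iter] using hB x y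
  | succ m ih =>
    have hB0 : 0 ≤ B := (h0 x y).trans (hB x y)
    refine integral_le_of_bdd ?_ _ (fun t => mul_nonneg (h0 _ _) (iter_nonneg h0 m _ _)) ?_
    · exact (hm.comp (by fun_prop : Measurable fun t : Ω => (x, t))).mul
        ((iter_meas hm m).comp (by fun_prop : Measurable fun t : Ω => (t, y)))
    · intro t
      rw [pow_succ']
      exact mul_le_mul (hB _ _) (ih _ _) (iter_nonneg h0 m _ _) hB0

lemma chain_meas (hm : Measurable (Function.uncurry W)) (m : ℕ) :
    Measurable (fun p : (Ω × Ω) × (Fin m → Ω) => chain W m p.1.1 p.1.2 p.2) := by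
  unfold chain
  apply Finset.measurable_prod
  intro l _
  have key : ∀ l : Fin (m + 2), Measurable (fun p : (Ω × Ω) × (Fin m → Ω) =>
      (Fin.cons p.1.1 (Fin.snoc p.2 p.1.2 : Fin (m + 1) → Ω) : Fin (m + 2) → Ω) l) := by
    intro l
    refine Fin.cases ?_ (fun i => ?_) l
    · simp only [Fin.cons_zero]; fun_prop
    · simp only [Fin.cons_succ]
      refine Fin.lastCases ?_ (fun i => ?_) i
      · simp only [Fin.snoc_last]; fun_prop
      · simp only [Fin.snoc_castSucc]; fun_prop
  exact hm.comp ((key l.castSucc).prodMk (key l.succ))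

lemma chain_nonneg (h0 : ∀ x y, 0 ≤ W x y) (m : ℕ) (z y : Ω) (x : Fin m → Ω) :
    0 ≤ chain W m z y x := Finset.prod_nonneg fun _ _ => h0 _ _

lemma chain_le (h0 : ∀ x y, 0 ≤ W x y) (hB : ∀ x y, W x y ≤ B) (m : ℕ) (z y : Ω)
    (x : Fin m → Ω) : chain W m z y x ≤ B ^ (m + 1) := by
  calc chain W m z y x ≤ ∏ _l : Fin (m + 1), B := Finset.prod_le_prod (fun _ _ => h0 _ _) (fun _ _ => hB _ _)
    _ = _ := by simp

lemma iter_eq_chain (hm : Measurable (Function.uncurry W)) (h0 : ∀ x y, 0 ≤ W x y)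
    (hB : ∀ x y, W x y ≤ B) (m : ℕ) (z y : Ω) :
    iter μ W m z y = ∫ x : Fin m → Ω, chain W m z y x ∂(Measure.pi fun _ => μ) := by
  induction m generalizing z y with
  | zero => simp [chain_zero, iter]
  | succ m ih =>
    have e := (measurePreserving_piFinSuccAbove (n := m) (fun _ : Fin (m + 1) => μ) 0).symm
    rw [← e.integral_comp']
    have h1 : ∀ p : Ω × (Fin m → Ω), chain W (m + 1) z y
        ((MeasurableEquiv.piFinSuccAbove (fun _ => Ω) 0).symm p) = W z p.1 * chain W m p.1 y p.2 := by
      intro p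
      rw [← chain_succ]
      congr 1
      simp [MeasurableEquiv.piFinSuccAbove, Fin.insertNthEquiv]
    simp only [h1]
    rw [integral_prod]
    · simp only [integral_const_mul, ← ih]; rfl
    · refine integrable_of_bdd ?_ (B * B ^ (m + 1)) (fun p => mul_nonneg (h0 _ _) (chain_nonneg h0 _ _ _ _)) ?_
      · exact (hm.comp (by fun_prop : Measurable fun p : Ω × (Fin m → Ω) => (z, p.1))).mul
          ((chain_meas hm m).comp
            (by fun_prop : Measurable fun p : Ω × (Fin m → Ω) => ((p.1, y), p.2)))
      · intro p
        exact mul_le_mul (hB _ _) (chain_le h0 hB _ _ _ _) (chain_nonneg h0 _ _ _ _)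
          ((h0 z z).trans (hB z z))

lemma mp_sigma {r : ℕ} (m : Fin r → ℕ) :
    MeasurePreserving (MeasurableEquiv.piCurry (fun (i : Fin r) (_ : Fin (m i)) => Ω)).symm
      (Measure.pi fun i => Measure.pi fun _ : Fin (m i) => μ)
      (Measure.pi fun _ : (Σ i : Fin r, Fin (m i)) => μ) := by
  refine ⟨MeasurableEquiv.measurable _, ?_⟩
  symm
  apply Measure.pi_eq
  intro s hs
  rw [MeasurableEquiv.map_apply]
  have : (MeasurableEquiv.piCurry (fun (i : Fin r) (_ : Fin (m i)) => Ω)).symm ⁻¹' (Set.univ.pi s)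
      = Set.univ.pi fun i => Set.univ.pi fun l => s ⟨i, l⟩ := by
    ext x
    simp only [Set.mem_preimage, Set.mem_univ_pi, MeasurableEquiv.coe_piCurry_symm, Sigma.forall]
    rfl
  rw [this, Measure.pi_pi]
  simp only [Measure.pi_pi]
  rw [← Finset.univ_sigma_univ, Finset.prod_sigma]

/-- The vertex set of a theta graph. -/
abbrev ThV {r : ℕ} (m : Fin r → ℕ) := Bool ⊕ (Σ i : Fin r, Fin (m i))

lemma mp_bool : MeasurePreserving (fun x : Bool → Ω => (x false, x true))
    (Measure.pi fun _ : Bool => μ) (μ.prod μ) := by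
  refine ⟨by fun_prop, ?_⟩
  symm
  apply Measure.prod_eq
  intro s t hs ht
  rw [Measure.map_apply (by fun_prop) (hs.prod ht)]
  have : (fun x : Bool → Ω => (x false, x true)) ⁻¹' (s ×ˢ t) =
      Set.univ.pi (fun b => if b then t else s) := by
    ext x; simp
  rw [this, Measure.pi_pi]; simp [mul_comm]

lemma theta_eq (hm : Measurable (Function.uncurry W)) (h0 : ∀ x y, 0 ≤ W x y)
    (hB : ∀ x y, W x y ≤ B) {r : ℕ} (m : Fin r → ℕ) :
    ∫ p, ∏ i, iter μ W (m i) p.1 p.2 ∂(μ.prod μ) =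
    ∫ x : ThV m → Ω, ∏ i, chain W (m i) (x (Sum.inl false)) (x (Sum.inl true))
      (fun l => x (Sum.inr ⟨i, l⟩)) ∂(Measure.pi fun _ => μ) := by
  have e := (measurePreserving_sumPiEquivProdPi (fun _ : ThV m => μ)).symm
  rw [← e.integral_comp']
  simp only [MeasurableEquiv.coe_sumPiEquivProdPi_symm, Equiv.sumPiEquivProdPi_symm_apply]
  have hmeas : ∀ i, Measurable (fun p : (Ω × Ω) × (Fin (m i) → Ω) => chain W (m i) p.1.1 p.1.2 p.2) :=
    fun i => chain_meas hm (m i)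
  refine Eq.trans ?_ (integral_prod _ ?_).symm
  · have h2 : ∀ w : Bool → Ω, ∫ y : (Σ i : Fin r, Fin (m i)) → Ω, ∏ i, chain W (m i) (w false) (w true)
      (fun l => y ⟨i, l⟩) ∂(Measure.pi fun _ => μ) = ∏ i, iter μ W (m i) (w false) (w true) := by
      intro w
      rw [← (mp_sigma m).integral_comp']
      simp only [iter_eq_chain hm h0 hB, MeasurableEquiv.coe_piCurry_symm]
      exact integral_fintype_prod_eq_prod (μ := fun i => Measure.pi fun _ : Fin (m i) => μ) (fun i (x : Fin (m i) → Ω) => chain W (m i) (w false) (w true) x)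
    refine Eq.trans ?_ (integral_congr_ae (Eventually.of_forall fun w => (h2 w).symm))
    have hg : Measurable (fun p : Ω × Ω => ∏ i, iter μ W (m i) p.1 p.2) :=
      Finset.measurable_prod _ fun i _ => iter_meas hm (m i)
    rw [← (mp_bool (μ := μ)).map_eq, integral_map (by fun_prop) hg.aestronglyMeasurable]
  · refine integrable_of_bdd ?_ (∏ i, B ^ (m i + 1))
      (fun p => Finset.prod_nonneg fun i _ => chain_nonneg h0 _ _ _ _)
      (fun p => Finset.prod_le_prod (fun i _ => chain_nonneg h0 _ _ _ _) fun i _ => chain_le h0 hB _ _ _ _)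
    refine Finset.measurable_prod _ fun i _ => (hmeas i).comp (f := fun p : (Bool → Ω) × ((Σ i : Fin r, Fin (m i)) → Ω) => ((p.1 false, p.1 true), fun l => p.2 ⟨i, l⟩)) ?_
    fun_prop

end Iter

end GiantAux

namespace GiantAux

open Percolation

section Theta
variable {r : ℕ} (m : Fin r → ℕ)

/-- The `i`-th path of the theta graph. -/
def thC (i : Fin r) : Fin (m i + 2) → ThV m :=
  Fin.cons (Sum.inl false) (Fin.snoc (fun l => Sum.inr ⟨i, l⟩) (Sum.inl true) : Fin (m i + 1) → ThV m)

def thPos (i : Fin r) : ThV m → ℕ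
  | Sum.inl false => 0
  | Sum.inl true => m i + 1
  | Sum.inr ⟨_, l⟩ => l + 1

def thLab : ThV m → Option (Fin r)
  | Sum.inl _ => none
  | Sum.inr ⟨i, _⟩ => some i

lemma thPos_thC (i : Fin r) (j : Fin (m i + 2)) : thPos m i (thC m i j) = j := by
  unfold thC
  refine Fin.cases ?_ (fun j => ?_) j
  · simp [thPos]
  · simp only [Fin.cons_succ]
    refine Fin.lastCases ?_ (fun j => ?_) j
    · simp [thPos]
    · simp [thPos]

lemma thLab_thC (i : Fin r) (j : Fin (m i + 2)) :
    thLab m (thC m i j) = if (j : ℕ) = 0 ∨ (j : ℕ) = m i + 1 then none else some i := by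
  unfold thC
  refine Fin.cases ?_ (fun j => ?_) j
  · simp [thLab]
  · simp only [Fin.cons_succ]
    refine Fin.lastCases ?_ (fun j => ?_) j
    · simp [thLab]
    · have := j.2.ne
      simp [thLab, this]

def thE (q : Σ i : Fin r, Fin (m i + 1)) : Sym2 (ThV m) :=
  s(thC m q.1 q.2.castSucc, thC m q.1 q.2.succ)

lemma thE_inj (hm : ∀ i, 1 ≤ m i) : Function.Injective (thE m) := by
  rintro ⟨i, a⟩ ⟨i', b⟩ h
  have hi : i = i' := by
    by_contra hne
    have h1 := thLab_thC m i a.castSucc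
    have h2 := thLab_thC m i a.succ
    have h3 := thLab_thC m i' b.castSucc
    have h4 := thLab_thC m i' b.succ
    have ha := a.2
    have hb := b.2
    have := hm i
    have := hm i'
    simp only [Fin.val_castSucc, Fin.val_succ] at h1 h2 h3 h4
    simp only [thE, Sym2.eq_iff] at h
    rcases h with ⟨e1, e2⟩ | ⟨e1, e2⟩
    · rw [e1, h3] at h1; rw [e2, h4] at h2
      clear e1 e2 h3 h4; split_ifs at h1 h2 <;> grind
    · rw [e1, h4] at h1; rw [e2, h3] at h2
      clear e1 e2 h3 h4; split_ifs at h1 h2 <;> grind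
  subst hi
  have : a = b := by
    simp only [thE, Sym2.eq_iff] at h
    have h1 := thPos_thC m i a.castSucc
    have h2 := thPos_thC m i a.succ
    have h3 := thPos_thC m i b.castSucc
    have h4 := thPos_thC m i b.succ
    simp only [Fin.val_castSucc, Fin.val_succ] at h1 h2 h3 h4
    ext
    rcases h with ⟨e1, e2⟩ | ⟨e1, e2⟩
    · rw [e1] at h1; omega
    · rw [e1] at h1; rw [e2] at h2; omega
  rw [this]

lemma thE_notDiag (q : Σ i : Fin r, Fin (m i + 1)) : ¬ (thE m q).IsDiag := by
  simp only [thE, Sym2.mk_isDiag_iff]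
  intro h
  have := congrArg (thPos m q.1) h
  rw [thPos_thC, thPos_thC] at this
  simp at this

/-- The theta graph on `Fin k`. -/
def thG : SimpleGraph (Fin (Fintype.card (ThV m))) :=
  SimpleGraph.fromEdgeSet (Set.range fun q => Sym2.map (Fintype.equivFin (ThV m)) (thE m q))

lemma edgeProd_thG (hm : ∀ i, 1 ≤ m i) (f : Fin (Fintype.card (ThV m)) → Fin (Fintype.card (ThV m)) → ℝ)
    (hf : ∀ a b, f a b = f b a) :
    edgeProd (thG m) f = ∏ i, ∏ l : Fin (m i + 1),
      f (Fintype.equivFin (ThV m) (thC m i l.castSucc)) (Fintype.equivFin (ThV m) (thC m i l.succ)) := by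
  classical
  have hE : (thG m).edgeSet = ((Finset.univ.image fun q => Sym2.map (Fintype.equivFin (ThV m)) (thE m q) :
      Finset (Sym2 (Fin (Fintype.card (ThV m))))) : Set _) := by
    rw [thG, SimpleGraph.edgeSet_fromEdgeSet]
    ext e
    simp only [Set.mem_sdiff, Set.mem_range, Finset.coe_image, Finset.coe_univ, Set.image_univ, and_iff_left_iff_imp]
    rintro ⟨q, rfl⟩ h
    apply thE_notDiag m q
    revert h
    simp only [thE, Sym2.map_mk]
    simp [Sym2.diagSet]
  have hF : edgeProd (thG m) f = ∏ e ∈ (Finset.univ.image fun q => Sym2.map (Fintype.equivFin (ThV m)) (thE m q)), sym2Val f e := by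
    unfold edgeProd
    refine Finset.prod_congr ?_ fun _ _ => rfl
    ext e
    rw [SimpleGraph.mem_edgeFinset, hE, Finset.mem_coe]
  rw [hF, Finset.prod_image, ← Finset.univ_sigma_univ, Finset.prod_sigma]
  · refine Finset.prod_congr rfl fun i _ => Finset.prod_congr rfl fun l _ => ?_
    simp only [thE, Sym2.map_mk, sym2Val, Sym2.lift_mk]
    rw [hf]; ring_nf
  · intro a _ b _ h
    exact thE_inj m hm (Sym2.map.injective (Fintype.equivFin (ThV m)).injective h)

variable {Ω : Type*} [MeasurableSpace Ω] {μ : Measure Ω} [IsProbabilityMeasure μ] {W : Ω → Ω → ℝ} {B : ℝ}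

lemma theta_density (hW : Measurable (Function.uncurry W)) (h0 : ∀ x y, 0 ≤ W x y)
    (hB : ∀ x y, W x y ≤ B) (hs : ∀ x y, W x y = W y x) (hm : ∀ i, 1 ≤ m i) :
    ∫ x : Fin (Fintype.card (ThV m)) → Ω, edgeProd (thG m) (fun i j => W (x i) (x j)) ∂(Measure.pi fun _ => μ) =
    ∫ p, ∏ i, iter μ W (m i) p.1 p.2 ∂(μ.prod μ) := by
  rw [theta_eq hW h0 hB]
  have e := measurePreserving_piCongrLeft (fun _ : Fin (Fintype.card (ThV m)) => μ) (Fintype.equivFin (ThV m))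
  rw [← e.integral_comp']
  congr 1
  ext x
  rw [edgeProd_thG m hm _ (fun a b => hs _ _)]
  refine Finset.prod_congr rfl fun i _ => ?_
  unfold chain
  have key : ∀ v : ThV m, MeasurableEquiv.piCongrLeft (fun _ => Ω) (Fintype.equivFin (ThV m)) x (Fintype.equivFin (ThV m) v) = x v := by
    intro v
    exact MeasurableEquiv.piCongrLeft_apply_apply (β := fun _ => Ω) (Fintype.equivFin (ThV m)) x v
  have key2 : ∀ j : Fin (m i + 2), x (thC m i j) = (Fin.cons (x (Sum.inl false)) (Fin.snoc (fun l => x (Sum.inr ⟨i, l⟩)) (x (Sum.inl true)) : Fin (m i + 1) → Ω) : Fin (m i + 2) → Ω) j := by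
    intro j
    unfold thC
    refine Fin.cases ?_ (fun j => ?_) j
    · simp
    · simp only [Fin.cons_succ]
      refine Fin.lastCases ?_ (fun j => ?_) j
      · simp
      · simp
  refine Finset.prod_congr rfl fun l _ => ?_
  rw [key, key, key2, key2]

/-- uniform measure -/
def unif (n : ℕ) : Measure (Fin n) := (n : ENNReal)⁻¹ • Measure.count

instance unif_prob (n : ℕ) [NeZero n] : IsProbabilityMeasure (unif n) := by
  constructor
  simp [unif, Measure.count_univ]
  exact ENNReal.inv_mul_cancel (by simp [NeZero.ne n]) (by simp)

lemma unif_real_singleton (n : ℕ) (x : Fin n) : unif n {x} = (n : ENNReal)⁻¹ := by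
  simp [unif]

lemma integral_unif (n : ℕ) [NeZero n] (f : Fin n → ℝ) :
    ∫ x, f x ∂(unif n) = (∑ x, f x) / n := by
  rw [integral_fintype (Integrable.of_finite)]
  simp [Measure.real, unif_real_singleton, Finset.mul_sum, div_eq_inv_mul]

lemma homDensityG_eq (n : ℕ) [NeZero n] {k : ℕ} (β : Fin n → Fin n → ℝ) (F : SimpleGraph (Fin k)) :
    homDensityG β F = ∫ x : Fin k → Fin n, edgeProd F (fun i j => β (x i) (x j)) ∂(Measure.pi fun _ => unif n) := by
  rw [integral_fintype (Integrable.of_finite)]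
  simp [Measure.real, Measure.pi_singleton, unif_real_singleton, homDensityG, Finset.mul_sum, div_eq_inv_mul]

/-- Lebesgue measure on the unit interval -/
def leb : Measure ℝ := volume.restrict I01

instance leb_prob : IsProbabilityMeasure leb := by
  constructor
  simp [leb, I01]

lemma homDensityW_eq {k : ℕ} (W : ℝ → ℝ → ℝ) (F : SimpleGraph (Fin k)) :
    homDensityW W F = ∫ x : Fin k → ℝ, edgeProd F (fun i j => W (x i) (x j)) ∂(Measure.pi fun _ => leb) := by
  unfold homDensityW leb
  rw [volume_pi, Measure.restrict_pi_pi]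

lemma theta_conv {β : ∀ n : ℕ, Fin n → Fin n → ℝ} {βmax : ℝ}
    (hsym : ∀ n i j, β n i j = β n j i)
    (hnonneg : ∀ n i j, 0 ≤ β n i j)
    (hbound : ∀ n i j, β n i j ≤ βmax)
    {W : ℝ → ℝ → ℝ} (hW : IsGraphon W) (hconv : ConvergesTo β W) (hm : ∀ i, 1 ≤ m i) :
    Tendsto (fun n => (∑ z, ∑ y, ∏ i, iter (unif n) (β n) (m i) z y) / (n : ℝ) ^ 2) atTop
      (𝓝 (∫ p, ∏ i, iter leb W (m i) p.1 p.2 ∂(leb.prod leb))) := by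
  obtain ⟨h1, h2, h3, M, hM⟩ := hW
  have := hconv _ (thG m)
  rw [homDensityW_eq, theta_density m h1 h2 hM h3 hm] at this
  refine this.congr' ?_
  filter_upwards [eventually_ge_atTop 1] with n hn
  have : NeZero n := ⟨by omega⟩
  rw [homDensityG_eq, theta_density m (by measurability) (hnonneg n) (hbound n) (hsym n) hm,
    integral_prod _ (Integrable.of_finite)]
  simp only [integral_unif, Finset.sum_div]
  refine Finset.sum_congr rfl fun z _ => Finset.sum_congr rfl fun y _ => ?_
  ring

end Theta
end GiantAux

namespace GiantAux

open Percolation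

section PosW
variable {W : ℝ → ℝ → ℝ}

lemma W_slice (hm : Measurable (Function.uncurry W)) (x : ℝ) : Measurable (W x) :=
  hm.comp (by fun_prop : Measurable fun y : ℝ => (x, y))

lemma ae_zero_of_int {X : Type*} [MeasurableSpace X] {ν : Measure X} [IsFiniteMeasure ν]
    {f : X → ℝ} (hf : Measurable f) (C : ℝ) (h0 : ∀ x, 0 ≤ f x) (h : ∀ x, f x ≤ C)
    (hi : ∫ x, f x ∂ν = 0) : ∀ᵐ x ∂ν, f x = 0 :=
  (integral_eq_zero_iff_of_nonneg h0 (integrable_of_bdd hf C h0 h)).1 hi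

lemma cut_lemma (hW : IsGraphon W) (hirr : Percolation.Irreducible W) (A : Set ℝ)
    (hA : MeasurableSet A) (h : ∀ x ∈ A, ∀ᵐ y ∂leb, y ∉ A → W x y = 0) :
    leb A = 0 ∨ leb Aᶜ = 0 := by
  by_contra hcon
  push Not at hcon
  apply hirr
  refine ⟨A ∩ I01, hA.inter measurableSet_Icc, Set.inter_subset_right, ?_, ?_, ?_⟩
  · rw [leb, Measure.restrict_apply hA] at hcon
    exact pos_iff_ne_zero.2 hcon.1
  · have h1 : leb A < 1 := by
      refine lt_of_le_of_ne prob_le_one ?_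
      intro h1
      exact hcon.2 ((prob_compl_eq_zero_iff hA).2 h1)
    rwa [leb, Measure.restrict_apply hA] at h1
  · have hS : MeasurableSet {p : ℝ × ℝ | ¬ (p.1 ∈ A ∩ I01 → p.2 ∈ I01 \ (A ∩ I01) → W p.1 p.2 = 0)} := by
      have hA2 := hA.inter (measurableSet_Icc : MeasurableSet (Set.Icc (0:ℝ) 1))
      have hW' : MeasurableSet {p : ℝ × ℝ | W p.1 p.2 = 0} := hW.1 (measurableSet_singleton 0)
      have : {p : ℝ × ℝ | ¬ (p.1 ∈ A ∩ I01 → p.2 ∈ I01 \ (A ∩ I01) → W p.1 p.2 = 0)} =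
          (Prod.fst ⁻¹' (A ∩ I01)) ∩ (Prod.snd ⁻¹' (I01 \ (A ∩ I01))) ∩ {p : ℝ × ℝ | W p.1 p.2 = 0}ᶜ := by
        ext p; simp only [Set.mem_ofPred_eq, Set.mem_inter_iff, Set.mem_preimage, Set.mem_compl_iff]; tauto
      rw [this]
      exact ((measurable_fst hA2).inter (measurable_snd ((measurableSet_Icc).diff hA2))).inter hW'.compl
    rw [ae_iff, Measure.volume_eq_prod, Measure.measure_prod_null hS]
    refine Eventually.of_forall fun x => ?_
    by_cases hx : x ∈ A
    · have := h x hx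
      rw [leb, ae_restrict_iff' (by exact measurableSet_Icc)] at this
      refine measure_mono_null ?_ (ae_iff.1 this)
      intro y hy
      simp only [Set.mem_preimage, Set.mem_ofPred_eq, Set.mem_sdiff, Set.mem_inter_iff] at hy ⊢
      tauto
    · have : (Prod.mk x ⁻¹' {p : ℝ × ℝ | ¬ (p.1 ∈ A ∩ I01 → p.2 ∈ I01 \ (A ∩ I01) → W p.1 p.2 = 0)}) = ∅ := by
        ext y; simp [hx]
      beta_reduce
      rw [this]; simp

lemma deg_pos (hW : IsGraphon W) (hirr : Percolation.Irreducible W) (hT : 0 < opNorm W) :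
    ∀ᵐ x ∂leb, 0 < ∫ y, W x y ∂leb := by
  obtain ⟨h1, h2, h3, M, hM⟩ := id hW
  have hmeas : Measurable fun x => ∫ y, W x y ∂leb :=
    (h1.stronglyMeasurable.integral_prod_right (ν := leb)).measurable
  have hsl : ∀ x, (∫ y, W x y ∂leb) = 0 → ∀ᵐ y ∂leb, W x y = 0 := fun x hx =>
    ae_zero_of_int (W_slice h1 x) M (h2 x) (hM x) hx
  have hA : MeasurableSet {x | (∫ y, W x y ∂leb) = 0} := hmeas (measurableSet_singleton 0)
  have key := cut_lemma hW hirr _ hA (fun x hx => (hsl x hx).mono fun y hy _ => hy)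
  rcases key with h | h
  · have : ∀ᵐ x ∂leb, ¬ (∫ y, W x y ∂leb) = 0 := by
      rw [ae_iff]; simpa using h
    filter_upwards [this] with x hx
    exact lt_of_le_of_ne (integral_nonneg (h2 x)) (Ne.symm hx)
  · exfalso
    have h' : ∀ᵐ x ∂leb, (∫ y, W x y ∂leb) = 0 := h
    have : opNorm W ≤ 0 := by
      apply Real.sSup_nonpos
      rintro r ⟨f, hf, hf2, hf3, rfl⟩
      unfold l2norm
      have : ∫ x in I01, applyT W f x ^ 2 = 0 := by
        rw [integral_eq_zero_of_ae]
        change ∀ᵐ x ∂leb, _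
        filter_upwards [h'] with x hx
        have : applyT W f x = 0 := by
          unfold applyT
          rw [integral_eq_zero_of_ae]
          change ∀ᵐ y ∂leb, _
          filter_upwards [hsl x hx] with y hy
          simp [hy]
        simp [this]
      rw [this]; simp
    linarith

lemma iter_pos (hW : IsGraphon W) (hirr : Percolation.Irreducible W) (hT : 0 < opNorm W) :
    ∀ᵐ p ∂(leb.prod leb), ∃ m, 0 < iter leb W (m + 1) p.1 p.2 := by
  obtain ⟨h1, h2, h3, M, hM⟩ := id hW
  have hdeg := deg_pos hW hirr hT
  have im := fun m => iter_meas (μ := leb) h1 m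
  have main : ∀ᵐ y ∂leb, ∀ᵐ x ∂leb, ∃ m, 0 < iter leb W (m + 1) x y := by
    filter_upwards [hdeg] with y hy
    have hms : ∀ m, Measurable (fun x => iter leb W m x y) := fun m =>
      (im m).comp (by fun_prop : Measurable fun x : ℝ => (x, y))
    set A : Set ℝ := ⋂ m, {x | iter leb W (m + 1) x y = 0} with hAdef
    have hA : MeasurableSet A := MeasurableSet.iInter fun m => hms (m + 1) (measurableSet_singleton 0)
    have hnn : ∀ m x, 0 ≤ iter leb W m x y := fun m x => iter_nonneg h2 m x y
    have hcut := cut_lemma hW hirr A hA (by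
      intro x hx
      have hx' : ∀ m, ∀ᵐ t ∂leb, W x t * iter leb W (m + 1) t y = 0 := by
        intro m
        have hxm : iter leb W (m + 2) x y = 0 := Set.mem_iInter.1 hx (m + 1)
        refine ae_zero_of_int ((W_slice h1 x).mul (hms (m + 1))) (M * M ^ (m + 1 + 1))
          (fun t => mul_nonneg (h2 _ _) (hnn _ _)) (fun t => ?_) hxm
        exact mul_le_mul (hM _ _) (iter_le h1 h2 hM _ _ _) (hnn _ _) ((h2 0 0).trans (hM 0 0))
      filter_upwards [ae_all_iff.2 hx'] with t ht htA
      by_contra hne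
      apply htA
      refine Set.mem_iInter.2 fun m => ?_
      exact (mul_eq_zero.1 (ht m)).resolve_left hne)
    rcases hcut with h | h
    · have : ∀ᵐ x ∂leb, x ∉ A := by rw [ae_iff]; simpa using h
      filter_upwards [this] with x hx
      by_contra hcon
      push Not at hcon
      exact hx (Set.mem_iInter.2 fun m => le_antisymm (hcon m) (hnn _ _))
    · exfalso
      have h0 : ∀ᵐ x ∂leb, iter leb W 1 x y = 0 := by
        filter_upwards [show ∀ᵐ x ∂leb, x ∈ A from h] with x hx
        exact Set.mem_iInter.1 hx 0
      have hI : ∫ x, ∫ t, W x t * W t y ∂leb ∂leb = 0 := by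
        rw [integral_eq_zero_of_ae]; exact h0
      have hmm : Measurable (fun p : ℝ × ℝ => W p.1 p.2 * W p.2 y) :=
        h1.mul (h1.comp (by fun_prop : Measurable fun p : ℝ × ℝ => (p.2, y)))
      have hM0 : 0 ≤ M := (h2 0 0).trans (hM 0 0)
      have hint : Integrable (Function.uncurry fun x t => W x t * W t y) (leb.prod leb) :=
        integrable_of_bdd hmm (M * M) (fun p => mul_nonneg (h2 _ _) (h2 _ _))
        (fun p => mul_le_mul (hM _ _) (hM _ _) (h2 _ _) hM0)
      rw [integral_integral_swap hint] at hI
      have hmeas : Measurable fun x => ∫ y, W x y ∂leb :=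
        (h1.stronglyMeasurable.integral_prod_right (ν := leb)).measurable
      simp only [integral_mul_const] at hI
      have hmy : Measurable (fun t => W t y) := h1.comp (by fun_prop : Measurable fun t : ℝ => (t, y))
      have hsw : ∀ t, ∫ x, W x t ∂leb = ∫ x, W t x ∂leb := fun t => by simp only [h3 _ t]
      simp only [hsw] at hI
      have hz := ae_zero_of_int (hmeas.mul hmy) (M * M)
        (fun t => mul_nonneg (integral_nonneg (h2 t)) (h2 _ _))
        (fun t => mul_le_mul (integral_le_of_bdd (W_slice h1 t) M (h2 t) (hM t)) (hM _ _) (h2 _ _) hM0) hI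
      have : ∫ t, W y t ∂leb = 0 := by
        rw [integral_eq_zero_of_ae]
        filter_upwards [hz, hdeg] with t ht hd
        rw [h3]
        exact (mul_eq_zero.1 ht).resolve_left hd.ne'
      linarith
  have hmS : MeasurableSet {p : ℝ × ℝ | ∃ m, 0 < iter leb W (m + 1) p.2 p.1} := by
    rw [Set.ofPred_exists]
    refine MeasurableSet.iUnion fun m => ?_
    exact measurableSet_lt measurable_const
      ((im (m + 1)).comp (by fun_prop : Measurable fun p : ℝ × ℝ => (p.2, p.1)))
  have h5 : ∀ᵐ p ∂(leb.prod leb), ∃ m, 0 < iter leb W (m + 1) p.2 p.1 := by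
    change (leb.prod leb) ({p : ℝ × ℝ | ∃ m, 0 < iter leb W (m + 1) p.2 p.1}ᶜ) = 0
    rw [Measure.measure_prod_null hmS.compl]
    filter_upwards [main] with y hy
    exact ae_iff.1 hy
  have := (Measure.measurePreserving_swap (μ := leb) (ν := leb)).quasiMeasurePreserving.ae h5
  simpa using this

end PosW
end GiantAux

namespace GiantAux

open Percolation

section STransfer

/-- weights -/
def wt (B : ℝ) (m : ℕ) : ℝ := (1 / 2) ^ (m + 1) / B ^ (m + 2)

lemma wt_pos {B : ℝ} (hB : 1 ≤ B) (m : ℕ) : 0 < wt B m := by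
  have : 0 < B := by linarith
  unfold wt; positivity

def gS {Ω : Type*} [MeasurableSpace Ω] (μ : Measure Ω) (W : Ω → Ω → ℝ) (B : ℝ) (j : ℕ) (x y : Ω) : ℝ :=
  ∑ m ∈ Finset.range j, wt B m * iter μ W (m + 1) x y

section
variable {Ω : Type*} [MeasurableSpace Ω] {μ : Measure Ω} {W : Ω → Ω → ℝ} {B : ℝ}

lemma gS_pow (j r : ℕ) (x y : Ω) : gS μ W B j x y ^ r =
    ∑ φ ∈ Fintype.piFinset (fun _ : Fin r => Finset.range j),
      (∏ i, wt B (φ i)) * ∏ i, iter μ W (φ i + 1) x y := by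
  have : gS μ W B j x y ^ r = ∏ _i : Fin r, gS μ W B j x y := by simp
  rw [this]
  unfold gS
  rw [Finset.prod_univ_sum]
  simp only [Finset.prod_mul_distrib]

lemma one_sub_gS_pow (j r : ℕ) (x y : Ω) : (1 - gS μ W B j x y) ^ r =
    ∑ s ∈ Finset.range (r + 1), ((-1) ^ s * (r.choose s : ℝ)) * gS μ W B j x y ^ s := by
  rw [sub_eq_neg_add, add_pow]
  refine Finset.sum_congr rfl fun s _ => ?_
  rw [neg_pow]; ring
variable [IsProbabilityMeasure μ]

lemma gS_nonneg (h0 : ∀ x y, 0 ≤ W x y) (hB1 : 1 ≤ B) (j : ℕ) (x y : Ω) : 0 ≤ gS μ W B j x y :=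
  Finset.sum_nonneg fun m _ => mul_nonneg (wt_pos hB1 m).le (iter_nonneg h0 _ _ _)

lemma gS_le (hm : Measurable (Function.uncurry W)) (h0 : ∀ x y, 0 ≤ W x y)
    (hB : ∀ x y, W x y ≤ B) (hB1 : 1 ≤ B) (j : ℕ) (x y : Ω) : gS μ W B j x y ≤ 1 := by
  have hB0 : 0 < B := by linarith
  have h1 : gS μ W B j x y ≤ ∑ m ∈ Finset.range j, (1 / 2 : ℝ) ^ (m + 1) := by
    refine Finset.sum_le_sum fun m _ => ?_
    calc wt B m * iter μ W (m + 1) x y ≤ wt B m * B ^ (m + 1 + 1) :=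
          mul_le_mul_of_nonneg_left (iter_le hm h0 hB _ _ _) (wt_pos hB1 m).le
      _ = (1 / 2) ^ (m + 1) := by unfold wt; field_simp
  have h2 : ∀ j : ℕ, ∑ m ∈ Finset.range j, (1 / 2 : ℝ) ^ (m + 1) = 1 - (1 / 2) ^ j := by
    intro j
    induction j with
    | zero => simp
    | succ j ih => rw [Finset.sum_range_succ, ih]; ring
  rw [h2] at h1
  have : (0 : ℝ) < (1 / 2) ^ j := by positivity
  linarith

lemma gS_meas (hm : Measurable (Function.uncurry W)) (j : ℕ) :
    Measurable fun p : Ω × Ω => gS μ W B j p.1 p.2 := by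
  unfold gS
  refine Finset.measurable_sum _ fun m _ => ?_
  exact (iter_meas (μ := μ) hm (m + 1)).const_mul _

end

variable {β : ∀ n : ℕ, Fin n → Fin n → ℝ} {βmax : ℝ} {W : ℝ → ℝ → ℝ}

lemma gS_conv (hsym : ∀ n i j, β n i j = β n j i)
    (hnonneg : ∀ n i j, 0 ≤ β n i j)
    (hbound : ∀ n i j, β n i j ≤ βmax)
    (hW : IsGraphon W) (hconv : ConvergesTo β W) {B : ℝ} (hB1 : 1 ≤ B) (hBW : ∀ x y, W x y ≤ B) (j r : ℕ) :
    Tendsto (fun n => (∑ z, ∑ y, gS (unif n) (β n) B j z y ^ r) / (n : ℝ) ^ 2) atTop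
      (𝓝 (∫ p, gS leb W B j p.1 p.2 ^ r ∂(leb.prod leb))) := by
  simp only [gS_pow]
  have hI : ∀ φ : Fin r → ℕ, Integrable (fun p : ℝ × ℝ => (∏ i, wt B (φ i)) * ∏ i, iter leb W (φ i + 1) p.1 p.2) (leb.prod leb) := by
    intro φ
    refine Integrable.const_mul ?_ _
    refine integrable_of_bdd ?_ (∏ i, B ^ (φ i + 1 + 1)) ?_ ?_
    · exact Finset.measurable_prod _ fun i _ => iter_meas hW.1 _
    · exact fun p => Finset.prod_nonneg fun i _ => iter_nonneg hW.2.1 _ _ _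
    · exact fun p => Finset.prod_le_prod (fun i _ => iter_nonneg hW.2.1 _ _ _)
        (fun i _ => iter_le hW.1 hW.2.1 hBW _ _ _)
  rw [integral_finsetSum _ fun φ _ => hI φ]
  have : ∀ n : ℕ, (∑ z, ∑ y, ∑ φ ∈ Fintype.piFinset (fun _ : Fin r => Finset.range j),
      (∏ i, wt B (φ i)) * ∏ i, iter (unif n) (β n) (φ i + 1) z y) / (n : ℝ) ^ 2 =
      ∑ φ ∈ Fintype.piFinset (fun _ : Fin r => Finset.range j),
      (∏ i, wt B (φ i)) * ((∑ z, ∑ y, ∏ i, iter (unif n) (β n) (φ i + 1) z y) / (n : ℝ) ^ 2) := by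
    intro n
    have : ∀ z, ∑ y, ∑ φ ∈ Fintype.piFinset (fun _ : Fin r => Finset.range j),
      (∏ i, wt B (φ i)) * ∏ i, iter (unif n) (β n) (φ i + 1) z y =
      ∑ φ ∈ Fintype.piFinset (fun _ : Fin r => Finset.range j), ∑ y,
      (∏ i, wt B (φ i)) * ∏ i, iter (unif n) (β n) (φ i + 1) z y := fun z => Finset.sum_comm
    simp only [this]
    rw [Finset.sum_comm, Finset.sum_div]
    refine Finset.sum_congr rfl fun φ _ => ?_
    simp only [← Finset.mul_sum]
    rw [mul_div_assoc]
  simp only [this]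
  refine tendsto_finsetSum _ fun φ _ => ?_
  rw [integral_const_mul]
  exact (theta_conv (fun i => φ i + 1) hsym hnonneg hbound hW hconv (fun i => by omega)).const_mul _

lemma gS1_conv (hsym : ∀ n i j, β n i j = β n j i)
    (hnonneg : ∀ n i j, 0 ≤ β n i j)
    (hbound : ∀ n i j, β n i j ≤ βmax)
    (hW : IsGraphon W) (hconv : ConvergesTo β W) {B : ℝ} (hB1 : 1 ≤ B) (hBW : ∀ x y, W x y ≤ B) (j r : ℕ) :
    Tendsto (fun n => (∑ z, ∑ y, (1 - gS (unif n) (β n) B j z y) ^ r) / (n : ℝ) ^ 2) atTop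
      (𝓝 (∫ p, (1 - gS leb W B j p.1 p.2) ^ r ∂(leb.prod leb))) := by
  simp only [one_sub_gS_pow]
  have hI : ∀ s : ℕ, Integrable (fun p : ℝ × ℝ => ((-1) ^ s * (r.choose s : ℝ)) * gS leb W B j p.1 p.2 ^ s) (leb.prod leb) := by
    intro s
    refine Integrable.const_mul ?_ _
    refine integrable_of_bdd ((gS_meas hW.1 j).pow_const s) 1 ?_ ?_
    · exact fun p => pow_nonneg (gS_nonneg hW.2.1 hB1 _ _ _) _
    · exact fun p => pow_le_one₀ (gS_nonneg hW.2.1 hB1 _ _ _) (gS_le hW.1 hW.2.1 hBW hB1 _ _ _)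
  rw [integral_finsetSum _ fun s _ => hI s]
  have : ∀ n : ℕ, (∑ z, ∑ y, ∑ s ∈ Finset.range (r + 1),
      ((-1) ^ s * (r.choose s : ℝ)) * gS (unif n) (β n) B j z y ^ s) / (n : ℝ) ^ 2 =
      ∑ s ∈ Finset.range (r + 1), ((-1) ^ s * (r.choose s : ℝ)) *
        ((∑ z, ∑ y, gS (unif n) (β n) B j z y ^ s) / (n : ℝ) ^ 2) := by
    intro n
    have : ∀ z, ∑ y, ∑ s ∈ Finset.range (r + 1),
      ((-1) ^ s * (r.choose s : ℝ)) * gS (unif n) (β n) B j z y ^ s =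
      ∑ s ∈ Finset.range (r + 1), ∑ y,
      ((-1) ^ s * (r.choose s : ℝ)) * gS (unif n) (β n) B j z y ^ s := fun z => Finset.sum_comm
    simp only [this]
    rw [Finset.sum_comm, Finset.sum_div]
    refine Finset.sum_congr rfl fun φ _ => ?_
    simp only [← Finset.mul_sum]
    rw [mul_div_assoc]
  simp only [this]
  refine tendsto_finsetSum _ fun s _ => ?_
  rw [integral_const_mul]
  exact (gS_conv hsym hnonneg hbound hW hconv hB1 hBW j s).const_mul _

lemma gS_lim (hW : IsGraphon W) (hirr : Percolation.Irreducible W) (hT : 0 < opNorm W)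
    {B : ℝ} (hB1 : 1 ≤ B) (hBW : ∀ x y, W x y ≤ B) :
    Tendsto (fun j => ∫ p, (1 - gS leb W B j p.1 p.2) ^ j ∂(leb.prod leb)) atTop (𝓝 0) := by
  have h0 : (0 : ℝ) = ∫ p : ℝ × ℝ, (0 : ℝ) ∂(leb.prod leb) := by simp
  rw [h0]
  refine tendsto_integral_of_dominated_convergence (fun _ => 1) ?_ (integrable_const _) ?_ ?_
  · exact fun j => ((measurable_const.sub (gS_meas hW.1 j)).pow_const j).aestronglyMeasurable
  · intro j
    refine Eventually.of_forall fun p => ?_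
    have h1 := gS_nonneg (μ := leb) hW.2.1 hB1 j p.1 p.2
    have h2 := gS_le (μ := leb) hW.1 hW.2.1 hBW hB1 j p.1 p.2
    rw [Real.norm_eq_abs, abs_of_nonneg (pow_nonneg (by linarith) _)]
    exact pow_le_one₀ (by linarith) (by linarith)
  · filter_upwards [iter_pos hW hirr hT] with p hp
    obtain ⟨m, hm⟩ := hp
    set c := wt B m * iter leb W (m + 1) p.1 p.2 with hc
    have hc0 : 0 < c := mul_pos (wt_pos hB1 m) hm
    have hcj : ∀ j, m < j → c ≤ gS leb W B j p.1 p.2 := fun j hj =>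
      Finset.single_le_sum (f := fun m => wt B m * iter leb W (m + 1) p.1 p.2)
        (fun i _ => mul_nonneg (wt_pos hB1 i).le (iter_nonneg hW.2.1 _ _ _)) (Finset.mem_range.2 hj)
    have h2 := fun j => gS_le (μ := leb) hW.1 hW.2.1 hBW hB1 j p.1 p.2
    have hc1 : c ≤ 1 := (hcj (m + 1) (by omega)).trans (h2 _)
    refine squeeze_zero' (g := fun j => (1 - c) ^ j) ?_ ?_ (tendsto_pow_atTop_nhds_zero_of_lt_one (by linarith) (by linarith))
    · exact Eventually.of_forall fun j => pow_nonneg (by linarith [h2 j]) _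
    · filter_upwards [eventually_gt_atTop m] with j hj
      exact pow_le_pow_left₀ (by linarith [h2 j]) (by linarith [hcj j hj]) _

lemma S_transfer (hsym : ∀ n i j, β n i j = β n j i)
    (hnonneg : ∀ n i j, 0 ≤ β n i j)
    (hbound : ∀ n i j, β n i j ≤ βmax)
    (hW : IsGraphon W) (hconv : ConvergesTo β W) (hirr : Percolation.Irreducible W) (hT : 0 < opNorm W)
    (ε : ℝ) (hε : 0 < ε) :
    ∃ (M : ℕ) (w : ℕ → ℝ) (η : ℝ), (∀ m, 0 ≤ w m) ∧ 0 < η ∧ ∀ᶠ n : ℕ in atTop,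
      ((Finset.univ.filter fun p : Fin n × Fin n =>
        (∑ m ∈ Finset.range M, w m * iter (unif n) (β n) (m + 1) p.1 p.2) < η).card : ℝ) ≤ ε * (n : ℝ) ^ 2 := by
  obtain ⟨M0, hM0⟩ := hW.2.2.2
  set B : ℝ := max 1 (max M0 βmax) with hB
  have hB1 : 1 ≤ B := le_max_left _ _
  have hBW : ∀ x y, W x y ≤ B := fun x y => (hM0 x y).trans ((le_max_left _ _).trans (le_max_right _ _))
  have hBβ : ∀ n i j, β n i j ≤ B := fun n x y => (hbound n x y).trans ((le_max_right _ _).trans (le_max_right _ _))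
  have h1 := gS_lim hW hirr hT hB1 hBW
  obtain ⟨j, hj⟩ := (h1.eventually (gt_mem_nhds (show (0 : ℝ) < ε / 4 by linarith))).exists
  have h2 := (gS1_conv hsym hnonneg hbound hW hconv hB1 hBW j j).eventually (gt_mem_nhds hj)
  refine ⟨j, wt B, 1 / (2 * (j + 1)), fun m => (wt_pos hB1 m).le, by positivity, ?_⟩
  filter_upwards [h2, eventually_ge_atTop 1] with n hn hn1
  have : NeZero n := ⟨by omega⟩
  have hn0 : (0 : ℝ) < (n : ℝ) ^ 2 := by positivity
  rw [div_lt_iff₀ hn0] at hn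
  rw [← Fintype.sum_prod_type'] at hn
  have hnn : ∀ p : Fin n × Fin n, 0 ≤ (1 - gS (unif n) (β n) B j p.1 p.2) ^ j := fun p =>
    pow_nonneg (by linarith [gS_le (μ := unif n) Measurable.of_discrete (hnonneg n) (hBβ n) hB1 j p.1 p.2]) _
  have h3 : ∑ p ∈ (Finset.univ.filter fun p : Fin n × Fin n =>
        (∑ m ∈ Finset.range j, wt B m * iter (unif n) (β n) (m + 1) p.1 p.2) < 1 / (2 * (j + 1))), (1 / 2 : ℝ) ≤
      ∑ p : Fin n × Fin n, (1 - gS (unif n) (β n) B j p.1 p.2) ^ j := by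
    refine (Finset.sum_le_sum ?_).trans (Finset.sum_le_sum_of_subset_of_nonneg (Finset.filter_subset _ _) fun p _ _ => hnn p)
    intro p hp
    have hp' : gS (unif n) (β n) B j p.1 p.2 < 1 / (2 * (j + 1)) := (Finset.mem_filter.1 hp).2
    have hge := gS_nonneg (μ := unif n) (hnonneg n) hB1 j p.1 p.2
    have hle := gS_le (μ := unif n) Measurable.of_discrete (hnonneg n) (hBβ n) hB1 j p.1 p.2
    have hb := one_add_mul_le_pow (a := - gS (unif n) (β n) B j p.1 p.2) (by linarith) j
    have : (j : ℝ) * gS (unif n) (β n) B j p.1 p.2 ≤ 1 / 2 := by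
      calc (j : ℝ) * gS (unif n) (β n) B j p.1 p.2 ≤ j * (1 / (2 * (j + 1))) :=
            mul_le_mul_of_nonneg_left hp'.le (by positivity)
        _ ≤ 1 / 2 := by
          rw [mul_one_div, div_le_div_iff₀ (by positivity) (by norm_num)]; linarith
    calc (1 / 2 : ℝ) ≤ 1 + j * (- gS (unif n) (β n) B j p.1 p.2) := by linarith
      _ ≤ (1 + - gS (unif n) (β n) B j p.1 p.2) ^ j := hb
      _ = _ := by rw [← sub_eq_add_neg]
  rw [Finset.sum_const, nsmul_eq_mul] at h3
  nlinarith [h3, hn]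

end STransfer
end GiantAux

namespace GiantAux

open Percolation

section OpN

def Top {Ω : Type*} [MeasurableSpace Ω] (μ : Measure Ω) (W : Ω → Ω → ℝ) (f : Ω → ℝ) (x : Ω) : ℝ :=
  ∫ y, W x y * f y ∂μ

def BN {Ω : Type*} [MeasurableSpace Ω] (f : Ω → ℝ) : Prop :=
  Measurable f ∧ (∀ x, 0 ≤ f x) ∧ ∃ C, ∀ x, f x ≤ C

lemma cs_int {X : Type*} [MeasurableSpace X] {ν : Measure X} {u v : X → ℝ} (hu : AEStronglyMeasurable u ν)
    (hv : AEStronglyMeasurable v ν)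
    (hu2 : Integrable (fun x => u x ^ 2) ν) (hv2 : Integrable (fun x => v x ^ 2) ν) :
    (∫ x, u x * v x ∂ν) ^ 2 ≤ (∫ x, u x ^ 2 ∂ν) * ∫ x, v x ^ 2 ∂ν := by
  have huv : Integrable (fun x => u x * v x) ν := by
    refine (hu2.add hv2).mono (hu.mul hv) (Eventually.of_forall fun x => ?_)
    simp only [Pi.add_apply, Real.norm_eq_abs]
    rw [abs_of_nonneg (by positivity : 0 ≤ u x ^ 2 + v x ^ 2), abs_le]
    constructor <;> nlinarith [sq_nonneg (u x + v x), sq_nonneg (u x - v x), sq_nonneg (u x), sq_nonneg (v x)]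
  have h : ∀ t : ℝ, 0 ≤ (∫ x, u x ^ 2 ∂ν) * (t * t) + (2 * ∫ x, u x * v x ∂ν) * t + ∫ x, v x ^ 2 ∂ν := by
    intro t
    have : (∫ x, u x ^ 2 ∂ν) * (t * t) + (2 * ∫ x, u x * v x ∂ν) * t + ∫ x, v x ^ 2 ∂ν =
        ∫ x, (t * u x + v x) ^ 2 ∂ν := by
      have e : ∀ x, (t * u x + v x) ^ 2 = (t * t) * u x ^ 2 + (2 * t) * (u x * v x) + v x ^ 2 := fun x => by ring
      simp only [e]
      have i1 : Integrable (fun x => (t * t) * u x ^ 2 + (2 * t) * (u x * v x)) ν :=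
        (hu2.const_mul _).add (huv.const_mul _)
      rw [integral_add i1 hv2, integral_add (hu2.const_mul _) (huv.const_mul _),
        integral_const_mul, integral_const_mul]
      ring
    rw [this]
    exact integral_nonneg fun x => sq_nonneg _
  have := discrim_le_zero h
  unfold discrim at this
  nlinarith

variable {Ω : Type*} [MeasurableSpace Ω] {μ : Measure Ω} [IsProbabilityMeasure μ] {W : Ω → Ω → ℝ} {B : ℝ}

lemma Top_meas (hm : Measurable (Function.uncurry W)) {f : Ω → ℝ} (hf : Measurable f) :
    Measurable (Top μ W f) := by
  have h : Measurable (Function.uncurry fun x y => W x y * f y) := hm.mul (hf.comp measurable_snd)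
  exact (h.stronglyMeasurable.integral_prod_right (ν := μ)).measurable

lemma slice_meas (hm : Measurable (Function.uncurry W)) (x : Ω) : Measurable (W x) :=
  hm.comp (by fun_prop : Measurable fun y : Ω => (x, y))

lemma BN.integrable {f : Ω → ℝ} (hf : BN f) : Integrable f μ := by
  obtain ⟨h1, h2, C, hC⟩ := hf
  exact integrable_of_bdd h1 C h2 hC

lemma BN.mul {f g : Ω → ℝ} (hf : BN f) (hg : BN g) : BN fun x => f x * g x := by
  obtain ⟨h1, h2, C, hC⟩ := hf
  obtain ⟨h1', h2', C', hC'⟩ := hg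
  exact ⟨h1.mul h1', fun x => mul_nonneg (h2 x) (h2' x), C * C', fun x =>
    mul_le_mul (hC x) (hC' x) (h2' x) ((h2 x).trans (hC x))⟩

lemma BN.one : BN (fun _ : Ω => (1 : ℝ)) := ⟨measurable_const, fun _ => zero_le_one, 1, fun _ => le_rfl⟩

lemma W_BN (hm : Measurable (Function.uncurry W)) (h0 : ∀ x y, 0 ≤ W x y)
    (hB : ∀ x y, W x y ≤ B) (x : Ω) : BN (W x) := ⟨slice_meas hm x, h0 x, B, hB x⟩

lemma BN.Top (hm : Measurable (Function.uncurry W)) (h0 : ∀ x y, 0 ≤ W x y)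
    (hB : ∀ x y, W x y ≤ B) {f : Ω → ℝ} (hf : BN f) : BN (Top μ W f) := by
  refine ⟨Top_meas hm hf.1, fun x => integral_nonneg fun y => mul_nonneg (h0 _ _) (hf.2.1 _), ?_⟩
  obtain ⟨h1, h2, C, hC⟩ := hf
  refine ⟨B * C, fun x => ?_⟩
  exact integral_le_of_bdd ((slice_meas hm x).mul h1) _ (fun y => mul_nonneg (h0 _ _) (h2 _))
    (fun y => mul_le_mul (hB _ _) (hC _) (h2 _) ((h0 x x).trans (hB _ _)))

lemma Top_iter_BN (hm : Measurable (Function.uncurry W)) (h0 : ∀ x y, 0 ≤ W x y)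
    (hB : ∀ x y, W x y ≤ B) {f : Ω → ℝ} (hf : BN f) (k : ℕ) : BN ((Top μ W)^[k] f) := by
  induction k with
  | zero => exact hf
  | succ k ih => rw [Function.iterate_succ_apply']; exact ih.Top hm h0 hB

lemma Top_adj (hm : Measurable (Function.uncurry W)) (h0 : ∀ x y, 0 ≤ W x y)
    (hB : ∀ x y, W x y ≤ B) (hs : ∀ x y, W x y = W y x) {u v : Ω → ℝ} (hu : Measurable u)
    (hui : Integrable u μ) (hv : BN v) :
    ∫ x, Top μ W u x * v x ∂μ = ∫ x, u x * Top μ W v x ∂μ := by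
  obtain ⟨hv1, hv2, C, hC⟩ := hv
  have hint : Integrable (Function.uncurry fun x y => W x y * u y * v x) (μ.prod μ) := by
    have h1 : Integrable (fun p : Ω × Ω => (B * C) * u p.2) (μ.prod μ) := (hui.comp_snd μ).const_mul _
    refine h1.mono ((hm.mul (hu.comp measurable_snd)).mul (hv1.comp measurable_fst)).aestronglyMeasurable ?_
    refine Eventually.of_forall fun p => ?_
    have hB0 : 0 ≤ B := (h0 p.1 p.1).trans (hB _ _)
    have hC0 : 0 ≤ C := (hv2 p.1).trans (hC _)
    simp only [Function.uncurry, norm_mul, Real.norm_eq_abs]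
    rw [abs_of_nonneg (h0 _ _), abs_of_nonneg (hv2 _), abs_of_nonneg hB0, abs_of_nonneg hC0]
    calc W p.1 p.2 * |u p.2| * v p.1 ≤ B * |u p.2| * C := by
          have := h0 p.1 p.2; have := hB p.1 p.2; have := hC p.1; have := hv2 p.1
          gcongr
      _ = _ := by ring
  calc ∫ x, Top μ W u x * v x ∂μ = ∫ x, ∫ y, W x y * u y * v x ∂μ ∂μ := by
        simp only [integral_mul_const, Top]
    _ = ∫ y, ∫ x, W x y * u y * v x ∂μ ∂μ := integral_integral_swap hint
    _ = _ := by
        simp only [Top, ← integral_const_mul]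
        refine integral_congr_ae (Eventually.of_forall fun y => ?_)
        refine integral_congr_ae (Eventually.of_forall fun x => ?_)
        simp only [hs y x]; ring

lemma iter_apply (hm : Measurable (Function.uncurry W)) (h0 : ∀ x y, 0 ≤ W x y)
    (hB : ∀ x y, W x y ≤ B) {f : Ω → ℝ} (hf : BN f) (m : ℕ) (z : Ω) :
    ∫ y, iter μ W m z y * f y ∂μ = (Top μ W)^[m + 1] f z := by
  induction m generalizing z with
  | zero => rfl
  | succ m ih =>
    rw [Function.iterate_succ_apply']
    unfold Top
    have hB0 : 0 ≤ B := (h0 z z).trans (hB _ _)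
    have e1 : ∀ x, (Top μ W)^[m + 1] f x = ∫ y, iter μ W m x y * f y ∂μ := fun x => (ih x).symm
    change _ = ∫ y, W z y * (Top μ W)^[m + 1] f y ∂μ
    simp only [e1, ← integral_const_mul]
    obtain ⟨hf1, hf2, C, hC⟩ := hf
    have hint : Integrable (Function.uncurry fun x y => W z x * (iter μ W m x y * f y)) (μ.prod μ) := by
      refine integrable_of_bdd (((slice_meas hm z).comp measurable_fst).mul
        ((iter_meas hm m).mul (hf1.comp measurable_snd))) (B * (B ^ (m + 1) * C)) ?_ ?_
      · exact fun p => mul_nonneg (h0 _ _) (mul_nonneg (iter_nonneg h0 _ _ _) (hf2 _))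
      · intro p
        exact mul_le_mul (hB _ _) (mul_le_mul (iter_le hm h0 hB _ _ _) (hC _) (hf2 _) (by positivity))
          (mul_nonneg (iter_nonneg h0 _ _ _) (hf2 _)) hB0
    rw [integral_integral_swap hint]
    simp only [iter, ← mul_assoc, integral_mul_const]

lemma Top_pair (hm : Measurable (Function.uncurry W)) (h0 : ∀ x y, 0 ≤ W x y)
    (hB : ∀ x y, W x y ≤ B) (hs : ∀ x y, W x y = W y x) {f g : Ω → ℝ} (hf : BN f) (hg : BN g) (i j : ℕ) :
    ∫ x, (Top μ W)^[i] f x * (Top μ W)^[j] g x ∂μ = ∫ x, f x * (Top μ W)^[i + j] g x ∂μ := by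
  induction i generalizing j with
  | zero => simp
  | succ i ih =>
    rw [Function.iterate_succ_apply',
      Top_adj hm h0 hB hs (Top_iter_BN hm h0 hB hf i).1 (Top_iter_BN hm h0 hB hf i).integrable
        (Top_iter_BN hm h0 hB hg j), ← Function.iterate_succ_apply' (Top μ W), ih,
      show i + (j + 1) = i + 1 + j by omega]

lemma Top_mono_iter (hm : Measurable (Function.uncurry W)) (h0 : ∀ x y, 0 ≤ W x y)
    (hB : ∀ x y, W x y ≤ B) {f : Ω → ℝ} (hf : BN f) {C : ℝ} (hC : ∀ x, f x ≤ C) (k : ℕ) (x : Ω) :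
    (Top μ W)^[k] f x ≤ C * (Top μ W)^[k] (fun _ => 1) x := by
  induction k generalizing x with
  | zero => simpa using hC x
  | succ k ih =>
    rw [Function.iterate_succ_apply', Function.iterate_succ_apply']
    unfold Top
    rw [← integral_const_mul]
    refine integral_mono ((W_BN hm h0 hB x).mul (Top_iter_BN hm h0 hB hf k)).integrable
      (((W_BN hm h0 hB x).mul (Top_iter_BN hm h0 hB BN.one k)).integrable.const_mul C) fun y => ?_
    have := mul_le_mul_of_nonneg_left (ih y) (h0 x y)
    change W x y * (Top μ W)^[k] f y ≤ C * (W x y * (Top μ W)^[k] (fun _ => 1) y)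
    linarith

end OpN

section OpN2
variable {W : ℝ → ℝ → ℝ}

lemma opNorm_lower (hW : IsGraphon W) {a : ℝ} (ha : 0 < a) (haW : a < opNorm W) :
    ∃ c > 0, ∀ k : ℕ, c * (a ^ 2) ^ k ≤ ∫ p, iter leb W (2 * k + 1) p.1 p.2 ∂(leb.prod leb) := by
  obtain ⟨hm, h0, hs, M, hM⟩ := hW
  have hM0 : 0 ≤ M := (h0 0 0).trans (hM 0 0)
  set S : Set ℝ := {r | ∃ f : ℝ → ℝ, Measurable f ∧
    MeasureTheory.IntegrableOn (fun x => f x ^ 2) I01 ∧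
    l2norm f ≤ 1 ∧ r = l2norm (applyT W f)} with hS
  have hne : S.Nonempty := ⟨_, fun _ => 0, measurable_const, by simp, by simp [l2norm], rfl⟩
  obtain ⟨r, ⟨f, hf, hf2, hf3, rfl⟩, har⟩ := exists_lt_of_lt_csSup hne haW
  have hf2' : Integrable (fun x => f x ^ 2) leb := hf2
  have hf3' : ∫ x, f x ^ 2 ∂leb ≤ 1 := by
    unfold l2norm at hf3
    rw [Real.sqrt_le_one] at hf3
    exact hf3
  set F : ℝ → ℝ := fun x => |f x| with hF
  have hFm : Measurable F := hf.abs
  have hF2 : Integrable (fun x => F x ^ 2) leb := by simpa [hF] using hf2'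
  have hF2i : ∫ x, F x ^ 2 ∂leb ≤ 1 := by simpa [hF] using hf3'
  have hFi : Integrable F leb := by
    refine (hF2.add (integrable_const (1 : ℝ))).mono hFm.aestronglyMeasurable (Eventually.of_forall fun x => ?_)
    simp only [Pi.add_apply, Real.norm_eq_abs]
    rw [abs_of_nonneg (by positivity : 0 ≤ F x ^ 2 + 1), abs_le]
    constructor <;> nlinarith [sq_nonneg (F x + 1), sq_nonneg (F x - 1), sq_nonneg (F x)]
  set g : ℝ → ℝ := Top leb W F with hg
  have hWF : ∀ x, Integrable (fun y => W x y * F y) leb := by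
    intro x
    refine (hFi.const_mul M).mono ((slice_meas hm x).mul hFm).aestronglyMeasurable (Eventually.of_forall fun y => ?_)
    simp only [norm_mul, Real.norm_eq_abs, abs_of_nonneg (h0 x y), abs_of_nonneg hM0]
    exact mul_le_mul_of_nonneg_right (hM _ _) (abs_nonneg _)
  have hFn : ∀ x, 0 ≤ F x := fun x => abs_nonneg _
  have hgB : ∀ x, g x ≤ M * ∫ y, F y ∂leb := by
    intro x
    rw [← integral_const_mul]
    exact integral_mono (hWF x) (hFi.const_mul M) fun y => mul_le_mul_of_nonneg_right (hM _ _) (hFn _)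
  have hgn : ∀ x, 0 ≤ g x := fun x => integral_nonneg fun y => mul_nonneg (h0 _ _) (hFn _)
  have hgBN : BN g := ⟨Top_meas hm hFm, hgn, _, hgB⟩
  set A : ℕ → ℝ := fun k => ∫ x, ((Top leb W)^[k] g x) ^ 2 ∂leb with hA
  have hBNk := fun k => Top_iter_BN (μ := leb) hm h0 hM hgBN k
  have hsqi : ∀ k, Integrable (fun x => ((Top leb W)^[k] g x) ^ 2) leb := fun k => by
    simpa only [pow_two] using ((hBNk k).mul (hBNk k)).integrable
  have hA0 : a ^ 2 < A 0 := by
    have h1 : a ^ 2 < ∫ x, applyT W f x ^ 2 ∂leb := by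
      have h2 : a < Real.sqrt (∫ x, applyT W f x ^ 2 ∂leb) := har
      exact (Real.lt_sqrt ha.le).1 h2
    refine h1.trans_le ?_
    refine integral_mono_of_nonneg (Eventually.of_forall fun x => sq_nonneg _) (hsqi 0) (Eventually.of_forall fun x => ?_)
    change applyT W f x ^ 2 ≤ g x ^ 2
    rw [sq_le_sq, abs_of_nonneg (hgn x)]
    change |∫ y, W x y * f y ∂leb| ≤ ∫ y, W x y * |f y| ∂leb
    refine (abs_integral_le_integral_abs).trans_eq ?_
    simp only [abs_mul, abs_of_nonneg (h0 _ _)]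
  have hApos : ∀ k, 0 ≤ A k := fun k => integral_nonneg fun x => sq_nonneg _
  have hA1 : A 0 ^ 2 ≤ A 1 := by
    have e : A 0 = ∫ x, F x * Top leb W g x ∂leb := by
      have := Top_adj (μ := leb) hm h0 hM hs hFm hFi hgBN
      rw [← this]; simp [hA, pow_two, hg]
    rw [e]
    refine (cs_int hFm.aestronglyMeasurable (hBNk 1).1.aestronglyMeasurable hF2 (hsqi 1)).trans ?_
    exact mul_le_of_le_one_left (hApos 1) hF2i
  have hAlog : ∀ k, A (k + 1) ^ 2 ≤ A k * A (k + 2) := by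
    intro k
    have e : A (k + 1) = ∫ x, (Top leb W)^[k] g x * (Top leb W)^[k + 2] g x ∂leb := by
      rw [Top_pair hm h0 hM hs hgBN hgBN]
      simp only [hA, pow_two]
      rw [Top_pair hm h0 hM hs hgBN hgBN, show k + 1 + (k + 1) = k + (k + 2) by omega]
    rw [e]
    exact cs_int (hBNk k).1.aestronglyMeasurable (hBNk (k + 2)).1.aestronglyMeasurable (hsqi k) (hsqi (k + 2))
  have hstep : ∀ k, 0 < A k ∧ a ^ 2 * A k ≤ A (k + 1) := by
    intro k
    induction k with
    | zero =>
      refine ⟨lt_trans (by positivity) hA0, ?_⟩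
      have : 0 < A 0 := lt_trans (by positivity) hA0
      simp only [zero_add]; nlinarith
    | succ k ih =>
      obtain ⟨i1, i2⟩ := ih
      have hp : 0 < A (k + 1) := lt_of_lt_of_le (by positivity) i2
      refine ⟨hp, ?_⟩
      have := hAlog k
      have h3 : A k * (a ^ 2 * A (k + 1)) ≤ A k * A (k + 1 + 1) := by nlinarith
      exact le_of_mul_le_mul_left h3 i1
  have hgeom : ∀ k, (a ^ 2) ^ k * A 0 ≤ A k := by
    intro k
    induction k with
    | zero => simp
    | succ k ih =>
      have := (hstep k).2
      have ha2 : 0 < a ^ 2 := by positivity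
      rw [pow_succ]; nlinarith
  set C : ℝ := M * ∫ y, F y ∂leb with hC
  have hC0 : 0 ≤ C := mul_nonneg hM0 (integral_nonneg hFn)
  have hup : ∀ k, A k ≤ C ^ 2 * ∫ x, (Top leb W)^[2 * k] (fun _ => 1) x ∂leb := by
    intro k
    have h1 := fun k => Top_iter_BN (μ := leb) hm h0 hM BN.one k
    have h2 : ∫ x, (Top leb W)^[2 * k] (fun _ => 1) x ∂leb = ∫ x, (Top leb W)^[k] (fun _ => 1) x ^ 2 ∂leb := by
      simp only [pow_two]
      rw [Top_pair hm h0 hM hs BN.one BN.one, two_mul]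
      simp
    rw [h2, ← integral_const_mul]
    refine integral_mono (hsqi k) ?_ fun x => ?_
    · have := ((h1 k).mul (h1 k)).integrable (μ := leb)
      simp only [pow_two]
      exact this.const_mul _
    · have := Top_mono_iter (μ := leb) hm h0 hM hgBN hgB k x
      have h4 := (hBNk k).2.1 x
      change (Top leb W)^[k] g x ^ 2 ≤ C ^ 2 * (Top leb W)^[k] (fun _ => 1) x ^ 2
      rw [← mul_pow]
      exact pow_le_pow_left₀ h4 this 2
  have hA0' : 0 < A 0 := (hstep 0).1
  refine ⟨a ^ 2 * A 0 / (C ^ 2 + 1), by positivity, fun k => ?_⟩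
  have e : ∫ p, iter leb W (2 * k + 1) p.1 p.2 ∂(leb.prod leb) = ∫ x, (Top leb W)^[2 * (k + 1)] (fun _ => 1) x ∂leb := by
    have i1 : Integrable (fun p : ℝ × ℝ => iter leb W (2 * k + 1) p.1 p.2) (leb.prod leb) :=
      integrable_of_bdd (iter_meas hm _) _ (fun p => iter_nonneg h0 _ _ _)
      (fun p => iter_le hm h0 hM _ _ _)
    rw [integral_prod _ i1]
    refine integral_congr_ae (Eventually.of_forall fun x => ?_)
    have := iter_apply (μ := leb) hm h0 hM BN.one (2 * k + 1) x
    simp only [mul_one] at this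
    exact this
  rw [e]
  have hh := (hgeom (k + 1)).trans (hup (k + 1))
  have hT0 : 0 ≤ ∫ x, (Top leb W)^[2 * (k + 1)] (fun _ => 1) x ∂leb :=
    integral_nonneg (Top_iter_BN (μ := leb) hm h0 hM BN.one _).2.1
  rw [div_mul_eq_mul_div, div_le_iff₀ (by positivity)]
  rw [pow_succ] at hh
  nlinarith

end OpN2
end GiantAux

namespace GiantAux

open Percolation

section Eig

/-- normalized finite operator -/
def Tn {n : ℕ} (b : Fin n → Fin n → ℝ) (f : Fin n → ℝ) (z : Fin n) : ℝ := (∑ w, b z w * f w) / n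

lemma Top_unif {n : ℕ} [NeZero n] (b : Fin n → Fin n → ℝ) : Top (unif n) b = Tn b := by
  funext f z
  simp only [Top, Tn, integral_unif]

variable {n : ℕ} [NeZero n] {b : Fin n → Fin n → ℝ} {B : ℝ}

lemma iter_Tn (hn : ∀ i j, 0 ≤ b i j) (hB : ∀ i j, b i j ≤ B) {f : Fin n → ℝ} (hf : ∀ i, 0 ≤ f i) (m : ℕ) (z : Fin n) :
    (∑ y, iter (unif n) b m z y * f y) / n = (Tn b)^[m + 1] f z := by
  have hBN : BN f := ⟨Measurable.of_discrete, hf, ∑ i, f i, fun i => Finset.single_le_sum (fun j _ => hf j) (Finset.mem_univ i)⟩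
  rw [← Top_unif, ← iter_apply (μ := unif n) Measurable.of_discrete hn hB hBN, integral_unif]

lemma Tn_add (f g : Fin n → ℝ) (z : Fin n) : Tn b (fun i => f i + g i) z = Tn b f z + Tn b g z := by
  simp only [Tn, mul_add, Finset.sum_add_distrib, add_div]

lemma Tn_smul (c : ℝ) (f : Fin n → ℝ) (z : Fin n) : Tn b (fun i => c * f i) z = c * Tn b f z := by
  simp only [Tn, ← mul_div_assoc, Finset.mul_sum]
  congr 1
  exact Finset.sum_congr rfl fun i _ => by ring

lemma Tn_mono (hn : ∀ i j, 0 ≤ b i j) {f g : Fin n → ℝ} (h : ∀ i, f i ≤ g i) (z : Fin n) : Tn b f z ≤ Tn b g z := by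
  unfold Tn
  gcongr with w _
  · exact hn _ _
  · exact h w

lemma Tn_nonneg (hn : ∀ i j, 0 ≤ b i j) {f : Fin n → ℝ} (h : ∀ i, 0 ≤ f i) (z : Fin n) : 0 ≤ Tn b f z :=
  div_nonneg (Finset.sum_nonneg fun w _ => mul_nonneg (hn _ _) (h w)) (Nat.cast_nonneg _)

lemma Tn_le (hn : ∀ i j, 0 ≤ b i j) (hB : ∀ i j, b i j ≤ B) {f : Fin n → ℝ} (h : ∀ i, 0 ≤ f i) (z : Fin n) :
    Tn b f z ≤ B * ((∑ i, f i) / n) := by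
  unfold Tn
  rw [← mul_div_assoc, Finset.mul_sum]
  gcongr with w _
  · exact h w
  · exact hB _ _

lemma Tn_adj (hs : ∀ i j, b i j = b j i) (f g : Fin n → ℝ) : ∑ z, f z * Tn b g z = ∑ z, g z * Tn b f z := by
  simp only [Tn, ← mul_div_assoc, ← Finset.sum_div, Finset.mul_sum]
  rw [Finset.sum_comm]
  congr 1
  refine Finset.sum_congr rfl fun i _ => Finset.sum_congr rfl fun j _ => ?_
  rw [hs i j]; ring

lemma Q_abs (hn : ∀ i j, 0 ≤ b i j) (f : Fin n → ℝ) : |∑ z, f z * Tn b f z| ≤ ∑ z, |f z| * Tn b (fun i => |f i|) z := by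
  refine (Finset.abs_sum_le_sum_abs _ _).trans (Finset.sum_le_sum fun z _ => ?_)
  rw [abs_mul]
  refine mul_le_mul_of_nonneg_left ?_ (abs_nonneg _)
  unfold Tn
  rw [abs_div, abs_of_nonneg (Nat.cast_nonneg n : (0 : ℝ) ≤ n)]
  gcongr
  refine (Finset.abs_sum_le_sum_abs _ _).trans (Finset.sum_le_sum fun w _ => ?_)
  rw [abs_mul, abs_of_nonneg (hn _ _)]

lemma Tn_norm_step (hs : ∀ i j, b i j = b j i) (hn : ∀ i j, 0 ≤ b i j) {a : ℝ} (ha : 0 < a)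
    (hQ : ∀ w : Fin n → ℝ, ∑ z, w z * Tn b w z ≤ a * ∑ z, w z ^ 2) (u : Fin n → ℝ) :
    ∑ z, Tn b u z ^ 2 ≤ a ^ 2 * ∑ z, u z ^ 2 := by
  set v : Fin n → ℝ := fun i => a⁻¹ * Tn b u i with hv
  have h1 := hQ (fun i => u i + v i)
  have h2 : -(∑ z, (u z + -1 * v z) * Tn b (fun i => u i + -1 * v i) z) ≤ a * ∑ z, (u z + -1 * v z) ^ 2 := by
    have e := Q_abs hn (fun i => u i + -1 * v i)
    have e2 := hQ (fun i => |u i + -1 * v i|)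
    simp only [sq_abs] at e2
    exact (neg_le_abs _).trans (e.trans e2)
  simp only [Tn_add, Tn_smul] at h1 h2
  have e1 : ∑ z, (u z + v z) * (Tn b u z + Tn b v z) = ∑ z, u z * Tn b u z + ∑ z, v z * Tn b v z + 2 * ∑ z, v z * Tn b u z := by
    have := Tn_adj hs u v
    calc _ = ∑ z, u z * Tn b u z + ∑ z, v z * Tn b v z + (∑ z, u z * Tn b v z + ∑ z, v z * Tn b u z) := by
          simp only [← Finset.sum_add_distrib]; exact Finset.sum_congr rfl fun i _ => by ring
      _ = _ := by rw [this]; ring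
  have e2 : ∑ z, (u z + -1 * v z) * (Tn b u z + -1 * Tn b v z) = ∑ z, u z * Tn b u z + ∑ z, v z * Tn b v z - 2 * ∑ z, v z * Tn b u z := by
    have := Tn_adj hs u v
    calc _ = ∑ z, u z * Tn b u z + ∑ z, v z * Tn b v z - (∑ z, u z * Tn b v z + ∑ z, v z * Tn b u z) := by
          simp only [← Finset.sum_add_distrib, ← Finset.sum_sub_distrib]; exact Finset.sum_congr rfl fun i _ => by ring
      _ = _ := by rw [this]; ring
  have e3 : ∑ z, (u z + v z) ^ 2 + ∑ z, (u z + -1 * v z) ^ 2 = 2 * ∑ z, u z ^ 2 + 2 * ∑ z, v z ^ 2 := by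
    simp only [← Finset.sum_add_distrib, Finset.mul_sum]; exact Finset.sum_congr rfl fun i _ => by ring
  have e4 : ∑ z, v z * Tn b u z = a⁻¹ * ∑ z, Tn b u z ^ 2 := by
    rw [Finset.mul_sum]; exact Finset.sum_congr rfl fun i _ => by simp only [hv]; ring
  have e5 : ∑ z, v z ^ 2 = (a⁻¹) ^ 2 * ∑ z, Tn b u z ^ 2 := by
    rw [Finset.mul_sum]; exact Finset.sum_congr rfl fun i _ => by simp only [hv]; ring
  rw [e1] at h1
  rw [e2] at h2
  have h3 : 4 * (a⁻¹ * ∑ z, Tn b u z ^ 2) ≤ a * (2 * ∑ z, u z ^ 2 + 2 * ((a⁻¹) ^ 2 * ∑ z, Tn b u z ^ 2)) := by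
    rw [← e5, ← e3, ← e4]; linarith
  set P := ∑ z, Tn b u z ^ 2
  set S := ∑ z, u z ^ 2
  have h4 : a * (4 * (a⁻¹ * P)) ≤ a * (a * (2 * S + 2 * ((a⁻¹) ^ 2 * P))) := mul_le_mul_of_nonneg_left h3 ha.le
  have h5 : a * (4 * (a⁻¹ * P)) = 4 * P := by field_simp
  have h6 : a * (a * (2 * S + 2 * ((a⁻¹) ^ 2 * P))) = 2 * a ^ 2 * S + 2 * P := by field_simp
  rw [h5, h6] at h4
  linarith

lemma Tn_pow_bound (hs : ∀ i j, b i j = b j i) (hn : ∀ i j, 0 ≤ b i j) {a : ℝ} (ha : 0 < a)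
    (hQ : ∀ w : Fin n → ℝ, ∑ z, w z * Tn b w z ≤ a * ∑ z, w z ^ 2) (m : ℕ) :
    (∑ z, (Tn b)^[m] (fun _ => 1) z) / n ≤ a ^ m := by
  have hn0 : (0 : ℝ) < n := by exact_mod_cast Nat.pos_of_ne_zero (NeZero.ne n)
  have h1 : ∑ z, ((Tn b)^[m] (fun _ => 1) z) ^ 2 ≤ (a ^ 2) ^ m * n := by
    induction m with
    | zero => simp
    | succ m ih =>
      simp only [Function.iterate_succ_apply']
      refine (Tn_norm_step hs hn ha hQ _).trans ?_
      have : 0 ≤ a ^ 2 := by positivity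
      refine (mul_le_mul_of_nonneg_left ih this).trans_eq ?_
      ring
  have h2 := Finset.sum_mul_sq_le_sq_mul_sq Finset.univ (fun _ : Fin n => (1 : ℝ)) (fun z => (Tn b)^[m] (fun _ => 1) z)
  simp only [one_mul, one_pow, Finset.sum_const, Finset.card_univ, Fintype.card_fin, nsmul_eq_mul, mul_one] at h2
  rw [div_le_iff₀ hn0]
  refine abs_le_of_sq_le_sq' ?_ (by positivity) |>.2
  calc _ ≤ _ := h2
    _ ≤ n * ((a ^ 2) ^ m * n) := mul_le_mul_of_nonneg_left h1 hn0.le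
    _ = _ := by rw [← pow_mul, mul_comm 2 m, pow_mul]; ring

lemma eig_exists (hs : ∀ i j, b i j = b j i) (hn : ∀ i j, 0 ≤ b i j) :
    ∃ (l : ℝ) (x : Fin n → ℝ), (∀ z, 0 ≤ x z) ∧ ∑ z, x z ^ 2 = n ∧ (∀ z, Tn b x z = l * x z) ∧
      ∀ w : Fin n → ℝ, ∑ z, w z * Tn b w z ≤ l * ∑ z, w z ^ 2 := by
  have hn0 : (0 : ℝ) < n := by exact_mod_cast Nat.pos_of_ne_zero (NeZero.ne n)
  set K : Set (EuclideanSpace ℝ (Fin n)) := Metric.sphere 0 1 with hK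
  have hKc : IsCompact K := isCompact_sphere 0 1
  have hKm : ∀ x : EuclideanSpace ℝ (Fin n), x ∈ K ↔ ∑ i, x i ^ 2 = 1 := by
    intro x
    rw [hK, mem_sphere_zero_iff_norm, EuclideanSpace.norm_eq, Real.sqrt_eq_one]
    simp
  have hne : K.Nonempty := by
    refine ⟨EuclideanSpace.single (0 : Fin n) 1, ?_⟩
    simp [hK]
  have hcont : Continuous fun x : EuclideanSpace ℝ (Fin n) => ∑ z, x z * Tn b (fun i => x i) z := by
    unfold Tn; fun_prop
  obtain ⟨y, hyK, hy⟩ := hKc.exists_isMaxOn hne hcont.continuousOn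
  set l := ∑ z, |y z| * Tn b (fun i => |y i|) z with hl
  have hy1 : ∑ i, y i ^ 2 = 1 := (hKm y).1 hyK
  have hQ : ∀ w : Fin n → ℝ, ∑ z, w z * Tn b w z ≤ l * ∑ z, w z ^ 2 := by
    intro w
    by_cases hw : ∑ z, w z ^ 2 = 0
    · have : ∀ z, w z = 0 := fun z => by
        have := (Finset.sum_eq_zero_iff_of_nonneg (fun i _ => sq_nonneg (w i))).1 hw z (Finset.mem_univ z)
        exact pow_eq_zero_iff (two_ne_zero) |>.1 this
      simp [this]
    · have hwp : 0 < ∑ z, w z ^ 2 := lt_of_le_of_ne (Finset.sum_nonneg fun i _ => sq_nonneg _) (Ne.symm hw)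
      set s := Real.sqrt (∑ z, w z ^ 2) with hsq
      have hsp : 0 < s := Real.sqrt_pos.2 hwp
      have hs2 : s ^ 2 = ∑ z, w z ^ 2 := Real.sq_sqrt hwp.le
      have hm : (WithLp.toLp 2 (fun i => s⁻¹ * w i) : EuclideanSpace ℝ (Fin n)) ∈ K := by
        rw [hKm]
        simp only [mul_pow, ← Finset.mul_sum, ← hs2]
        field_simp
      have h1 := hy hm
      simp only [Set.mem_ofPred_eq, Tn_smul] at h1
      have h2 : ∑ z, y z * Tn b (fun i => y i) z ≤ l := (le_abs_self _).trans (Q_abs hn _)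
      have h3 : ∑ z, s⁻¹ * w z * (s⁻¹ * Tn b w z) ≤ l := h1.trans h2
      have h4 : ∑ z, s⁻¹ * w z * (s⁻¹ * Tn b w z) = (∑ z, w z * Tn b w z) / s ^ 2 := by
        rw [Finset.sum_div]; exact Finset.sum_congr rfl fun i _ => by field_simp
      rw [h4, div_le_iff₀ (by positivity), hs2] at h3
      exact h3
  set X : Fin n → ℝ := fun i => |y i| with hX
  have hX2 : ∑ z, X z ^ 2 = 1 := by simp [hX, hy1]
  have heig : ∀ z, Tn b X z = l * X z := by
    -- variation
    set r : Fin n → ℝ := fun z => Tn b X z - l * X z with hr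
    set D := l * ∑ z, r z ^ 2 - ∑ z, r z * Tn b r z with hD
    have hvar : ∀ t : ℝ, 0 ≤ D * (t * t) + (-2 * ∑ z, r z ^ 2) * t + 0 := by
      intro t
      have h1 := hQ (fun i => X i + t * r i)
      simp only [Tn_add, Tn_smul] at h1
      have e1 : ∑ z, (X z + t * r z) * (Tn b X z + t * Tn b r z) = l + 2 * t * ∑ z, r z * Tn b X z + t * t * ∑ z, r z * Tn b r z := by
        have := Tn_adj hs X r
        calc _ = ∑ z, X z * Tn b X z + t * (∑ z, X z * Tn b r z + ∑ z, r z * Tn b X z) + t * t * ∑ z, r z * Tn b r z := by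
              simp only [Finset.mul_sum, ← Finset.sum_add_distrib]; exact Finset.sum_congr rfl fun i _ => by ring
          _ = _ := by rw [this]; ring
      have e2 : l * ∑ z, (X z + t * r z) ^ 2 = l + 2 * t * ∑ z, r z * (l * X z) + t * t * (l * ∑ z, r z ^ 2) := by
        calc _ = l * ∑ z, X z ^ 2 + 2 * t * ∑ z, r z * (l * X z) + t * t * (l * ∑ z, r z ^ 2) := by
              simp only [Finset.mul_sum, ← Finset.sum_add_distrib]; exact Finset.sum_congr rfl fun i _ => by ring
          _ = _ := by rw [hX2]; ring
      have e3 : ∑ z, r z ^ 2 = ∑ z, r z * Tn b X z - ∑ z, r z * (l * X z) := by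
        rw [← Finset.sum_sub_distrib]; exact Finset.sum_congr rfl fun i _ => by simp only [hr]; ring
      rw [e1, e2] at h1
      rw [hD]
      have e4 := congrArg (fun q => t * q) e3
      beta_reduce at e4
      linarith
    have h2 := discrim_le_zero hvar
    unfold discrim at h2
    have h3 : ∑ z, r z ^ 2 = 0 := by nlinarith [sq_nonneg (∑ z, r z ^ 2)]
    intro z
    have := (Finset.sum_eq_zero_iff_of_nonneg (fun i _ => sq_nonneg (r i))).1 h3 z (Finset.mem_univ z)
    have := pow_eq_zero_iff (two_ne_zero) |>.1 this
    simp only [hr] at this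
    linarith
  refine ⟨l, fun z => Real.sqrt n * X z, fun z => mul_nonneg (Real.sqrt_nonneg _) (abs_nonneg _), ?_, ?_, hQ⟩
  · simp only [mul_pow, ← Finset.mul_sum, hX2, Real.sq_sqrt hn0.le, mul_one]
  · intro z; rw [Tn_smul, heig]; ring

end Eig

section Eig2
variable {β : ∀ n : ℕ, Fin n → Fin n → ℝ} {βmax : ℝ} {W : ℝ → ℝ → ℝ}

lemma eig_final (hsym : ∀ n i j, β n i j = β n j i)
    (hnonneg : ∀ n i j, 0 ≤ β n i j)
    (hbound : ∀ n i j, β n i j ≤ βmax)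
    (hW : IsGraphon W) (hconv : ConvergesTo β W) {a : ℝ} (ha1 : 1 ≤ a) (haW : a < opNorm W) :
    ∀ᶠ n : ℕ in atTop, ∃ (l : ℝ) (x : Fin n → ℝ), a ≤ l ∧ l ≤ βmax ∧ (∀ z, 0 ≤ x z) ∧ (∀ z, x z ≤ βmax) ∧
      (n : ℝ) ≤ βmax * (∑ z, x z) ∧ ∀ z, Tn (β n) x z = l * x z := by
  obtain ⟨a2, h12, h2W⟩ := exists_between haW
  obtain ⟨c, hc, hck⟩ := opNorm_lower hW (show 0 < a2 by linarith) h2W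
  -- choose k
  have hr : 1 < a2 ^ 2 / a ^ 2 := by
    rw [one_lt_div (by positivity)]
    exact pow_lt_pow_left₀ h12 (by linarith) two_ne_zero
  obtain ⟨k, hk⟩ := (tendsto_pow_atTop_atTop_of_one_lt hr |>.eventually_gt_atTop (a ^ 2 / c)).exists
  have hk2 : a ^ (2 * k + 2) < c * (a2 ^ 2) ^ k := by
    rw [div_pow, div_lt_div_iff₀ hc (by positivity)] at hk
    calc a ^ (2 * k + 2) = a ^ 2 * (a ^ 2) ^ k := by rw [← pow_mul, ← pow_add]; ring_nf
      _ < _ := hk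
      _ = _ := mul_comm _ _
  have hlim := theta_conv (fun _ : Fin 1 => 2 * k + 1) hsym hnonneg hbound hW hconv (fun _ => by omega)
  simp only [Finset.univ_unique, Finset.prod_singleton] at hlim
  have hev := hlim.eventually (lt_mem_nhds (hk2.trans_le (hck k)))
  filter_upwards [hev, eventually_ge_atTop 1] with n hn hn1
  have : NeZero n := ⟨by omega⟩
  have hn0 : (0 : ℝ) < n := by exact_mod_cast hn1
  obtain ⟨l, x, hx0, hx2, hxe, hQ⟩ := eig_exists (hsym n) (hnonneg n)
  have hla : a ≤ l := by
    by_contra hcon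
    push Not at hcon
    have h1 := Tn_pow_bound (hsym n) (hnonneg n) (show 0 < a by linarith)
      (fun w => (hQ w).trans (mul_le_mul_of_nonneg_right hcon.le (Finset.sum_nonneg fun i _ => sq_nonneg _))) (2 * k + 2)
    have h2 : (∑ z, (Tn (β n))^[2 * k + 2] (fun _ => 1) z) / n =
        (∑ z, ∑ y, iter (unif n) (β n) (2 * k + 1) z y) / (n : ℝ) ^ 2 := by
      rw [Finset.sum_div, Finset.sum_div]
      refine Finset.sum_congr rfl fun z _ => ?_
      rw [← iter_Tn (hnonneg n) (hbound n) (fun _ => zero_le_one)]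
      simp only [mul_one]
      field_simp
    rw [h2] at h1
    linarith
  have hl0 : 0 < l := by linarith
  have hS0 : 0 ≤ ∑ z, x z := Finset.sum_nonneg fun i _ => hx0 i
  have hmean : (∑ z, x z) / n ≤ 1 := by
    have h2 := Finset.sum_mul_sq_le_sq_mul_sq Finset.univ (fun _ : Fin n => (1 : ℝ)) x
    simp only [one_mul, one_pow, Finset.sum_const, Finset.card_univ, Fintype.card_fin, nsmul_eq_mul, mul_one, hx2] at h2
    rw [div_le_one hn0]
    exact abs_le_of_sq_le_sq' (by nlinarith) hn0.le |>.2
  have hB0 : 0 ≤ βmax := (hnonneg n 0 0).trans (hbound n 0 0)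
  have hxB : ∀ z, x z ≤ βmax := by
    intro z
    have h1 := Tn_le (hnonneg n) (hbound n) hx0 z
    rw [hxe] at h1
    have h2 : βmax * ((∑ i, x i) / n) ≤ βmax := mul_le_of_le_one_right hB0 hmean
    have : x z ≤ l * x z := le_mul_of_one_le_left (hx0 z) (by linarith)
    linarith
  have hmn : (n : ℝ) ≤ βmax * (∑ z, x z) := by
    rw [← hx2, Finset.mul_sum]
    refine Finset.sum_le_sum fun i _ => ?_
    rw [pow_two]
    exact mul_le_mul_of_nonneg_right (hxB i) (hx0 i)
  refine ⟨l, x, hla, ?_, hx0, hxB, hmn, hxe⟩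
  have hSpos : 0 < ∑ z, x z := by
    rcases hS0.lt_or_eq with h | h
    · exact h
    · rw [← h] at hmn; simp at hmn; omega
  have h1 : ∑ z, Tn (β n) x z ≤ ∑ _z : Fin n, βmax * ((∑ i, x i) / n) := Finset.sum_le_sum fun z _ => Tn_le (hnonneg n) (hbound n) hx0 z
  simp only [hxe, ← Finset.mul_sum, Finset.sum_const, Finset.card_univ, Fintype.card_fin, nsmul_eq_mul] at h1
  have h2 : βmax * ((n : ℝ) * ((∑ i, x i) / n)) = βmax * ∑ i, x i := by field_simp
  rw [h2] at h1
  exact le_of_mul_le_mul_right h1 hSpos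

end Eig2
end GiantAux

namespace GiantAux

open Percolation

section LG

lemma lemG {n : ℕ} [NeZero n] (S : Fin n → Fin n → ℝ) (f v r : Fin n → ℝ) {F m0 K η ε ρ γ : ℝ}
    (hS : ∀ z y, 0 ≤ S z y) (hf0 : ∀ y, 0 ≤ f y) (hfF : ∀ y, f y ≤ F) (hm0 : m0 * n ≤ ∑ y, f y)
    (hK : 0 ≤ K) (hη : 0 ≤ η) (hr : ∀ z, 0 ≤ r z) (hρ : ∑ z, r z ≤ ρ * n)
    (h : ∀ z, (∑ y, S z y * f y) / n ≤ K * v z + r z)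
    (hcard : ((Finset.univ.filter fun p : Fin n × Fin n => S p.1 p.2 < η).card : ℝ) ≤ ε * (n : ℝ) ^ 2) :
    ((Finset.univ.filter fun z => v z ≤ γ).card : ℝ) * (η * m0 - K * γ) ≤ (η * F * ε + ρ) * n := by
  have hn0 : (0 : ℝ) < n := by exact_mod_cast Nat.pos_of_ne_zero (NeZero.ne n)
  have hF0 : 0 ≤ F := (hf0 0).trans (hfF 0)
  set A := Finset.univ.filter fun z => v z ≤ γ with hA
  have h1 : ∑ z ∈ A, (∑ y, S z y * f y) / n ≤ A.card * (K * γ) + ρ * n := by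
    calc ∑ z ∈ A, (∑ y, S z y * f y) / n ≤ ∑ z ∈ A, (K * γ + r z) := by
          refine Finset.sum_le_sum fun z hz => (h z).trans ?_
          have : v z ≤ γ := (Finset.mem_filter.1 hz).2
          have := mul_le_mul_of_nonneg_left this hK
          linarith
      _ = A.card * (K * γ) + ∑ z ∈ A, r z := by rw [Finset.sum_add_distrib]; simp
      _ ≤ _ := by
          have : ∑ z ∈ A, r z ≤ ∑ z, r z :=
            Finset.sum_le_sum_of_subset_of_nonneg (Finset.subset_univ _) fun i _ _ => hr i
          linarith
  have h2 : A.card * (η * (m0 * n)) - η * F * (ε * (n : ℝ) ^ 2) ≤ ∑ z ∈ A, ∑ y, S z y * f y := by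
    have e1 : ∀ z y, η * f y - (if S z y < η then η * F else 0) ≤ S z y * f y := by
      intro z y
      split_ifs with hlt
      · have := mul_nonneg (hS z y) (hf0 y)
        have := mul_le_mul_of_nonneg_left (hfF y) hη
        linarith
      · have := mul_le_mul_of_nonneg_right (not_lt.1 hlt) (hf0 y)
        linarith
    have e2 : ∑ z ∈ A, ∑ y, (η * f y - (if S z y < η then η * F else 0)) ≤ ∑ z ∈ A, ∑ y, S z y * f y :=
      Finset.sum_le_sum fun z _ => Finset.sum_le_sum fun y _ => e1 z y
    refine le_trans ?_ e2
    simp only [Finset.sum_sub_distrib, ← Finset.mul_sum, Finset.sum_const, nsmul_eq_mul]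
    have e3 : ∑ z ∈ A, ∑ y, (if S z y < η then η * F else 0) ≤ η * F * (ε * (n : ℝ) ^ 2) := by
      calc ∑ z ∈ A, ∑ y, (if S z y < η then η * F else 0) ≤ ∑ z, ∑ y, (if S z y < η then η * F else 0) := by
            refine Finset.sum_le_sum_of_subset_of_nonneg (Finset.subset_univ _) fun i _ _ => Finset.sum_nonneg fun y _ => ?_
            split_ifs <;> positivity
        _ = ∑ p : Fin n × Fin n, (if S p.1 p.2 < η then η * F else 0) := (Fintype.sum_prod_type' _).symm
        _ = (η * F) * ((Finset.univ.filter fun p : Fin n × Fin n => S p.1 p.2 < η).card : ℝ) := by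
            rw [← Finset.sum_filter, Finset.sum_const, nsmul_eq_mul, mul_comm]
        _ ≤ _ := mul_le_mul_of_nonneg_left hcard (by positivity)
    have e4 : (A.card : ℝ) * (η * (m0 * n)) ≤ A.card * (η * ∑ i, f i) := by gcongr
    linarith
  rw [← Finset.sum_div, div_le_iff₀ hn0] at h1
  have h3 : (A.card : ℝ) * (η * (m0 * n)) - η * F * (ε * (n : ℝ) ^ 2) ≤ (A.card * (K * γ) + ρ * n) * n := h2.trans h1
  have h4 : ((A.card : ℝ) * (η * m0 - K * γ)) * n ≤ ((η * F * ε + ρ) * n) * n := by nlinarith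
  exact le_of_mul_le_mul_right h4 hn0

variable {β : ∀ n : ℕ, Fin n → Fin n → ℝ} {βmax : ℝ} {W : ℝ → ℝ → ℝ}

lemma S_apply {n : ℕ} [NeZero n] {b : Fin n → Fin n → ℝ} {B : ℝ} (hn : ∀ i j, 0 ≤ b i j) (hB : ∀ i j, b i j ≤ B)
    {f : Fin n → ℝ} (hf : ∀ i, 0 ≤ f i) (w : ℕ → ℝ) (M : ℕ) (z : Fin n) :
    (∑ y, (∑ m ∈ Finset.range M, w m * iter (unif n) b (m + 1) z y) * f y) / n =
      ∑ m ∈ Finset.range M, w m * (Tn b)^[m + 2] f z := by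
  simp only [← iter_Tn hn hB hf, Finset.sum_mul]
  rw [Finset.sum_comm, Finset.sum_div]
  refine Finset.sum_congr rfl fun m _ => ?_
  rw [← mul_div_assoc, Finset.mul_sum]
  congr 1
  exact Finset.sum_congr rfl fun y _ => by ring

lemma eig_lower (hsym : ∀ n i j, β n i j = β n j i)
    (hnonneg : ∀ n i j, 0 ≤ β n i j)
    (hbound : ∀ n i j, β n i j ≤ βmax) (hβ : 0 < βmax)
    (hW : IsGraphon W) (hconv : ConvergesTo β W) (hirr : Percolation.Irreducible W) (hT : 0 < opNorm W)
    (δ : ℝ) (hδ : 0 < δ) : ∃ τ > 0, ∀ᶠ n : ℕ in atTop, ∀ (l : ℝ) (x : Fin n → ℝ), 0 ≤ l → l ≤ βmax → (∀ z, 0 ≤ x z) →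
      (∀ z, x z ≤ βmax) → (n : ℝ) ≤ βmax * (∑ z, x z) → (∀ z, Tn (β n) x z = l * x z) →
      ((Finset.univ.filter fun z => x z ≤ τ).card : ℝ) ≤ δ * n := by
  obtain ⟨M, w, η, hw, hη, hev⟩ := S_transfer hsym hnonneg hbound hW hconv hirr hT (δ / (2 * βmax ^ 2)) (by positivity)
  set K : ℝ := ∑ m ∈ Finset.range M, w m * βmax ^ (m + 2) with hK
  have hK0 : 0 ≤ K := Finset.sum_nonneg fun m _ => mul_nonneg (hw m) (by positivity)
  refine ⟨η / (2 * βmax * (K + 1)), by positivity, ?_⟩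
  filter_upwards [hev, eventually_ge_atTop 1] with n hn hn1 l x hl0 hlB hx0 hxB hmn hxe
  have : NeZero n := ⟨by omega⟩
  have hpow : ∀ m z, (Tn (β n))^[m] x z = l ^ m * x z := by
    intro m
    induction m with
    | zero => simp
    | succ m ih =>
      intro z
      rw [Function.iterate_succ_apply', show (Tn (β n))^[m] x = fun z => l ^ m * x z from funext ih, Tn_smul, hxe, pow_succ]
      ring
  have key := lemG (fun z y => ∑ m ∈ Finset.range M, w m * iter (unif n) (β n) (m + 1) z y) x x (fun _ => 0)
    (F := βmax) (m0 := 1 / βmax) (K := K) (η := η) (ε := δ / (2 * βmax ^ 2)) (ρ := 0) (γ := η / (2 * βmax * (K + 1)))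
    (fun z y => Finset.sum_nonneg fun m _ => mul_nonneg (hw m) (iter_nonneg (hnonneg n) _ _ _)) hx0 hxB
    (by rw [div_mul_eq_mul_div, one_mul, div_le_iff₀ hβ]; linarith) hK0 hη.le (fun _ => le_rfl) (by simp) (by
      intro z
      rw [S_apply (hnonneg n) (hbound n) hx0, hK, Finset.sum_mul, add_zero]
      refine Finset.sum_le_sum fun m _ => ?_
      rw [hpow, mul_assoc]
      refine mul_le_mul_of_nonneg_left ?_ (hw m)
      exact mul_le_mul_of_nonneg_right (pow_le_pow_left₀ hl0 hlB _) (hx0 z)) hn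
  set a : ℝ := ((Finset.univ.filter fun z => x z ≤ η / (2 * βmax * (K + 1))).card : ℝ)
  have ha : 0 ≤ a := Nat.cast_nonneg _
  have h1 : η / (2 * βmax) ≤ η * (1 / βmax) - K * (η / (2 * βmax * (K + 1))) := by
    have : K * (η / (2 * βmax * (K + 1))) ≤ η / (2 * βmax) := by
      rw [← mul_div_assoc, div_le_div_iff₀ (by positivity) (by positivity)]
      have := mul_pos hη hβ
      nlinarith
    have e : η * (1 / βmax) = η / (2 * βmax) + η / (2 * βmax) := by field_simp; ring
    linarith
  have h2 := (mul_le_mul_of_nonneg_left h1 ha).trans key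
  have e : (η * βmax * (δ / (2 * βmax ^ 2)) + 0) * n = (δ * n) * (η / (2 * βmax)) := by field_simp; ring
  rw [e] at h2
  exact le_of_mul_le_mul_right h2 (by positivity)

/-- error coefficients -/
def cErr (K B : ℝ) : ℕ → ℝ
  | 0 => 0
  | m + 1 => K ^ m + B * cErr K B m

lemma cErr_nonneg {K B : ℝ} (hK : 0 ≤ K) (hB : 0 ≤ B) (m : ℕ) : 0 ≤ cErr K B m := by
  induction m with
  | zero => simp [cErr]
  | succ m ih => simp only [cErr]; positivity

lemma Tn_iter_err {n : ℕ} [NeZero n] {b : Fin n → Fin n → ℝ} {B K : ℝ} (hn : ∀ i j, 0 ≤ b i j) (hB : ∀ i j, b i j ≤ B)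
    (hK : 0 ≤ K) (u e : Fin n → ℝ) (he : ∀ z, 0 ≤ e z) (h : ∀ z, Tn b u z ≤ K * u z + e z) (m : ℕ) :
    ∃ r : Fin n → ℝ, (∀ z, 0 ≤ r z) ∧ (∀ z, (Tn b)^[m] u z ≤ K ^ m * u z + r z) ∧ ∑ z, r z ≤ cErr K B m * ∑ z, e z := by
  have hn0 : (0 : ℝ) < n := by exact_mod_cast Nat.pos_of_ne_zero (NeZero.ne n)
  induction m with
  | zero => exact ⟨fun _ => 0, fun _ => le_rfl, fun z => by simp, by simp [cErr]⟩
  | succ m ih =>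
    obtain ⟨r, h1, h2, h3⟩ := ih
    refine ⟨fun z => K ^ m * e z + Tn b r z, fun z => add_nonneg (mul_nonneg (by positivity) (he z)) (Tn_nonneg hn h1 z), ?_, ?_⟩
    · intro z
      rw [Function.iterate_succ_apply']
      refine (Tn_mono hn h2 z).trans ?_
      rw [Tn_add, Tn_smul]
      have := mul_le_mul_of_nonneg_left (h z) (by positivity : 0 ≤ K ^ m)
      rw [pow_succ]
      linarith
    · rw [Finset.sum_add_distrib, ← Finset.mul_sum]
      have h4 : ∑ z, Tn b r z ≤ ∑ _z : Fin n, B * ((∑ i, r i) / n) := Finset.sum_le_sum fun z _ => Tn_le hn hB h1 z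
      rw [Finset.sum_const, nsmul_eq_mul, Finset.card_univ, Fintype.card_fin] at h4
      have e1 : (n : ℝ) * (B * ((∑ i, r i) / n)) = B * ∑ i, r i := by field_simp
      rw [e1] at h4
      have h5 := mul_le_mul_of_nonneg_left h3 ((hn 0 0).trans (hB 0 0))
      simp only [cErr]
      linarith

lemma attach_det (hsym : ∀ n i j, β n i j = β n j i)
    (hnonneg : ∀ n i j, 0 ≤ β n i j)
    (hbound : ∀ n i j, β n i j ≤ βmax) (hβ : 0 < βmax)
    (hW : IsGraphon W) (hconv : ConvergesTo β W) (hirr : Percolation.Irreducible W) (hT : 0 < opNorm W)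
    (s δ K : ℝ) (hs : 0 < s) (hδ : 0 < δ) (hK : 0 ≤ K) : ∃ γ > 0, ∃ κ > 0, ∀ᶠ n : ℕ in atTop, ∀ (c e : Fin n → ℝ),
      (∀ z, 0 ≤ c z) → (∀ z, c z ≤ 1) → δ * n ≤ ∑ z, c z → (∀ z, 0 ≤ e z) →
      (∀ z, Tn (β n) (Tn (β n) c) z ≤ K * Tn (β n) c z + e z) → ∑ z, e z ≤ κ * n →
      ((Finset.univ.filter fun z => Tn (β n) c z ≤ γ).card : ℝ) ≤ s * n := by
  obtain ⟨M, w, η, hw, hη, hev⟩ := S_transfer hsym hnonneg hbound hW hconv hirr hT (s * δ / 4) (by positivity)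
  set K' : ℝ := ∑ m ∈ Finset.range M, w m * K ^ (m + 1) with hK'
  have hK0 : 0 ≤ K' := Finset.sum_nonneg fun m _ => mul_nonneg (hw m) (by positivity)
  set D : ℝ := ∑ m ∈ Finset.range M, w m * cErr K βmax (m + 1) with hD
  have hD0 : 0 ≤ D := Finset.sum_nonneg fun m _ => mul_nonneg (hw m) (cErr_nonneg hK hβ.le _)
  refine ⟨η * δ / (2 * (K' + 1)), by positivity, η * s * δ / (4 * (D + 1)), by positivity, ?_⟩
  filter_upwards [hev, eventually_ge_atTop 1] with n hn hn1 c e hc0 hc1 hcs he0 he hes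
  have : NeZero n := ⟨by omega⟩
  have hn0 : (0 : ℝ) < n := by exact_mod_cast hn1
  choose r hr0 hr1 hr2 using Tn_iter_err (hnonneg n) (hbound n) hK _ e he0 he
  have key := lemG (fun z y => ∑ m ∈ Finset.range M, w m * iter (unif n) (β n) (m + 1) z y) c (Tn (β n) c)
    (fun z => ∑ m ∈ Finset.range M, w m * r (m + 1) z)
    (F := 1) (m0 := δ) (K := K') (η := η) (ε := s * δ / 4) (ρ := η * s * δ / 4) (γ := η * δ / (2 * (K' + 1)))
    (fun z y => Finset.sum_nonneg fun m _ => mul_nonneg (hw m) (iter_nonneg (hnonneg n) _ _ _)) hc0 hc1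
    hcs hK0 hη.le (fun z => Finset.sum_nonneg fun m _ => mul_nonneg (hw m) (hr0 _ _)) (by
      rw [Finset.sum_comm]
      calc ∑ m ∈ Finset.range M, ∑ z, w m * r (m + 1) z ≤ ∑ m ∈ Finset.range M, w m * cErr K βmax (m + 1) * ∑ z, e z := by
            refine Finset.sum_le_sum fun m _ => ?_
            rw [← Finset.mul_sum, mul_assoc]
            exact mul_le_mul_of_nonneg_left (hr2 _) (hw m)
        _ = D * ∑ z, e z := by rw [hD, Finset.sum_mul]
        _ ≤ D * (η * s * δ / (4 * (D + 1)) * n) := mul_le_mul_of_nonneg_left hes hD0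
        _ ≤ _ := by
          rw [← mul_assoc]
          refine mul_le_mul_of_nonneg_right ?_ hn0.le
          rw [← mul_div_assoc, div_le_div_iff₀ (by positivity) (by norm_num)]
          have : 0 < η * s * δ := by positivity
          nlinarith) (by
      intro z
      rw [S_apply (hnonneg n) (hbound n) hc0, hK', Finset.sum_mul, ← Finset.sum_add_distrib]
      refine Finset.sum_le_sum fun m _ => ?_
      have := mul_le_mul_of_nonneg_left (hr1 (m + 1) z) (hw m)
      rw [← Function.iterate_succ_apply] at this
      linarith) hn
  set a : ℝ := ((Finset.univ.filter fun z => Tn (β n) c z ≤ η * δ / (2 * (K' + 1))).card : ℝ)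
  have ha : 0 ≤ a := Nat.cast_nonneg _
  have h1 : η * δ / 2 ≤ η * δ - K' * (η * δ / (2 * (K' + 1))) := by
    have : K' * (η * δ / (2 * (K' + 1))) ≤ η * δ / 2 := by
      rw [← mul_div_assoc, div_le_div_iff₀ (by positivity) (by positivity)]
      have := mul_pos hη hδ
      nlinarith
    linarith
  have h2 := (mul_le_mul_of_nonneg_left h1 ha).trans key
  have e : (η * 1 * (s * δ / 4) + η * s * δ / 4) * n = (s * n) * (η * δ / 2) := by ring
  rw [e] at h2
  exact le_of_mul_le_mul_right h2 (by positivity)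

end LG
end GiantAux

namespace GiantAux

open Percolation ProbabilityTheory

section Perc

lemma bern_prob {p : ℝ} (h0 : 0 ≤ p) (h1 : p ≤ 1) : IsProbabilityMeasure (bern p) := by
  constructor
  simp only [bern, Measure.add_apply, Measure.smul_apply, measure_univ, smul_eq_mul, mul_one]
  rw [← ENNReal.ofReal_add h0 (by linarith)]
  simp

lemma bern_false (p : ℝ) : bern p {false} = ENNReal.ofReal (1 - p) := by
  simp [bern]

lemma pi_indep {ι : Type*} [Fintype ι] [DecidableEq ι] (m : ι → Measure Bool) [∀ i, IsProbabilityMeasure (m i)]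
    (S T : Finset ι) (hST : Disjoint S T) (A B : Set (ι → Bool))
    (hA : ∀ ω ω' : ι → Bool, (∀ e ∈ S, ω e = ω' e) → ω ∈ A → ω' ∈ A)
    (hB : ∀ ω ω' : ι → Bool, (∀ e ∈ T, ω e = ω' e) → ω ∈ B → ω' ∈ B) :
    Measure.pi m (A ∩ B) = Measure.pi m A * Measure.pi m B := by
  have hind := iIndepFun_pi (μ := m) (X := fun _ : ι => (id : Bool → Bool)) (fun i => aemeasurable_id)
  have h2 := hind.indepFun_finset S T hST (fun i => by fun_prop)
  have eA : A = (fun ω : ι → Bool => fun i : S => ω i) ⁻¹' ((fun ω : ι → Bool => fun i : S => ω i) '' A) := by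
    refine Set.Subset.antisymm (Set.subset_preimage_image _ _) ?_
    rintro ω ⟨ω', h', e⟩
    exact hA ω' ω (fun i hi => congrFun e ⟨i, hi⟩) h'
  have eB : B = (fun ω : ι → Bool => fun i : T => ω i) ⁻¹' ((fun ω : ι → Bool => fun i : T => ω i) '' B) := by
    refine Set.Subset.antisymm (Set.subset_preimage_image _ _) ?_
    rintro ω ⟨ω', h', e⟩
    exact hB ω' ω (fun i hi => congrFun e ⟨i, hi⟩) h'
  have h3 := h2.measure_inter_preimage_eq_mul ((fun ω : ι → Bool => fun i : S => ω i) '' A)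
    ((fun ω : ι → Bool => fun i : T => ω i) '' B) (Set.toFinite _).measurableSet (Set.toFinite _).measurableSet
  simp only [id] at h3
  rw [← eA, ← eB] at h3
  exact h3

lemma pi_false {ι : Type*} [Fintype ι] [DecidableEq ι] (m : ι → Measure Bool) [∀ i, IsProbabilityMeasure (m i)]
    (T : Finset ι) : Measure.pi m {ω | ∀ e ∈ T, ω e = false} = ∏ e ∈ T, m e {false} := by
  have : {ω : ι → Bool | ∀ e ∈ T, ω e = false} = Set.univ.pi fun e => if e ∈ T then {false} else Set.univ := by
    ext ω
    simp only [Set.mem_ofPred_eq, Set.mem_pi, Set.mem_univ, true_implies]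
    refine forall_congr' fun e => ?_
    by_cases h : e ∈ T <;> simp [h]
  rw [this, Measure.pi_pi, ← Finset.prod_subset (Finset.subset_univ T)]
  · exact Finset.prod_congr rfl fun e he => by simp [he]
  · intro e _ he
    simp only [he, if_false]
    exact measure_univ

variable {V : Type*} [Fintype V] [DecidableEq V]

/-- one exploration step -/
def stp (ω : Sym2 V → Bool) (R : Finset V) (x y : V) : Prop := y ∈ R ∧ x ≠ y ∧ ω s(x, y) = true

open Classical in
/-- the union of clusters of `V0` inside `R` -/
def clus (ω : Sym2 V → Bool) (R V0 : Finset V) : Finset V :=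
  Finset.univ.filter fun w => ∃ v ∈ V0, Relation.ReflTransGen (stp ω R) v w

lemma mem_clus {ω : Sym2 V → Bool} {R V0 : Finset V} {w : V} :
    w ∈ clus ω R V0 ↔ ∃ v ∈ V0, Relation.ReflTransGen (stp ω R) v w := by simp [clus]

lemma sub_clus (ω : Sym2 V → Bool) (R V0 : Finset V) : V0 ⊆ clus ω R V0 := fun v hv =>
  mem_clus.2 ⟨v, hv, Relation.ReflTransGen.refl⟩

lemma clus_closed {ω : Sym2 V → Bool} {R V0 : Finset V} {x y : V} (hx : x ∈ clus ω R V0) (h : stp ω R x y) :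
    y ∈ clus ω R V0 := by
  obtain ⟨v, hv, hr⟩ := mem_clus.1 hx
  exact mem_clus.2 ⟨v, hv, hr.tail h⟩

lemma clus_min {ω : Sym2 V → Bool} {R V0 S : Finset V} (h0 : V0 ⊆ S) (h : ∀ x ∈ S, ∀ y, stp ω R x y → y ∈ S) :
    clus ω R V0 ⊆ S := by
  intro w hw
  obtain ⟨v, hv, hr⟩ := mem_clus.1 hw
  induction hr with
  | refl => exact h0 hv
  | tail _ hs ih => exact h _ (ih (mem_clus.2 ⟨v, hv, by assumption⟩)) _ hs

lemma clus_sub {ω : Sym2 V → Bool} {R V0 : Finset V} (h0 : V0 ⊆ R) : clus ω R V0 ⊆ R :=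
  clus_min h0 fun _ _ _ h => h.1

lemma clus_local {ω : Sym2 V → Bool} {R V0 D : Finset V} (h0 : V0 ⊆ R) (hD : D ⊆ R) (hd : Disjoint V0 D) :
    (Disjoint (clus ω R V0) D ↔ ∀ x ∈ clus ω (R \ D) V0, ∀ w ∈ D, ω s(x, w) = false) ∧
    (Disjoint (clus ω R V0) D → clus ω R V0 = clus ω (R \ D) V0) := by
  have h0' : V0 ⊆ R \ D := Finset.subset_sdiff.2 ⟨h0, hd⟩
  have hsub : clus ω (R \ D) V0 ⊆ clus ω R V0 :=
    clus_min (sub_clus _ _ _) fun x hx y h => clus_closed hx ⟨(Finset.mem_sdiff.1 h.1).1, h.2⟩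
  have hC' : clus ω (R \ D) V0 ⊆ R \ D := clus_sub h0'
  have A1 : Disjoint (clus ω R V0) D → clus ω R V0 = clus ω (R \ D) V0 := by
    intro hdis
    refine Finset.Subset.antisymm ?_ hsub
    have : clus ω R V0 ⊆ clus ω R V0 ∩ clus ω (R \ D) V0 := by
      refine clus_min (Finset.subset_inter (sub_clus _ _ _) (sub_clus _ _ _)) ?_
      intro x hx y hy
      have hy1 := clus_closed (Finset.mem_inter.1 hx).1 hy
      refine Finset.mem_inter.2 ⟨hy1, clus_closed (Finset.mem_inter.1 hx).2 ⟨?_, hy.2⟩⟩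
      exact Finset.mem_sdiff.2 ⟨hy.1, Finset.disjoint_left.1 hdis hy1⟩
    exact this.trans Finset.inter_subset_right
  refine ⟨⟨fun hdis x hx w hw => ?_, fun h => ?_⟩, A1⟩
  · by_contra hne
    have hne' : ω s(x, w) = true := by simpa using hne
    have hxD : x ∉ D := (Finset.mem_sdiff.1 (hC' hx)).2
    have : w ∈ clus ω R V0 := clus_closed (hsub hx) ⟨hD hw, fun e => hxD (e ▸ hw), hne'⟩
    exact Finset.disjoint_left.1 hdis this hw
  · have : clus ω R V0 ⊆ clus ω (R \ D) V0 := by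
      refine clus_min (sub_clus _ _ _) fun x hx y hy => clus_closed hx ⟨Finset.mem_sdiff.2 ⟨hy.1, fun hyD => ?_⟩, hy.2⟩
      have := h x hx y hyD
      rw [hy.2.2] at this
      exact Bool.noConfusion this
    exact (Finset.sdiff_disjoint).mono_left (this.trans hC')

lemma clus_congr {ω ω' : Sym2 V → Bool} {R V0 D : Finset V} (h0 : V0 ⊆ R) (hd : Disjoint R D)
    (h : ∀ e : Sym2 V, (∀ w ∈ D, w ∉ e) → ω e = ω' e) : clus ω R V0 = clus ω' R V0 := by
  have key : ∀ ω ω' : Sym2 V → Bool, (∀ e : Sym2 V, (∀ w ∈ D, w ∉ e) → ω e = ω' e) → clus ω R V0 ⊆ clus ω' R V0 := by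
    intro ω ω' h
    have : clus ω R V0 ⊆ clus ω' R V0 ∩ R := by
      refine clus_min (Finset.subset_inter (sub_clus _ _ _) h0) fun x hx y hy => ?_
      obtain ⟨hx1, hx2⟩ := Finset.mem_inter.1 hx
      refine Finset.mem_inter.2 ⟨clus_closed hx1 ⟨hy.1, hy.2.1, ?_⟩, hy.1⟩
      rw [← h, hy.2.2]
      intro w hw hm
      rcases Sym2.mem_iff.1 hm with e | e
      · exact Finset.disjoint_left.1 hd hx2 (e ▸ hw)
      · exact Finset.disjoint_left.1 hd hy.1 (e ▸ hw)
    exact this.trans Finset.inter_subset_left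
  exact Finset.Subset.antisymm (key ω ω' h) (key ω' ω fun e he => (h e he).symm)

end Perc

end GiantAux

namespace GiantAux

open Percolation

/-- non-edge probability product -/
def Qf {n : ℕ} (b : Fin n → Fin n → ℝ) (C : Finset (Fin n)) (w : Fin n) : ℝ := ∏ x ∈ C, (1 - b x w / n)

lemma perc_prob {n : ℕ} (b : Fin n → Fin n → ℝ) (h0 : ∀ i j, 0 ≤ b i j) :
    IsProbabilityMeasure (percMeasure b (1 / n)) := by
  have h : ∀ e : Sym2 (Fin n), 0 ≤ min (1 / (n:ℝ) * sym2Val b e) 1 := by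
    intro e
    induction e using Sym2.ind with
    | _ x y =>
      refine le_min ?_ zero_le_one
      have := h0 x y
      have := h0 y x
      simp only [sym2Val, Sym2.lift_mk]
      positivity
  have : ∀ e : Sym2 (Fin n), IsProbabilityMeasure (bern (min (1 / (n:ℝ) * sym2Val b e) 1)) :=
    fun e => bern_prob (h e) (min_le_right _ _)
  unfold percMeasure
  infer_instance

lemma perc_noedge {n : ℕ} (hn : 0 < n) (b : Fin n → Fin n → ℝ) (h0 : ∀ i j, 0 ≤ b i j) (hs : ∀ i j, b i j = b j i)
    {B : ℝ} (hB : ∀ i j, b i j ≤ B) (hnB : 2 * B ≤ n) (S D : Finset (Fin n)) (hd : Disjoint S D) :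
    (percMeasure b (1 / n)).real {ω | ∀ x ∈ S, ∀ w ∈ D, ω s(x, w) = false} = ∏ w ∈ D, Qf b S w := by
  have h : ∀ e : Sym2 (Fin n), 0 ≤ min (1 / (n:ℝ) * sym2Val b e) 1 := by
    intro e
    induction e using Sym2.ind with
    | _ x y =>
      refine le_min ?_ zero_le_one
      have := h0 x y
      have := h0 y x
      simp only [sym2Val, Sym2.lift_mk]
      positivity
  have : ∀ e : Sym2 (Fin n), IsProbabilityMeasure (bern (min (1 / (n:ℝ) * sym2Val b e) 1)) :=
    fun e => bern_prob (h e) (min_le_right _ _)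
  have hn' : (0:ℝ) < n := by exact_mod_cast hn
  have hinj : Set.InjOn (fun p : Fin n × Fin n => s(p.1, p.2)) (S ×ˢ D : Finset (Fin n × Fin n)) := by
    rintro ⟨x, w⟩ h1 ⟨y, z⟩ h2 e
    simp only [Finset.coe_product, Set.mem_prod, Finset.mem_coe] at h1 h2
    simp only [Sym2.eq_iff] at e
    rcases e with ⟨e1, e2⟩ | ⟨e1, e2⟩
    · simp [e1, e2]
    · exact absurd h2.2 (Finset.disjoint_left.1 hd (e1 ▸ h1.1))
  have hset : {ω : Sym2 (Fin n) → Bool | ∀ x ∈ S, ∀ w ∈ D, ω s(x, w) = false} =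
      {ω | ∀ e ∈ (S ×ˢ D).image (fun p : Fin n × Fin n => s(p.1, p.2)), ω e = false} := by
    ext ω
    simp only [Set.mem_ofPred_eq, Finset.mem_image, Finset.mem_product]
    constructor
    · rintro h e ⟨⟨x, w⟩, ⟨hx, hw⟩, rfl⟩
      exact h x hx w hw
    · intro h x hx w hw
      exact h _ ⟨(x, w), ⟨hx, hw⟩, rfl⟩
  rw [Measure.real, percMeasure, hset, pi_false, Finset.prod_image hinj, Finset.prod_product_right,
    ENNReal.toReal_prod]
  refine Finset.prod_congr rfl fun w hw => ?_
  rw [Qf, ENNReal.toReal_prod]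
  refine Finset.prod_congr rfl fun x hx => ?_
  have e1 : sym2Val b s(x, w) = b x w := by
    simp only [sym2Val, Sym2.lift_mk]; rw [hs w x]; ring
  have e2 : b x w / n ≤ 1 := by
    rw [div_le_one hn']; have := hB x w; have := h0 x w; linarith
  have e3 : (1 / (n:ℝ) * b x w) = b x w / n := by ring
  simp only [bern_false, e1, e3, min_eq_left e2]
  exact ENNReal.toReal_ofReal (by linarith)

lemma Qf_bounds {n : ℕ} (hn : 0 < n) (b : Fin n → Fin n → ℝ) (h0 : ∀ i j, 0 ≤ b i j)
    {B : ℝ} (hB : ∀ i j, b i j ≤ B) (hnB : 2 * B ≤ n) (C : Finset (Fin n)) (w : Fin n) :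
    0 < Qf b C w ∧ (Qf b C w)⁻¹ ≤ Real.exp (2 * B) ∧ 1 + ∑ x ∈ C, b x w / n ≤ (Qf b C w)⁻¹ := by
  have hn' : (0:ℝ) < n := by exact_mod_cast hn
  have hB0 : 0 ≤ B := (h0 w w).trans (hB w w)
  have hp : ∀ x, 0 ≤ b x w / n := fun x => div_nonneg (h0 x w) hn'.le
  have hp2 : ∀ x, b x w / n ≤ 1 / 2 := fun x => by
    rw [div_le_iff₀ hn']; have := hB x w; linarith
  have hpos : 0 < Qf b C w := Finset.prod_pos fun x _ => by linarith [hp2 x]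
  refine ⟨hpos, ?_, ?_⟩
  · rw [Qf, ← Finset.prod_inv_distrib]
    calc ∏ x ∈ C, (1 - b x w / n)⁻¹ ≤ ∏ x ∈ C, Real.exp (2 * (b x w / n)) := by
          refine Finset.prod_le_prod (fun x _ => inv_nonneg.2 (by linarith [hp2 x])) fun x _ => ?_
          have h1 : (1 - b x w / n)⁻¹ ≤ 1 + 2 * (b x w / n) := by
            rw [inv_le_iff_one_le_mul₀ (by linarith [hp2 x])]
            nlinarith [hp x, hp2 x]
          linarith [Real.add_one_le_exp (2 * (b x w / n))]
      _ = Real.exp (∑ x ∈ C, 2 * (b x w / n)) := (Real.exp_sum _ _).symm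
      _ ≤ Real.exp (2 * B) := by
          refine Real.exp_le_exp.2 ?_
          calc ∑ x ∈ C, 2 * (b x w / n) ≤ ∑ x : Fin n, 2 * (B / n) := by
                refine (Finset.sum_le_univ_sum_of_nonneg fun x => by linarith [hp x]).trans ?_
                exact Finset.sum_le_sum fun x _ => by have := hB x w; gcongr
            _ = 2 * B := by simp; field_simp
  · rw [le_inv_comm₀ (by have := Finset.sum_nonneg fun x (_ : x ∈ C) => hp x; linarith) hpos]
    have hS := Finset.sum_nonneg fun x (_ : x ∈ C) => hp x
    have h1 : Qf b C w ≤ Real.exp (-(∑ x ∈ C, b x w / n)) := by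
      rw [← Finset.sum_neg_distrib, Real.exp_sum]
      refine Finset.prod_le_prod (fun x _ => by linarith [hp2 x]) fun x _ => ?_
      linarith [Real.add_one_le_exp (-(b x w / n))]
    refine h1.trans ?_
    rw [Real.exp_neg]
    refine inv_anti₀ (by linarith) ?_
    linarith [Real.add_one_le_exp (∑ x ∈ C, b x w / n)]

lemma perc_id {n : ℕ} (hn : 0 < n) (b : Fin n → Fin n → ℝ) (h0 : ∀ i j, 0 ≤ b i j) (hs : ∀ i j, b i j = b j i)
    {B : ℝ} (hB : ∀ i j, b i j ≤ B) (hnB : 2 * B ≤ n) (R V0 D : Finset (Fin n)) (h0R : V0 ⊆ R) (hDR : D ⊆ R)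
    (hd : Disjoint V0 D) :
    ∫ ω, (if Disjoint (clus ω R V0) D then ∏ w ∈ D, (Qf b (clus ω R V0) w)⁻¹ else 0) ∂(percMeasure b (1 / n)) = 1 := by
  have := perc_prob b h0
  have hV0' : V0 ⊆ R \ D := Finset.subset_sdiff.2 ⟨h0R, hd⟩
  set μ := percMeasure b (1 / n) with hμ
  let E : Finset (Fin n) → Set (Sym2 (Fin n) → Bool) := fun S => {ω | clus ω (R \ D) V0 = S}
  let N : Finset (Fin n) → Set (Sym2 (Fin n) → Bool) := fun S => {ω | ∀ x ∈ S, ∀ w ∈ D, ω s(x, w) = false}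
  have hfun : ∀ ω, (if Disjoint (clus ω R V0) D then ∏ w ∈ D, (Qf b (clus ω R V0) w)⁻¹ else 0) =
      ∑ S : Finset (Fin n), (E S ∩ N S).indicator (fun _ => ∏ w ∈ D, (Qf b S w)⁻¹) ω := by
    intro ω
    rw [Finset.sum_eq_single (clus ω (R \ D) V0)]
    · obtain ⟨a1, a2⟩ := clus_local (ω := ω) h0R hDR hd
      by_cases hdis : Disjoint (clus ω R V0) D
      · rw [if_pos hdis, Set.indicator_of_mem, a2 hdis]
        exact ⟨rfl, a1.1 hdis⟩
      · rw [if_neg hdis, Set.indicator_of_notMem]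
        exact fun h => hdis (a1.2 h.2)
    · intro S _ hne
      exact Set.indicator_of_notMem (fun h => hne h.1.symm) _
    · simp
  have hmeas : ∀ A : Set (Sym2 (Fin n) → Bool), MeasurableSet A := fun A => (Set.toFinite A).measurableSet
  have hprod : ∀ S, μ.real (E S ∩ N S) * ∏ w ∈ D, (Qf b S w)⁻¹ = μ.real (E S) := by
    intro S
    by_cases hS : S ⊆ R \ D
    · have hSD : Disjoint S D := Finset.sdiff_disjoint.mono_left hS
      have h : ∀ e : Sym2 (Fin n), 0 ≤ min (1 / (n:ℝ) * sym2Val b e) 1 := by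
        intro e
        induction e using Sym2.ind with
        | _ x y =>
          refine le_min ?_ zero_le_one
          have := h0 x y
          have := h0 y x
          simp only [sym2Val, Sym2.lift_mk]
          positivity
      have : ∀ e : Sym2 (Fin n), IsProbabilityMeasure (bern (min (1 / (n:ℝ) * sym2Val b e) 1)) :=
        fun e => bern_prob (h e) (min_le_right _ _)
      have hi : μ (E S ∩ N S) = μ (E S) * μ (N S) := by
        classical
        refine pi_indep _ (Finset.univ.filter fun e : Sym2 (Fin n) => ∀ w ∈ D, w ∉ e)
          (Finset.univ.filter fun e : Sym2 (Fin n) => ¬ ∀ w ∈ D, w ∉ e) (Finset.disjoint_filter_filter_not _ _ _) _ _ ?_ ?_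
        · intro ω ω' h' hω
          have := clus_congr (ω := ω) (ω' := ω') (D := D) hV0' Finset.sdiff_disjoint
            (fun e he => h' e (by simpa using he))
          change clus ω' (R \ D) V0 = S
          rw [← this]; exact hω
        · intro ω ω' h' hω x hx w hw
          rw [← h' s(x, w) (by
            simp only [Finset.mem_filter, Finset.mem_univ, true_and]
            intro hh
            exact hh w hw (Sym2.mem_mk_right x w))]
          exact hω x hx w hw
      have hr : μ.real (E S ∩ N S) = μ.real (E S) * μ.real (N S) := by
        simp only [Measure.real, hi, ENNReal.toReal_mul]
      rw [hr, perc_noedge hn b h0 hs hB hnB S D hSD, mul_assoc, ← Finset.prod_mul_distrib,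
        Finset.prod_eq_one, mul_one]
      intro w _
      exact mul_inv_cancel₀ (Qf_bounds hn b h0 hB hnB S w).1.ne'
    · have hE : E S = ∅ := by
        ext ω
        simp only [Set.mem_empty_iff_false, iff_false]
        intro h
        exact hS (h ▸ clus_sub hV0')
      simp [hE]
  simp only [hfun]
  rw [integral_finsetSum _ fun S _ => Integrable.of_finite]
  simp only [integral_indicator_const _ (hmeas _), smul_eq_mul, hprod]
  have : ∑ S : Finset (Fin n), μ.real (E S) = ∑ S : Finset (Fin n), ∫ ω, (E S).indicator (fun _ => (1:ℝ)) ω ∂μ := by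
    refine Finset.sum_congr rfl fun S _ => ?_
    rw [integral_indicator_const _ (hmeas _)]; simp
  rw [this, ← integral_finsetSum _ fun S _ => Integrable.of_finite]
  have h1 : ∀ ω, ∑ S : Finset (Fin n), (E S).indicator (fun _ => (1:ℝ)) ω = 1 := by
    intro ω
    rw [Finset.sum_eq_single (clus ω (R \ D) V0)]
    · exact Set.indicator_of_mem (s := E (clus ω (R \ D) V0)) (show ω ∈ E (clus ω (R \ D) V0) from rfl) (fun _ => (1:ℝ))
    · intro S _ hne
      exact Set.indicator_of_notMem (s := E S) (fun h => hne (Eq.symm h)) (fun _ => (1:ℝ))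
    · simp
  simp [h1]

/-- normalised indicator of non-exploration -/
def Hf {n : ℕ} (b : Fin n → Fin n → ℝ) (C : Finset (Fin n)) (w : Fin n) : ℝ :=
  if w ∈ C then 0 else (Qf b C w)⁻¹

/-- the error term -/
def errf {n : ℕ} (b : Fin n → Fin n → ℝ) (R V0 : Finset (Fin n)) (a : Fin n → ℝ) (ω : Sym2 (Fin n) → Bool) : ℝ :=
  ∑ w ∈ R \ V0, a w * (Hf b (clus ω R V0) w - 1)

lemma Hf_mean {n : ℕ} (hn : 0 < n) (b : Fin n → Fin n → ℝ) (h0 : ∀ i j, 0 ≤ b i j) (hs : ∀ i j, b i j = b j i)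
    {B : ℝ} (hB : ∀ i j, b i j ≤ B) (hnB : 2 * B ≤ n) (R V0 : Finset (Fin n)) (h0R : V0 ⊆ R) (w : Fin n)
    (hw : w ∈ R \ V0) : ∫ ω, Hf b (clus ω R V0) w ∂(percMeasure b (1 / n)) = 1 := by
  have hw' := Finset.mem_sdiff.1 hw
  have := perc_id hn b h0 hs hB hnB R V0 {w} h0R (by simpa using hw'.1) (by simpa using hw'.2)
  refine Eq.trans ?_ this
  refine integral_congr_ae (Eventually.of_forall fun ω => ?_)
  beta_reduce
  simp only [Hf, Finset.disjoint_singleton_right, Finset.prod_singleton]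
  by_cases h : w ∈ clus ω R V0 <;> simp [h]

lemma Hf_cov {n : ℕ} (hn : 0 < n) (b : Fin n → Fin n → ℝ) (h0 : ∀ i j, 0 ≤ b i j) (hs : ∀ i j, b i j = b j i)
    {B : ℝ} (hB : ∀ i j, b i j ≤ B) (hnB : 2 * B ≤ n) (R V0 : Finset (Fin n)) (h0R : V0 ⊆ R) (w z : Fin n)
    (hw : w ∈ R \ V0) (hz : z ∈ R \ V0) (hwz : w ≠ z) :
    ∫ ω, Hf b (clus ω R V0) w * Hf b (clus ω R V0) z ∂(percMeasure b (1 / n)) = 1 := by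
  have hw' := Finset.mem_sdiff.1 hw
  have hz' := Finset.mem_sdiff.1 hz
  have := perc_id hn b h0 hs hB hnB R V0 {w, z} h0R
    (by intro x hx; rcases Finset.mem_insert.1 hx with rfl | hx
        · exact hw'.1
        · rw [Finset.mem_singleton.1 hx]; exact hz'.1)
    (by rw [Finset.disjoint_insert_right, Finset.disjoint_singleton_right]; exact ⟨hw'.2, hz'.2⟩)
  refine Eq.trans ?_ this
  refine integral_congr_ae (Eventually.of_forall fun ω => ?_)
  beta_reduce
  simp only [Hf, Finset.disjoint_insert_right, Finset.disjoint_singleton_right, Finset.prod_pair hwz]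
  by_cases h : w ∈ clus ω R V0 <;> by_cases h2 : z ∈ clus ω R V0 <;> simp [h, h2]

lemma Hf_bd {n : ℕ} (hn : 0 < n) (b : Fin n → Fin n → ℝ) (h0 : ∀ i j, 0 ≤ b i j)
    {B : ℝ} (hB : ∀ i j, b i j ≤ B) (hnB : 2 * B ≤ n) (C : Finset (Fin n)) (w : Fin n) :
    0 ≤ Hf b C w ∧ Hf b C w ≤ Real.exp (2 * B) := by
  obtain ⟨h1, h2, h3⟩ := Qf_bounds hn b h0 hB hnB C w
  unfold Hf
  split_ifs
  · exact ⟨le_rfl, (Real.exp_pos _).le⟩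
  · exact ⟨(inv_pos.2 h1).le, h2⟩

lemma errf_var {n : ℕ} (hn : 0 < n) (b : Fin n → Fin n → ℝ) (h0 : ∀ i j, 0 ≤ b i j) (hs : ∀ i j, b i j = b j i)
    {B : ℝ} (hB : ∀ i j, b i j ≤ B) (hnB : 2 * B ≤ n) (R V0 : Finset (Fin n)) (h0R : V0 ⊆ R)
    (a : Fin n → ℝ) {A : ℝ} (ha : ∀ w, 0 ≤ a w) (hA : ∀ w, a w ≤ A) :
    ∫ ω, (errf b R V0 a ω) ^ 2 ∂(percMeasure b (1 / n)) ≤ n * (A ^ 2 * Real.exp (4 * B)) := by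
  have := perc_prob b h0
  set μ := percMeasure b (1 / n) with hμ
  have hexp : ∀ ω, (errf b R V0 a ω) ^ 2 = ∑ w ∈ R \ V0, ∑ z ∈ R \ V0,
      a w * a z * (Hf b (clus ω R V0) w * Hf b (clus ω R V0) z - Hf b (clus ω R V0) w - Hf b (clus ω R V0) z + 1) := by
    intro ω
    rw [errf, sq, Finset.sum_mul_sum]
    refine Finset.sum_congr rfl fun w _ => Finset.sum_congr rfl fun z _ => ?_
    ring
  simp only [hexp]
  rw [integral_finsetSum _ fun S _ => Integrable.of_finite]
  calc _ ≤ ∑ w ∈ R \ V0, (A ^ 2 * Real.exp (4 * B)) := by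
        refine Finset.sum_le_sum fun w hw => ?_
        rw [integral_finsetSum _ fun S _ => Integrable.of_finite, Finset.sum_eq_single w]
        · rw [integral_const_mul, integral_add Integrable.of_finite Integrable.of_finite,
            integral_sub Integrable.of_finite Integrable.of_finite,
            integral_sub Integrable.of_finite Integrable.of_finite,
            Hf_mean hn b h0 hs hB hnB R V0 h0R w hw]
          have h1 : ∫ ω, Hf b (clus ω R V0) w * Hf b (clus ω R V0) w ∂μ ≤ ∫ ω, Real.exp (4 * B) ∂μ := by
            refine integral_mono Integrable.of_finite Integrable.of_finite fun ω => ?_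
            obtain ⟨h1, h2⟩ := Hf_bd hn b h0 hB hnB (clus ω R V0) w
            have : Real.exp (4 * B) = Real.exp (2 * B) * Real.exp (2 * B) := by
              rw [← Real.exp_add]; ring_nf
            beta_reduce
            rw [this]
            exact mul_le_mul h2 h2 h1 (h1.trans h2)
          simp only [integral_const, probReal_univ, smul_eq_mul, one_mul, mul_one] at h1 ⊢
          have hA0 : 0 ≤ A := (ha w).trans (hA w)
          calc a w * a w * (∫ ω, Hf b (clus ω R V0) w * Hf b (clus ω R V0) w ∂μ - 1 - 1 + 1)
              ≤ a w * a w * Real.exp (4 * B) := by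
                refine mul_le_mul_of_nonneg_left (by linarith) (mul_self_nonneg _)
            _ ≤ A ^ 2 * Real.exp (4 * B) := by
                rw [sq]
                exact mul_le_mul_of_nonneg_right (mul_le_mul (hA w) (hA w) (ha w) hA0) (Real.exp_pos _).le
        · intro z hz hne
          rw [integral_const_mul, integral_add Integrable.of_finite Integrable.of_finite,
            integral_sub Integrable.of_finite Integrable.of_finite,
            integral_sub Integrable.of_finite Integrable.of_finite,
            Hf_mean hn b h0 hs hB hnB R V0 h0R w hw, Hf_mean hn b h0 hs hB hnB R V0 h0R z hz,
            Hf_cov hn b h0 hs hB hnB R V0 h0R w z hw hz hne.symm]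
          simp
        · intro h; exact absurd hw h
    _ ≤ n * (A ^ 2 * Real.exp (4 * B)) := by
        rw [Finset.sum_const, nsmul_eq_mul]
        refine mul_le_mul_of_nonneg_right ?_ (by positivity)
        exact_mod_cast (Finset.card_le_univ _).trans (by simp)

lemma errf_det {n : ℕ} (hn : 0 < n) (b : Fin n → Fin n → ℝ) (h0 : ∀ i j, 0 ≤ b i j)
    (hs : ∀ i j, b i j = b j i)
    {B : ℝ} (hB : ∀ i j, b i j ≤ B) (hnB : 2 * B ≤ n) (R V0 : Finset (Fin n)) (h0R : V0 ⊆ R)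
    (a : Fin n → ℝ) (ha : ∀ w, 0 ≤ a w) (ω : Sym2 (Fin n) → Bool) :
    ∑ w ∈ R \ clus ω R V0, a w * Tn b (fun y => if y ∈ clus ω R V0 then 1 else 0) w ≤
      ∑ w ∈ clus ω R V0 \ V0, a w + errf b R V0 a ω := by
  set C := clus ω R V0 with hC
  have hVC : V0 ⊆ C := sub_clus _ _ _
  have hCR : C ⊆ R := clus_sub h0R
  have hsplit : R \ V0 = (R \ C) ∪ (C \ V0) := by
    ext w; simp only [Finset.mem_sdiff, Finset.mem_union]
    constructor
    · rintro ⟨h1, h2⟩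
      by_cases h : w ∈ C
      · exact Or.inr ⟨h, h2⟩
      · exact Or.inl ⟨h1, h⟩
    · rintro (⟨h1, h2⟩ | ⟨h1, h2⟩)
      · exact ⟨h1, fun h => h2 (hVC h)⟩
      · exact ⟨hCR h1, h2⟩
  have hdis : Disjoint (R \ C) (C \ V0) := by
    refine Finset.disjoint_left.2 fun w h1 h2 => ?_
    exact (Finset.mem_sdiff.1 h1).2 (Finset.mem_sdiff.1 h2).1
  rw [errf, hsplit, Finset.sum_union hdis]
  have e1 : ∑ w ∈ C \ V0, a w * (Hf b (clus ω R V0) w - 1) = - ∑ w ∈ C \ V0, a w := by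
    rw [← Finset.sum_neg_distrib]
    refine Finset.sum_congr rfl fun w hw => ?_
    rw [Hf, if_pos (Finset.mem_sdiff.1 hw).1]; ring
  rw [e1]
  have e2 : ∑ w ∈ R \ C, a w * Tn b (fun y => if y ∈ C then 1 else 0) w ≤
      ∑ w ∈ R \ C, a w * (Hf b (clus ω R V0) w - 1) := by
    refine Finset.sum_le_sum fun w hw => mul_le_mul_of_nonneg_left ?_ (ha w)
    rw [Hf, if_neg (Finset.mem_sdiff.1 hw).2]
    have h3 := (Qf_bounds hn b h0 hB hnB C w).2.2
    have : Tn b (fun y => if y ∈ C then 1 else 0) w = ∑ x ∈ C, b x w / n := by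
      simp only [Tn, mul_ite, mul_one, mul_zero, Finset.sum_ite_mem, Finset.univ_inter, Finset.sum_div]
      exact Finset.sum_congr rfl fun x _ => by rw [hs w x]
    rw [this]
    linarith
  linarith

end GiantAux

namespace GiantAux

open Percolation

/-- the family of `m`-subsets -/
def Pm (n k : ℕ) : Finset (Finset (Fin n)) := Finset.univ.filter fun S : Finset (Fin n) => S.card = n / k

lemma Pm_card_pos (n k : ℕ) : 0 < (Pm n k).card := by
  obtain ⟨S, _, hS⟩ := Finset.exists_subset_card_eq (s := (Finset.univ : Finset (Fin n))) (n := n / k)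
    (by simpa using Nat.div_le_self n k)
  exact Finset.card_pos.2 ⟨S, by simp [Pm, hS]⟩

lemma integral_unifSubset (n k : ℕ) (F : Finset (Fin n) → ℝ) :
    ∫ L, F L ∂(unifSubset n k) = (∑ L ∈ Pm n k, F L) / (Pm n k).card := by
  have : unifSubset n k = ((Pm n k).card : ENNReal)⁻¹ • ∑ S ∈ Pm n k, Measure.dirac S := rfl
  rw [this, integral_smul_measure, integral_finsetSum_measure (fun i _ => Integrable.of_finite)]
  simp only [integral_dirac, ENNReal.toReal_inv, ENNReal.toReal_natCast, smul_eq_mul]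
  rw [mul_comm, div_eq_mul_inv]

lemma unifSubset_prob (n k : ℕ) : IsProbabilityMeasure (unifSubset n k) := by
  constructor
  have : unifSubset n k = ((Pm n k).card : ENNReal)⁻¹ • ∑ S ∈ Pm n k, Measure.dirac S := rfl
  rw [this]
  simp only [Measure.smul_apply, Measure.coe_finsetSum, Finset.sum_apply, measure_univ, Finset.sum_const,
    smul_eq_mul, nsmul_eq_mul, mul_one]
  exact ENNReal.inv_mul_cancel (by exact_mod_cast (Pm_card_pos n k).ne') (ENNReal.natCast_ne_top _)

/-- centred indicator of the complement of `L` -/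
def xi (n k : ℕ) (L : Finset (Fin n)) (w : Fin n) : ℝ :=
  (if w ∈ Finset.univ \ L then 1 else 0) - (1 - ((n / k : ℕ) : ℝ) / n)

lemma xi_sq_le (n k : ℕ) (L : Finset (Fin n)) (w : Fin n) : xi n k L w * xi n k L w ≤ 1 := by
  have h1 : (((n / k : ℕ) : ℝ) / n) ≤ 1 := div_le_one_of_le₀ (by exact_mod_cast Nat.div_le_self n k) (by positivity)
  have h0 : 0 ≤ (((n / k : ℕ) : ℝ) / n) := by positivity
  unfold xi
  split_ifs <;> nlinarith

lemma xi_sum (n k : ℕ) (hn : 0 < n) (L : Finset (Fin n)) (hL : L ∈ Pm n k) : ∑ w, xi n k L w = 0 := by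
  have hc : L.card = n / k := by simpa [Pm] using hL
  have hn' : (0:ℝ) < n := by exact_mod_cast hn
  simp only [xi, Finset.sum_sub_distrib, Finset.sum_ite_mem, Finset.univ_inter, Finset.sum_const,
    nsmul_eq_mul, mul_one, Finset.card_univ, Fintype.card_fin]
  rw [Finset.card_sdiff_of_subset (Finset.subset_univ _), hc, Nat.cast_sub (by simpa using Nat.div_le_self n k)]
  simp only [Finset.card_univ, Fintype.card_fin]
  field_simp
  ring

/-- covariance matrix -/
def Mx (n k : ℕ) (w z : Fin n) : ℝ := ∑ L ∈ Pm n k, xi n k L w * xi n k L z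

lemma Mx_perm (n k : ℕ) (π : Equiv.Perm (Fin n)) (w z : Fin n) : Mx n k (π w) (π z) = Mx n k w z := by
  unfold Mx
  symm
  refine Finset.sum_bij (fun L _ => L.map π.toEmbedding) ?_ ?_ ?_ ?_
  · intro L hL
    simpa [Pm] using hL
  · intro L _ L' _ h
    exact Finset.map_injective _ h
  · intro L hL
    refine ⟨L.map π.symm.toEmbedding, by simpa [Pm] using hL, ?_⟩
    ext x; simp
  · intro L hL
    simp [xi]

lemma subset_var (n k : ℕ) (hn : 2 ≤ n) (a : Fin n → ℝ) :
    ∑ L ∈ Pm n k, (∑ w, a w * xi n k L w) ^ 2 ≤ 2 * (Pm n k).card * ∑ w, a w ^ 2 := by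
  have hn' : (2:ℝ) ≤ n := by exact_mod_cast hn
  have e1 : ∑ L ∈ Pm n k, (∑ w, a w * xi n k L w) ^ 2 = ∑ w, ∑ z, a w * a z * Mx n k w z := by
    simp only [sq, Finset.sum_mul_sum]
    simp only [Mx, Finset.mul_sum]
    rw [Finset.sum_comm]
    refine Finset.sum_congr rfl fun w _ => ?_
    rw [Finset.sum_comm]
    refine Finset.sum_congr rfl fun z _ => Finset.sum_congr rfl fun L _ => ?_
    ring
  obtain ⟨w0⟩ : Nonempty (Fin n) := ⟨⟨0, by omega⟩⟩
  set v := Mx n k w0 w0 with hv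
  have hdiag : ∀ w, Mx n k w w = v := by
    intro w
    have := Mx_perm n k (Equiv.swap w0 w) w0 w0
    simpa using this
  have hoff : ∀ w z, w ≠ z → Mx n k w z = -v / (n - 1) := by
    intro w z hne
    have hrow : ∑ y, Mx n k w y = 0 := by
      unfold Mx
      rw [Finset.sum_comm]
      refine Finset.sum_eq_zero fun L hL => ?_
      rw [← Finset.mul_sum, xi_sum n k (by omega) L hL, mul_zero]
    rw [← Finset.add_sum_erase _ _ (Finset.mem_univ w), hdiag] at hrow
    have hc : ∀ y ∈ Finset.univ.erase w, Mx n k w y = Mx n k w z := by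
      intro y hy
      have hy' := Finset.ne_of_mem_erase hy
      have := Mx_perm n k (Equiv.swap z y) w z
      rw [Equiv.swap_apply_of_ne_of_ne hne hy'.symm, Equiv.swap_apply_left] at this
      exact this
    rw [Finset.sum_congr rfl hc, Finset.sum_const, Finset.card_erase_of_mem (Finset.mem_univ _)] at hrow
    simp only [Finset.card_univ, Fintype.card_fin, nsmul_eq_mul] at hrow
    rw [Nat.cast_sub (by omega)] at hrow
    rw [eq_div_iff (by linarith)]
    push_cast at hrow
    linarith
  have hv0 : 0 ≤ v := Finset.sum_nonneg fun L _ => mul_self_nonneg _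
  have hv1 : v ≤ (Pm n k).card := by
    have : v ≤ ∑ L ∈ Pm n k, (1:ℝ) := Finset.sum_le_sum fun L _ => xi_sq_le n k L w0
    simpa using this
  set c := v / (n - 1) with hc
  have hc0 : 0 ≤ c := div_nonneg hv0 (by linarith)
  have hcv : c ≤ v := div_le_self hv0 (by linarith)
  have e2 : ∀ w z, a w * a z * Mx n k w z = -c * (a w * a z) + (if z = w then (v + c) * (a w) ^ 2 else 0) := by
    intro w z
    by_cases h : z = w
    · subst h; rw [hdiag, if_pos rfl]; ring
    · rw [hoff w z (Ne.symm h), if_neg h, hc]; ring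
  rw [e1]
  simp only [e2, Finset.sum_add_distrib, Finset.sum_ite_eq', Finset.mem_univ, if_true]
  have e3 : ∑ w, ∑ z, -c * (a w * a z) = -c * (∑ w, a w) ^ 2 := by
    rw [sq, Finset.sum_mul_sum, Finset.mul_sum]
    exact Finset.sum_congr rfl fun w _ => by rw [Finset.mul_sum]
  rw [e3, ← Finset.mul_sum]
  have hS : 0 ≤ ∑ w, a w ^ 2 := Finset.sum_nonneg fun w _ => sq_nonneg _
  nlinarith [mul_nonneg hc0 (sq_nonneg (∑ w, a w)), mul_le_mul_of_nonneg_right (show v + c ≤ 2 * (Pm n k).card by linarith) hS]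

lemma abs_le_half {t s : ℝ} (ht : 0 < t) : |s| ≤ (t + s ^ 2 / t) / 2 := by
  have h : s ^ 2 / t * t = s ^ 2 := div_mul_cancel₀ _ ht.ne'
  have h2 : s ^ 2 = |s| ^ 2 := (sq_abs s).symm
  have : 0 ≤ (t + s ^ 2 / t - 2 * |s|) * t := by nlinarith [sq_nonneg (t - |s|)]
  have := nonneg_of_mul_nonneg_left this ht
  linarith

lemma subset_abs (n k : ℕ) (hn : 2 ≤ n) (a : Fin n → ℝ) {A : ℝ} (hA : ∀ w, |a w| ≤ A) :
    ∫ L, |∑ w, a w * xi n k L w| ∂(unifSubset n k) ≤ Real.sqrt n * (1 + A ^ 2) := by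
  have := unifSubset_prob n k
  have hn' : (0:ℝ) < n := by exact_mod_cast (by omega : 0 < n)
  have ht : 0 < Real.sqrt n := Real.sqrt_pos.2 hn'
  have hP : (0:ℝ) < (Pm n k).card := by exact_mod_cast Pm_card_pos n k
  calc ∫ L, |∑ w, a w * xi n k L w| ∂(unifSubset n k)
      ≤ ∫ L, (Real.sqrt n + (∑ w, a w * xi n k L w) ^ 2 / Real.sqrt n) / 2 ∂(unifSubset n k) :=
        integral_mono Integrable.of_finite Integrable.of_finite fun L => abs_le_half ht
    _ = (Real.sqrt n + (∫ L, (∑ w, a w * xi n k L w) ^ 2 ∂(unifSubset n k)) / Real.sqrt n) / 2 := by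
        rw [integral_div, integral_add Integrable.of_finite Integrable.of_finite, integral_div]
        simp
    _ ≤ (Real.sqrt n + (2 * (n * A ^ 2)) / Real.sqrt n) / 2 := by
        gcongr
        rw [integral_unifSubset, div_le_iff₀ hP]
        refine (subset_var n k hn a).trans ?_
        have : ∑ w, a w ^ 2 ≤ ∑ w : Fin n, A ^ 2 := Finset.sum_le_sum fun w _ => by
          rw [← sq_abs]; exact pow_le_pow_left₀ (abs_nonneg _) (hA w) 2
        simp only [Finset.sum_const, Finset.card_univ, Fintype.card_fin, nsmul_eq_mul] at this
        nlinarith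
    _ = Real.sqrt n * (1 / 2 + A ^ 2) := by
        have : (2 * (n * A ^ 2)) / Real.sqrt n = 2 * A ^ 2 * Real.sqrt n := by
          rw [div_eq_iff ht.ne', mul_assoc, Real.mul_self_sqrt hn'.le]; ring
        rw [this]; ring
    _ ≤ _ := by gcongr; norm_num

end GiantAux

namespace GiantAux

open Percolation

/-- real indicator -/
def ind {n : ℕ} (C : Finset (Fin n)) (y : Fin n) : ℝ := if y ∈ C then 1 else 0

/-- discrepancy of the two-step kernel -/
def dz {n : ℕ} (b : Fin n → Fin n → ℝ) (k : ℕ) (L : Finset (Fin n)) (z : Fin n) : ℝ :=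
  (∑ y, |∑ w, (b z w * b w y) * xi n k L w|) / n

lemma ind_sum {n : ℕ} (C : Finset (Fin n)) : ∑ y, ind C y = C.card := by simp [ind]

lemma sum_mul_ind {n : ℕ} (C : Finset (Fin n)) (f : Fin n → ℝ) : ∑ y, f y * ind C y = ∑ y ∈ C, f y := by
  simp [ind]

lemma sum_xi {n : ℕ} (k : ℕ) (L : Finset (Fin n)) (f : Fin n → ℝ) :
    ∑ w ∈ Finset.univ \ L, f w = (1 - ((n / k : ℕ) : ℝ) / n) * ∑ w, f w + ∑ w, f w * xi n k L w := by
  have : ∀ w, f w * xi n k L w = f w * ind (Finset.univ \ L) w - (1 - ((n / k : ℕ) : ℝ) / n) * f w := by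
    intro w; simp only [xi, ind]; ring
  simp only [this, Finset.sum_sub_distrib, sum_mul_ind, ← Finset.mul_sum]
  ring

lemma K_det {n : ℕ} [NeZero n] (b : Fin n → Fin n → ℝ) (h0 : ∀ i j, 0 ≤ b i j) (hs : ∀ i j, b i j = b j i)
    {B : ℝ} (hB : ∀ i j, b i j ≤ B) (hnB : 2 * B ≤ n) (k : ℕ) (L : Finset (Fin n)) {q : ℝ} (hq : 0 < q)
    (hqn : q ≤ 1 - ((n / k : ℕ) : ℝ) / n) (v : Fin n) (hv : v ∈ Finset.univ \ L) (ω : Sym2 (Fin n) → Bool) (z : Fin n) :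
    Tn b (Tn b (ind (clus ω (Finset.univ \ L) {v}))) z ≤
      ((1 + B) / q) * Tn b (ind (clus ω (Finset.univ \ L) {v})) z +
      (|errf b (Finset.univ \ L) {v} (b z) ω| + dz b k L z) / (q * n) := by
  have hn : 0 < n := Nat.pos_of_ne_zero (NeZero.ne n)
  have hn' : (0:ℝ) < n := by exact_mod_cast hn
  have hB0 : 0 ≤ B := (h0 v v).trans (hB v v)
  set R := Finset.univ \ L with hR
  set C := clus ω R {v} with hC
  have hvR : ({v} : Finset (Fin n)) ⊆ R := by simpa using hv
  have hCR : C ⊆ R := clus_sub hvR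
  have hdet := errf_det hn b h0 hs hB hnB R {v} hvR (b z) (h0 z) ω
  change ∑ w ∈ R \ C, b z w * Tn b (ind C) w ≤ ∑ w ∈ C \ {v}, b z w + errf b R {v} (b z) ω at hdet
  set u := Tn b (ind C) with hu
  have hi0 : ∀ y, 0 ≤ ind C y := fun y => by unfold ind; split_ifs <;> norm_num
  have hi1 : ∀ y, ind C y ≤ 1 := fun y => by unfold ind; split_ifs <;> norm_num
  have huz : ∑ w ∈ C, b z w = n * u z := by
    rw [hu, Tn, sum_mul_ind]; field_simp
  have hCv : ∑ w ∈ C \ {v}, b z w ≤ ∑ w ∈ C, b z w :=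
    Finset.sum_le_sum_of_subset_of_nonneg Finset.sdiff_subset fun w _ _ => h0 z w
  have huB : ∀ w, u w ≤ B := by
    intro w
    rw [hu, Tn, sum_mul_ind, div_le_iff₀ hn']
    calc ∑ y ∈ C, b w y ≤ ∑ y : Fin n, B := (Finset.sum_le_univ_sum_of_nonneg fun y => h0 w y).trans
          (Finset.sum_le_sum fun y _ => hB w y)
      _ = B * n := by simp [mul_comm]
  have hCu : ∑ w ∈ C, b z w * u w ≤ B * (n * u z) := by
    rw [← huz, Finset.mul_sum]
    exact Finset.sum_le_sum fun w _ => by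
      rw [mul_comm]; exact mul_le_mul_of_nonneg_right (huB w) (h0 z w)
  have hRsum : ∑ w ∈ R, b z w * u w = ∑ w ∈ R \ C, b z w * u w + ∑ w ∈ C, b z w * u w :=
    (Finset.sum_sdiff hCR).symm
  have hxi := sum_xi k L (fun w => b z w * u w)
  have hd : -(dz b k L z) ≤ ∑ w, b z w * u w * xi n k L w := by
    have e : ∑ w, b z w * u w * xi n k L w = (∑ y, ind C y * ∑ w, (b z w * b w y) * xi n k L w) / n := by
      simp only [hu, Tn, Finset.mul_sum, Finset.sum_div, Finset.sum_mul]
      rw [Finset.sum_comm]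
      refine Finset.sum_congr rfl fun y _ => Finset.sum_congr rfl fun w _ => ?_
      ring
    rw [e, dz, ← neg_div, ← Finset.sum_neg_distrib]
    refine div_le_div_of_nonneg_right (Finset.sum_le_sum fun y _ => ?_) hn'.le
    have := neg_abs_le (∑ w, (b z w * b w y) * xi n k L w)
    have := abs_nonneg (∑ w, (b z w * b w y) * xi n k L w)
    unfold ind; split_ifs
    · linarith
    · linarith
  have hTT : ∑ w, b z w * u w = n * Tn b u z := by rw [Tn]; field_simp
  rw [hTT] at hxi
  have hTu0 : 0 ≤ Tn b u z := by
    refine div_nonneg (Finset.sum_nonneg fun w _ => mul_nonneg (h0 z w) ?_) hn'.le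
    exact div_nonneg (Finset.sum_nonneg fun y _ => mul_nonneg (h0 w y) (hi0 y)) hn'.le
  have hfin : q * (n * Tn b u z) ≤ (1 + B) * (n * u z) + (|errf b R {v} (b z) ω| + dz b k L z) := by
    have h1 : q * (n * Tn b u z) ≤ (1 - ((n / k : ℕ) : ℝ) / n) * (n * Tn b u z) :=
      mul_le_mul_of_nonneg_right hqn (by positivity)
    have h2 := le_abs_self (errf b R {v} (b z) ω)
    linarith
  have : ((1 + B) / q) * u z + (|errf b R {v} (b z) ω| + dz b k L z) / (q * n) =
      ((1 + B) * (n * u z) + (|errf b R {v} (b z) ω| + dz b k L z)) / (q * n) := by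
    field_simp
  rw [this, le_div_iff₀ (by positivity)]
  linarith

lemma clus_symm {V : Type*} [Fintype V] [DecidableEq V] {ω : Sym2 V → Bool} {R : Finset V} {v v' : V} (hv : v ∈ R) (h : v' ∈ clus ω R {v}) :
    clus ω R {v'} = clus ω R {v} := by
  classical
  have key : ∀ x ∈ clus ω R {v}, v ∈ clus ω R {x} := by
    have : clus ω R {v} ⊆ R.filter fun x => v ∈ clus ω R {x} := by
      refine clus_min ?_ ?_
      · intro x hx
        rw [Finset.mem_singleton.1 hx]
        exact Finset.mem_filter.2 ⟨hv, sub_clus _ _ _ (Finset.mem_singleton_self v)⟩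
      · intro x hx y hy
        obtain ⟨hxR, hx2⟩ := Finset.mem_filter.1 hx
        refine Finset.mem_filter.2 ⟨hy.1, ?_⟩
        have h1 : x ∈ clus ω R {y} := clus_closed (sub_clus _ _ _ (Finset.mem_singleton_self y))
          ⟨hxR, hy.2.1.symm, by rw [Sym2.eq_swap]; exact hy.2.2⟩
        exact clus_min (S := clus ω R {y}) (by simpa using h1) (fun a ha c hc => clus_closed ha hc) hx2
    intro x hx
    exact (Finset.mem_filter.1 (this hx)).2
  refine Finset.Subset.antisymm ?_ ?_
  · exact clus_min (by simpa using h) fun a ha c hc => clus_closed ha hc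
  · exact clus_min (by simpa using key v' h) fun a ha c hc => clus_closed ha hc

lemma errf_abs {n : ℕ} (hn : 0 < n) (b : Fin n → Fin n → ℝ) (h0 : ∀ i j, 0 ≤ b i j) (hs : ∀ i j, b i j = b j i)
    {B : ℝ} (hB : ∀ i j, b i j ≤ B) (hnB : 2 * B ≤ n) (R V0 : Finset (Fin n)) (h0R : V0 ⊆ R)
    (a : Fin n → ℝ) {A : ℝ} (ha : ∀ w, 0 ≤ a w) (hA : ∀ w, a w ≤ A) :
    ∫ ω, |errf b R V0 a ω| ∂(percMeasure b (1 / n)) ≤ Real.sqrt n * (1 + A ^ 2 * Real.exp (4 * B)) := by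
  have := perc_prob b h0
  have hn' : (0:ℝ) < n := by exact_mod_cast hn
  have ht : 0 < Real.sqrt n := Real.sqrt_pos.2 hn'
  calc ∫ ω, |errf b R V0 a ω| ∂(percMeasure b (1 / n))
      ≤ ∫ ω, (Real.sqrt n + (errf b R V0 a ω) ^ 2 / Real.sqrt n) / 2 ∂(percMeasure b (1 / n)) :=
        integral_mono Integrable.of_finite Integrable.of_finite fun L => abs_le_half ht
    _ = (Real.sqrt n + (∫ ω, (errf b R V0 a ω) ^ 2 ∂(percMeasure b (1 / n))) / Real.sqrt n) / 2 := by
        rw [integral_div, integral_add Integrable.of_finite Integrable.of_finite, integral_div]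
        simp only [integral_const, probReal_univ, smul_eq_mul, one_mul]
    _ ≤ (Real.sqrt n + (n * (A ^ 2 * Real.exp (4 * B))) / Real.sqrt n) / 2 := by
        gcongr
        exact errf_var hn b h0 hs hB hnB R V0 h0R a ha hA
    _ = Real.sqrt n * (1 + A ^ 2 * Real.exp (4 * B)) / 2 := by
        have : (n * (A ^ 2 * Real.exp (4 * B))) / Real.sqrt n = A ^ 2 * Real.exp (4 * B) * Real.sqrt n := by
          rw [div_eq_iff ht.ne', mul_assoc, Real.mul_self_sqrt hn'.le]; ring
        rw [this]; ring
    _ ≤ _ := by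
        have : 0 ≤ Real.sqrt n * (1 + A ^ 2 * Real.exp (4 * B)) := by positivity
        linarith

/-- bad event: a large badly attached component -/
def bad2 {n : ℕ} (b : Fin n → Fin n → ℝ) (δ γ s : ℝ) (L : Finset (Fin n)) : Set (Sym2 (Fin n) → Bool) :=
  {ω | ∃ v ∈ Finset.univ \ L, δ * n ≤ (clus ω (Finset.univ \ L) {v}).card ∧
    s * n < ((Finset.univ.filter fun z => Tn b (ind (clus ω (Finset.univ \ L) {v})) z ≤ γ).card : ℝ)}

lemma bad2_bound {n : ℕ} [NeZero n] (b : Fin n → Fin n → ℝ) (h0 : ∀ i j, 0 ≤ b i j) (hs : ∀ i j, b i j = b j i)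
    {B : ℝ} (hB : ∀ i j, b i j ≤ B) (hnB : 2 * B ≤ n) (k : ℕ) (L : Finset (Fin n)) {q : ℝ} (hq : 0 < q)
    (hqn : q ≤ 1 - ((n / k : ℕ) : ℝ) / n) {δ γ s κ : ℝ} (hδ : 0 < δ) (hκ : 0 < κ)
    (H : ∀ c e : Fin n → ℝ, (∀ z, 0 ≤ c z) → (∀ z, c z ≤ 1) → δ * n ≤ ∑ z, c z → (∀ z, 0 ≤ e z) →
      (∀ z, Tn b (Tn b c) z ≤ ((1 + B) / q) * Tn b c z + e z) → ∑ z, e z ≤ κ * n →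
      ((Finset.univ.filter fun z => Tn b c z ≤ γ).card : ℝ) ≤ s * n) :
    (percMeasure b (1 / n)).real (bad2 b δ γ s L) ≤
      (Real.sqrt n * (1 + B ^ 2 * Real.exp (4 * B)) + (∑ z, dz b k L z) / n) / (δ * κ * q * n) := by
  have hn : 0 < n := Nat.pos_of_ne_zero (NeZero.ne n)
  have hn' : (0:ℝ) < n := by exact_mod_cast hn
  have := perc_prob b h0
  set R := Finset.univ \ L with hR
  have hdz : ∀ z, 0 ≤ dz b k L z := fun z => div_nonneg (Finset.sum_nonneg fun y _ => abs_nonneg _) hn'.le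
  have hpt : ∀ ω, (bad2 b δ γ s L).indicator (fun _ => (1:ℝ)) ω ≤
      (∑ v ∈ R, ∑ z, (|errf b R {v} (b z) ω| + dz b k L z) / (q * n)) / (δ * n * (κ * n)) := by
    intro ω
    have hnn : ∀ v z, 0 ≤ (|errf b R {v} (b z) ω| + dz b k L z) / (q * n) := fun v z =>
      div_nonneg (add_nonneg (abs_nonneg _) (hdz z)) (by positivity)
    by_cases hω : ω ∈ bad2 b δ γ s L
    · rw [Set.indicator_of_mem hω]
      obtain ⟨v, hv, hc, hbad⟩ := hω
      have hCR : clus ω R {v} ⊆ R := clus_sub (Finset.singleton_subset_iff.2 hv)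
      rw [le_div_iff₀ (by positivity), one_mul]
      calc δ * n * (κ * n) ≤ (clus ω R {v}).card * (κ * n) := by gcongr
        _ = ∑ v' ∈ clus ω R {v}, κ * n := by simp
        _ ≤ ∑ v' ∈ clus ω R {v}, ∑ z, (|errf b R {v'} (b z) ω| + dz b k L z) / (q * n) := by
            refine Finset.sum_le_sum fun v' hv' => ?_
            by_contra hlt
            push Not at hlt
            have hcl := clus_symm hv hv'
            refine absurd (H (ind (clus ω R {v'})) (fun z => (|errf b R {v'} (b z) ω| + dz b k L z) / (q * n))
              (fun y => ?_) (fun y => ?_) ?_ (hnn v') (fun z => K_det b h0 hs hB hnB k L hq hqn v' (hCR hv') ω z) hlt.le) ?_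
            · unfold ind; split_ifs <;> norm_num
            · unfold ind; split_ifs <;> norm_num
            · rw [ind_sum, hcl]; exact hc
            · rw [hcl]; push Not; exact hbad
        _ ≤ _ := Finset.sum_le_sum_of_subset_of_nonneg hCR fun v' _ _ => Finset.sum_nonneg fun z _ => hnn v' z
    · rw [Set.indicator_of_notMem hω]
      exact div_nonneg (Finset.sum_nonneg fun v' _ => Finset.sum_nonneg fun z _ => hnn v' z) (by positivity)
  have hmeas : MeasurableSet (bad2 b δ γ s L) := (Set.toFinite _).measurableSet
  have h1 : (percMeasure b (1 / n)).real (bad2 b δ γ s L) =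
      ∫ ω, (bad2 b δ γ s L).indicator (fun _ => (1:ℝ)) ω ∂(percMeasure b (1 / n)) := by
    rw [integral_indicator_const _ hmeas]; simp
  rw [h1]
  refine (integral_mono Integrable.of_finite Integrable.of_finite hpt).trans ?_
  rw [integral_div, integral_finsetSum _ fun S _ => Integrable.of_finite]
  have h2 : ∀ v ∈ R, ∫ ω, (∑ z, (|errf b R {v} (b z) ω| + dz b k L z) / (q * n)) ∂(percMeasure b (1 / n)) ≤
      (n * (Real.sqrt n * (1 + B ^ 2 * Real.exp (4 * B))) + ∑ z, dz b k L z) / (q * n) := by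
    intro v hv
    rw [integral_finsetSum _ fun S _ => Integrable.of_finite]
    have : ∀ z ∈ (Finset.univ : Finset (Fin n)), ∫ ω, (|errf b R {v} (b z) ω| + dz b k L z) / (q * n) ∂(percMeasure b (1 / n)) ≤
        (Real.sqrt n * (1 + B ^ 2 * Real.exp (4 * B)) + dz b k L z) / (q * n) := by
      intro z _
      rw [integral_div, integral_add Integrable.of_finite Integrable.of_finite]
      refine div_le_div_of_nonneg_right ?_ (by positivity)
      have := errf_abs hn b h0 hs hB hnB R {v} (Finset.singleton_subset_iff.2 hv) (b z) (h0 z) (hB z)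
      simp only [integral_const, probReal_univ, smul_eq_mul, one_mul]
      linarith
    refine (Finset.sum_le_sum this).trans (le_of_eq ?_)
    rw [← Finset.sum_div, Finset.sum_add_distrib]
    simp
  have hRc : (R.card : ℝ) ≤ n := by exact_mod_cast (Finset.card_le_univ R).trans (by simp)
  have hdzs : 0 ≤ ∑ z, dz b k L z := Finset.sum_nonneg fun z _ => hdz z
  calc _ ≤ (∑ v ∈ R, (n * (Real.sqrt n * (1 + B ^ 2 * Real.exp (4 * B))) + ∑ z, dz b k L z) / (q * n)) / (δ * n * (κ * n)) :=
        div_le_div_of_nonneg_right (Finset.sum_le_sum h2) (by positivity)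
    _ ≤ (n * ((n * (Real.sqrt n * (1 + B ^ 2 * Real.exp (4 * B))) + ∑ z, dz b k L z) / (q * n))) / (δ * n * (κ * n)) := by
        rw [Finset.sum_const, nsmul_eq_mul]
        gcongr
    _ = _ := by field_simp

end GiantAux

namespace GiantAux

open Percolation

/-- discrepancy for the eigenvector -/
def d2 {n : ℕ} (b : Fin n → Fin n → ℝ) (k : ℕ) (x : Fin n → ℝ) (L : Finset (Fin n)) : ℝ :=
  (∑ y, |∑ w, (x w * b w y) * xi n k L w|) / n

lemma L_det {n : ℕ} [NeZero n] (b : Fin n → Fin n → ℝ) (h0 : ∀ i j, 0 ≤ b i j) (hs : ∀ i j, b i j = b j i)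
    {B : ℝ} (hB : ∀ i j, b i j ≤ B) (hnB : 2 * B ≤ n) (k : ℕ) (L : Finset (Fin n)) {q : ℝ} (hq : 0 < q)
    (hqn : q ≤ 1 - ((n / k : ℕ) : ℝ) / n) (x : Fin n → ℝ) (hx : ∀ z, 0 ≤ x z) {l : ℝ} (hl : 0 ≤ l)
    (hev : ∀ z, Tn b x z = l * x z) (V0 : Finset (Fin n)) (hV : V0 ⊆ Finset.univ \ L) (ω : Sym2 (Fin n) → Bool) :
    (q * l - 1 - B * ((clus ω (Finset.univ \ L) V0).card / n)) * ∑ z ∈ clus ω (Finset.univ \ L) V0, x z + ∑ z ∈ V0, x z ≤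
      |errf b (Finset.univ \ L) V0 x ω| + d2 b k x L := by
  have hn : 0 < n := Nat.pos_of_ne_zero (NeZero.ne n)
  have hn' : (0:ℝ) < n := by exact_mod_cast hn
  set R := Finset.univ \ L with hR
  set C := clus ω R V0 with hC
  have hCR : C ⊆ R := clus_sub hV
  have hVC : V0 ⊆ C := sub_clus _ _ _
  have hdet := errf_det hn b h0 hs hB hnB R V0 hV x hx ω
  change ∑ w ∈ R \ C, x w * Tn b (ind C) w ≤ ∑ w ∈ C \ V0, x w + errf b R V0 x ω at hdet
  set u := Tn b (ind C) with hu
  have huB : ∀ w, u w ≤ B * (C.card / n) := by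
    intro w
    rw [← ind_sum]
    exact Tn_le h0 hB (fun y => by unfold ind; split_ifs <;> norm_num) w
  have hCu : ∑ w ∈ C, x w * u w ≤ B * (C.card / n) * ∑ w ∈ C, x w := by
    rw [Finset.mul_sum]
    exact Finset.sum_le_sum fun w _ => by
      rw [mul_comm]; exact mul_le_mul_of_nonneg_right (huB w) (hx w)
  have hRsum : ∑ w ∈ R, x w * u w = ∑ w ∈ R \ C, x w * u w + ∑ w ∈ C, x w * u w :=
    (Finset.sum_sdiff hCR).symm
  have hCV : ∑ w ∈ C, x w = ∑ w ∈ C \ V0, x w + ∑ w ∈ V0, x w := (Finset.sum_sdiff hVC).symm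
  have hxi := sum_xi k L (fun w => x w * u w)
  have hd : -(d2 b k x L) ≤ ∑ w, x w * u w * xi n k L w := by
    have e : ∑ w, x w * u w * xi n k L w = (∑ y, ind C y * ∑ w, (x w * b w y) * xi n k L w) / n := by
      simp only [hu, Tn, Finset.mul_sum, Finset.sum_div, Finset.sum_mul]
      rw [Finset.sum_comm]
      refine Finset.sum_congr rfl fun y _ => Finset.sum_congr rfl fun w _ => ?_
      ring
    rw [e, d2, ← neg_div, ← Finset.sum_neg_distrib]
    refine div_le_div_of_nonneg_right (Finset.sum_le_sum fun y _ => ?_) hn'.le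
    have := neg_abs_le (∑ w, (x w * b w y) * xi n k L w)
    have := abs_nonneg (∑ w, (x w * b w y) * xi n k L w)
    unfold ind; split_ifs
    · linarith
    · linarith
  have hadj : ∑ w, x w * u w = l * ∑ w ∈ C, x w := by
    rw [hu, Tn_adj hs]
    simp only [hev]
    rw [← sum_mul_ind C, Finset.mul_sum]
    exact Finset.sum_congr rfl fun w _ => by ring
  rw [hadj] at hxi
  have hSx : 0 ≤ ∑ w ∈ C, x w := Finset.sum_nonneg fun w _ => hx w
  have h1 : q * (l * ∑ w ∈ C, x w) ≤ (1 - ((n / k : ℕ) : ℝ) / n) * (l * ∑ w ∈ C, x w) :=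
    mul_le_mul_of_nonneg_right hqn (by positivity)
  have h2 := le_abs_self (errf b R V0 x ω)
  linarith

/-- bad event: no large component -/
def bad1 {n : ℕ} (δ : ℝ) (L : Finset (Fin n)) : Set (Sym2 (Fin n) → Bool) :=
  {ω | ∀ v ∈ Finset.univ \ L, ((clus ω (Finset.univ \ L) {v}).card : ℝ) < δ * n}

lemma clus_insert {V : Type*} [Fintype V] [DecidableEq V] (ω : Sym2 V → Bool) (R V0 : Finset V) (v : V) :
    clus ω R (insert v V0) ⊆ clus ω R {v} ∪ clus ω R V0 := by
  refine clus_min ?_ ?_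
  · intro x hx
    rcases Finset.mem_insert.1 hx with rfl | hx
    · exact Finset.mem_union_left _ (sub_clus _ _ _ (Finset.mem_singleton_self _))
    · exact Finset.mem_union_right _ (sub_clus _ _ _ hx)
  · intro x hx y hy
    rcases Finset.mem_union.1 hx with h | h
    · exact Finset.mem_union_left _ (clus_closed h hy)
    · exact Finset.mem_union_right _ (clus_closed h hy)

lemma sq_split {T e d : ℝ} (hT : 0 < T) (hd : 0 ≤ d) (h : T ≤ |e| + d) : 1 ≤ 4 * e ^ 2 / T ^ 2 + 2 * d / T := by
  by_cases h1 : T / 2 ≤ |e|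
  · have : 1 ≤ 4 * e ^ 2 / T ^ 2 := by
      rw [le_div_iff₀ (by positivity), ← sq_abs e]; nlinarith
    have : 0 ≤ 2 * d / T := by positivity
    linarith
  · have : 1 ≤ 2 * d / T := by rw [le_div_iff₀ hT]; linarith
    have : 0 ≤ 4 * e ^ 2 / T ^ 2 := by positivity
    linarith

lemma bad1_bound {n : ℕ} [NeZero n] (b : Fin n → Fin n → ℝ) (h0 : ∀ i j, 0 ≤ b i j) (hs : ∀ i j, b i j = b j i)
    {B : ℝ} (hB : ∀ i j, b i j ≤ B) (hnB : 2 * B ≤ n) (k : ℕ) (L : Finset (Fin n)) {q : ℝ} (hq : 0 < q)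
    (hqn : q ≤ 1 - ((n / k : ℕ) : ℝ) / n) (x : Fin n → ℝ) (hx : ∀ z, 0 ≤ x z) (hxB : ∀ z, x z ≤ B) {l : ℝ} (hl : 0 ≤ l)
    (hev : ∀ z, Tn b x z = l * x z) {h δ τ : ℝ} (hh : 0 < h) (hδ : 0 < δ) (hτ : 0 < τ)
    (hql : 1 + 2 * h ≤ q * l) (hBδ : 3 * B * δ ≤ h)
    (hsmall : ((Finset.univ.filter fun z => x z ≤ τ).card : ℝ) ≤ δ * n) (J : ℕ) (hJ : 0 < J)
    (hJZ : J ≤ ((Finset.univ \ L).filter fun z => τ < x z).card) :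
    (percMeasure b (1 / n)).real (bad1 δ L) ≤
      4 * (n * (B ^ 2 * Real.exp (4 * B))) / (τ * J) ^ 2 + 2 * d2 b k x L / (τ * J) +
      ((J + 1) * (4 * (n * (B ^ 2 * Real.exp (4 * B))) / (h * τ * δ * n) ^ 2) + 2 * d2 b k x L / (h * τ * δ * n)) := by
  have hn : 0 < n := Nat.pos_of_ne_zero (NeZero.ne n)
  have hn' : (0:ℝ) < n := by exact_mod_cast hn
  have hJ' : (0:ℝ) < J := by exact_mod_cast hJ
  have := perc_prob b h0
  set R := Finset.univ \ L with hR
  have hd2 : 0 ≤ d2 b k x L := div_nonneg (Finset.sum_nonneg fun y _ => abs_nonneg _) hn'.le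
  obtain ⟨Z, hZ1, hZ2⟩ := Finset.exists_subset_card_eq hJZ
  have hB0 : 0 ≤ B := (hx ⟨0, hn⟩).trans (hxB _)
  let e := Z.equivFin
  let g : ℕ → Fin n := fun i => if hi : i < Z.card then (e.symm ⟨i, hi⟩ : Fin n) else ⟨0, hn⟩
  have hgZ : ∀ i < J, g i ∈ Z := by
    intro i hi
    have hi' : i < Z.card := by omega
    simp only [g, hi', dif_pos]
    exact (e.symm ⟨i, hi'⟩).2
  have hginj : ∀ i < J, ∀ j < J, g i = g j → i = j := by
    intro i hi j hj hij
    have hi' : i < Z.card := by omega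
    have hj' : j < Z.card := by omega
    simp only [g, hi', hj', dif_pos] at hij
    have := e.symm.injective (Subtype.ext hij)
    simpa using this
  let Vj : ℕ → Finset (Fin n) := fun j => (Finset.range j).image g
  have hVR : ∀ j ≤ J, Vj j ⊆ R := by
    intro j hj y hy
    obtain ⟨i, hi, rfl⟩ := Finset.mem_image.1 hy
    have := hZ1 (hgZ i (by have := Finset.mem_range.1 hi; omega))
    exact (Finset.mem_filter.1 this).1
  have hpt : ∀ ω, (bad1 δ L).indicator (fun _ => (1:ℝ)) ω ≤
      (4 * (errf b R (Vj J) x ω) ^ 2 / (τ * J) ^ 2 + 2 * d2 b k x L / (τ * J)) +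
      ((∑ j ∈ Finset.range (J + 1), 4 * (errf b R (Vj j) x ω) ^ 2 / (h * τ * δ * n) ^ 2) + 2 * d2 b k x L / (h * τ * δ * n)) := by
    intro ω
    have hn1 : 0 ≤ 4 * (errf b R (Vj J) x ω) ^ 2 / (τ * J) ^ 2 + 2 * d2 b k x L / (τ * J) := by positivity
    have hn2 : 0 ≤ ∑ j ∈ Finset.range (J + 1), 4 * (errf b R (Vj j) x ω) ^ 2 / (h * τ * δ * n) ^ 2 :=
      Finset.sum_nonneg fun j _ => by positivity
    have hn3 : 0 ≤ 2 * d2 b k x L / (h * τ * δ * n) := by positivity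
    by_cases hω : ω ∈ bad1 δ L
    swap
    · rw [Set.indicator_of_notMem hω]; linarith
    rw [Set.indicator_of_mem hω]
    have hkey : ∀ j ≤ J, ((clus ω R (Vj j)).card : ℝ) ≤ 3 * δ * n →
        h * ∑ z ∈ clus ω R (Vj j), x z + ∑ z ∈ Vj j, x z ≤ |errf b R (Vj j) x ω| + d2 b k x L := by
      intro j hj hc
      have h1 := L_det b h0 hs hB hnB k L hq hqn x hx hl hev (Vj j) (hVR j hj) ω
      have hS : 0 ≤ ∑ z ∈ clus ω R (Vj j), x z := Finset.sum_nonneg fun z _ => hx z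
      have h2 : B * ((clus ω R (Vj j)).card / n) ≤ h := by
        refine le_trans ?_ hBδ
        have : ((clus ω R (Vj j)).card / n : ℝ) ≤ 3 * δ := by rw [div_le_iff₀ hn']; exact hc
        nlinarith
      have h3 : h ≤ q * l - 1 - B * ((clus ω R (Vj j)).card / n) := by linarith
      have := mul_le_mul_of_nonneg_right h3 hS
      exact le_trans (by linarith) h1
    by_cases hcase : ((clus ω R (Vj J)).card : ℝ) < 2 * δ * n
    · have h1 := hkey J le_rfl (by nlinarith)
      have hS : 0 ≤ ∑ z ∈ clus ω R (Vj J), x z := Finset.sum_nonneg fun z _ => hx z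
      have h2 : τ * J ≤ ∑ z ∈ Vj J, x z := by
        have hcard : (Vj J).card = J := by
          rw [Finset.card_image_of_injOn, Finset.card_range]
          intro i hi j hj hij
          exact hginj i (by simpa using hi) j (by simpa using hj) hij
        calc τ * J = ∑ z ∈ Vj J, τ := by rw [Finset.sum_const, hcard, nsmul_eq_mul, mul_comm]
          _ ≤ _ := Finset.sum_le_sum fun z hz => by
            obtain ⟨i, hi, rfl⟩ := Finset.mem_image.1 hz
            exact (Finset.mem_filter.1 (hZ1 (hgZ i (Finset.mem_range.1 hi)))).2.le
      have := sq_split (T := τ * J) (by positivity) hd2 (by nlinarith)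
      linarith
    · push Not at hcase
      -- first index where the size reaches the threshold
      have hex : ∃ j, 2 * δ * n ≤ ((clus ω R (Vj j)).card : ℝ) := ⟨J, hcase⟩
      classical
      set j := Nat.find hex with hjdef
      have hj1 : 2 * δ * n ≤ ((clus ω R (Vj j)).card : ℝ) := Nat.find_spec hex
      have hjJ : j ≤ J := Nat.find_min' hex hcase
      have hj0 : j ≠ 0 := by
        intro h0j
        rw [h0j] at hj1
        have : clus ω R (Vj 0) = ∅ := by
          refine Finset.subset_empty.1 (clus_min (by simp [Vj]) (by simp))
        rw [this] at hj1
        simp at hj1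
        nlinarith [mul_pos hδ hn']
      obtain ⟨i, hi⟩ : ∃ i, j = i + 1 := ⟨j - 1, by omega⟩
      have hj2 : ((clus ω R (Vj i)).card : ℝ) < 2 * δ * n := by
        have := Nat.find_min hex (m := i) (by omega)
        push Not at this; exact this
      have hgR : g i ∈ R := hVR J le_rfl (Finset.mem_image.2 ⟨i, Finset.mem_range.2 (by omega), rfl⟩)
      have hsmallc := hω (g i) hgR
      have hc3 : ((clus ω R (Vj j)).card : ℝ) ≤ 3 * δ * n := by
        have hV : Vj j = insert (g i) (Vj i) := by
          simp only [Vj, hi, Finset.range_add_one, Finset.image_insert]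
        have h1 : (clus ω R (Vj j)).card ≤ (clus ω R {g i}).card + (clus ω R (Vj i)).card := by
          rw [hV]
          exact (Finset.card_le_card (clus_insert ω R (Vj i) (g i))).trans (Finset.card_union_le _ _)
        have h1' : ((clus ω R (Vj j)).card : ℝ) ≤ (clus ω R {g i}).card + (clus ω R (Vj i)).card := by exact_mod_cast h1
        linarith
      have h1 := hkey j hjJ hc3
      have hV0 : 0 ≤ ∑ z ∈ Vj j, x z := Finset.sum_nonneg fun z _ => hx z
      have hS : τ * (δ * n) ≤ ∑ z ∈ clus ω R (Vj j), x z := by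
        set C := clus ω R (Vj j) with hC
        have hcc : (C.card : ℝ) ≤ (C.filter fun z => τ < x z).card + (Finset.univ.filter fun z => x z ≤ τ).card := by
          rw [← Finset.card_filter_add_card_filter_not (s := C) (fun z => τ < x z)]
          push_cast
          gcongr
          intro z hz
          have := (Finset.mem_filter.1 hz).2
          simpa using this
        calc τ * (δ * n) ≤ τ * (C.filter fun z => τ < x z).card := by
              refine mul_le_mul_of_nonneg_left ?_ hτ.le
              linarith
          _ = ∑ z ∈ C.filter (fun z => τ < x z), τ := by rw [Finset.sum_const, nsmul_eq_mul, mul_comm]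
          _ ≤ ∑ z ∈ C.filter (fun z => τ < x z), x z := Finset.sum_le_sum fun z hz => (Finset.mem_filter.1 hz).2.le
          _ ≤ _ := Finset.sum_le_sum_of_subset_of_nonneg (Finset.filter_subset _ _) fun z _ _ => hx z
      have h2 : h * τ * δ * n ≤ |errf b R (Vj j) x ω| + d2 b k x L := by
        have := mul_le_mul_of_nonneg_left hS hh.le
        have e1 : h * τ * δ * n = h * (τ * (δ * n)) := by ring
        linarith
      have h3 := sq_split (by positivity) hd2 h2
      have h4 : 4 * (errf b R (Vj j) x ω) ^ 2 / (h * τ * δ * n) ^ 2 ≤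
          ∑ j ∈ Finset.range (J + 1), 4 * (errf b R (Vj j) x ω) ^ 2 / (h * τ * δ * n) ^ 2 :=
        Finset.single_le_sum (f := fun j => 4 * (errf b R (Vj j) x ω) ^ 2 / (h * τ * δ * n) ^ 2)
          (fun j _ => by positivity) (Finset.mem_range.2 (by omega))
      linarith
  have hmeas : MeasurableSet (bad1 (n := n) δ L) := (Set.toFinite _).measurableSet
  have h1 : (percMeasure b (1 / n)).real (bad1 δ L) =
      ∫ ω, (bad1 δ L).indicator (fun _ => (1:ℝ)) ω ∂(percMeasure b (1 / n)) := by
    rw [integral_indicator_const _ hmeas]; simp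
  rw [h1]
  refine (integral_mono Integrable.of_finite Integrable.of_finite hpt).trans ?_
  have hint : ∀ j ≤ J, ∀ T : ℝ, ∫ ω, 4 * (errf b R (Vj j) x ω) ^ 2 / T ^ 2 ∂(percMeasure b (1 / n)) ≤
      4 * (n * (B ^ 2 * Real.exp (4 * B))) / T ^ 2 := by
    intro j hj T
    rw [integral_div, integral_const_mul]
    have := errf_var hn b h0 hs hB hnB R (Vj j) (hVR j hj) x hx hxB
    gcongr
  rw [integral_add Integrable.of_finite Integrable.of_finite, integral_add Integrable.of_finite Integrable.of_finite,
    integral_add Integrable.of_finite Integrable.of_finite, integral_finsetSum _ fun S _ => Integrable.of_finite]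
  simp only [integral_const, probReal_univ, smul_eq_mul, one_mul]
  refine add_le_add (add_le_add_left (hint J le_rfl _) _) (add_le_add_left ?_ _)
  refine (Finset.sum_le_sum fun j hj => hint j (by have := Finset.mem_range.1 hj; omega) _).trans (le_of_eq ?_)
  rw [Finset.sum_const, Finset.card_range, nsmul_eq_mul]
  push_cast; ring

end GiantAux

namespace GiantAux

open Percolation

lemma unif_mono (n k : ℕ) {F G : Finset (Fin n) → ℝ} (h : ∀ L ∈ Pm n k, F L ≤ G L) :
    ∫ L, F L ∂(unifSubset n k) ≤ ∫ L, G L ∂(unifSubset n k) := by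
  rw [integral_unifSubset, integral_unifSubset]
  exact div_le_div_of_nonneg_right (Finset.sum_le_sum h) (by positivity)

lemma abs_prod_le {B s t : ℝ} (hs : 0 ≤ s) (ht : 0 ≤ t) (hsB : s ≤ B) (htB : t ≤ B) : |s * t| ≤ B ^ 2 := by
  rw [abs_of_nonneg (mul_nonneg hs ht), sq]
  exact mul_le_mul hsB htB ht (hs.trans hsB)

lemma d2_mean {n : ℕ} (hn : 2 ≤ n) (b : Fin n → Fin n → ℝ) (h0 : ∀ i j, 0 ≤ b i j)
    {B : ℝ} (hB : ∀ i j, b i j ≤ B) (k : ℕ) (x : Fin n → ℝ) (hx : ∀ z, 0 ≤ x z) (hxB : ∀ z, x z ≤ B) :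
    ∫ L, d2 b k x L ∂(unifSubset n k) ≤ Real.sqrt n * (1 + (B ^ 2) ^ 2) := by
  have := unifSubset_prob n k
  have hn' : (0:ℝ) < n := by exact_mod_cast (by omega : 0 < n)
  unfold d2
  rw [integral_div, integral_finsetSum _ fun S _ => Integrable.of_finite, div_le_iff₀ hn']
  refine (Finset.sum_le_sum fun y _ => subset_abs n k hn (fun w => x w * b w y) (A := B ^ 2)
    fun w => abs_prod_le (hx w) (h0 w y) (hxB w) (hB w y)).trans (le_of_eq ?_)
  simp; ring

lemma dz_mean {n : ℕ} (hn : 2 ≤ n) (b : Fin n → Fin n → ℝ) (h0 : ∀ i j, 0 ≤ b i j)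
    {B : ℝ} (hB : ∀ i j, b i j ≤ B) (k : ℕ) :
    ∫ L, (∑ z, dz b k L z) / n ∂(unifSubset n k) ≤ Real.sqrt n * (1 + (B ^ 2) ^ 2) := by
  have := unifSubset_prob n k
  have hn' : (0:ℝ) < n := by exact_mod_cast (by omega : 0 < n)
  rw [integral_div, integral_finsetSum _ fun S _ => Integrable.of_finite, div_le_iff₀ hn']
  refine (Finset.sum_le_sum fun z _ => d2_mean hn b h0 hB k (b z) (h0 z) (hB z)).trans (le_of_eq ?_)
  simp; ring

lemma reach_iff {n : ℕ} (ω : Sym2 (Fin n) → Bool) (R : Finset (Fin n)) (u w : (↑R : Set (Fin n))) :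
    ((graphOf ω).induce (↑R : Set (Fin n))).Reachable u w ↔ (w : Fin n) ∈ clus ω R {(u : Fin n)} := by
  have hadj : ∀ a b : (↑R : Set (Fin n)), ((graphOf ω).induce (↑R : Set (Fin n))).Adj a b ↔ stp ω R a b := by
    intro a b
    have hb : (b : Fin n) ∈ R := b.2
    simp only [graphOf, SimpleGraph.comap_adj, SimpleGraph.fromRel_adj, stp, Function.Embedding.subtype_apply]
    rw [Sym2.eq_swap (a := (b : Fin n))]
    simp [hb]
  constructor
  · intro h
    rw [SimpleGraph.reachable_iff_reflTransGen] at h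
    induction h with
    | refl => exact sub_clus _ _ _ (Finset.mem_singleton_self _)
    | tail _ hs ih => exact clus_closed ih ((hadj _ _).1 hs)
  · intro h
    classical
    have : clus ω R {(u : Fin n)} ⊆ Finset.univ.filter fun y => ∃ hy : y ∈ (↑R : Set (Fin n)),
        ((graphOf ω).induce (↑R : Set (Fin n))).Reachable u ⟨y, hy⟩ := by
      refine clus_min ?_ ?_
      · intro y hy
        rw [Finset.mem_singleton.1 hy]
        exact Finset.mem_filter.2 ⟨Finset.mem_univ _, u.2, SimpleGraph.Reachable.refl _⟩
      · intro y hy z hz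
        obtain ⟨hyR, hr⟩ := (Finset.mem_filter.1 hy).2
        refine Finset.mem_filter.2 ⟨Finset.mem_univ _, hz.1, hr.trans ?_⟩
        exact SimpleGraph.Adj.reachable ((hadj ⟨y, hyR⟩ ⟨z, hz.1⟩).2 hz)
    obtain ⟨_, hr⟩ := (Finset.mem_filter.1 (this h)).2
    exact hr

lemma compSize_eq {n : ℕ} (ω : Sym2 (Fin n) → Bool) (R : Finset (Fin n)) (u : (↑R : Set (Fin n))) :
    compSize ((graphOf ω).induce (↑R : Set (Fin n))) u = (clus ω R {(u : Fin n)}).card := by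
  unfold compSize
  have hsub : clus ω R {(u : Fin n)} ⊆ R := clus_sub (Finset.singleton_subset_iff.2 u.2)
  rw [← Set.ncard_image_of_injective _ Subtype.val_injective, ← Set.ncard_coe_finset]
  congr 1
  ext y
  simp only [Set.mem_image, Set.mem_ofPred_eq, reach_iff, Finset.mem_coe]
  constructor
  · rintro ⟨w, hw, rfl⟩; exact hw
  · intro hy; exact ⟨⟨y, hsub hy⟩, hy, rfl⟩

open scoped Classical in
lemma good_of_not_bad {n : ℕ} [NeZero n] (b : Fin n → Fin n → ℝ) {δ γ s : ℝ} (L : Finset (Fin n)) (ω : Sym2 (Fin n) → Bool)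
    (h1 : ω ∉ bad1 δ L) (h2 : ω ∉ bad2 b δ γ s L) (u : (↑(Finset.univ \ L) : Set (Fin n)))
    (hu : compSize ((graphOf ω).induce ↑(Finset.univ \ L)) u = C1 ((graphOf ω).induce ↑(Finset.univ \ L))) :
    (({v : Fin n | v ∈ L ∧
              (∑ w : (↑(Finset.univ \ L) : Set (Fin n)),
                if ((graphOf ω).induce ↑(Finset.univ \ L)).Reachable u w then
                  b v ↑w else 0) ≤ γ * n}.ncard : ℝ)) ≤ s * n := by
  have hn' : (0:ℝ) < n := by exact_mod_cast Nat.pos_of_ne_zero (NeZero.ne n)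
  simp only [bad1, Set.mem_ofPred_eq] at h1
  push Not at h1
  obtain ⟨v, hv, hvc⟩ := h1
  have hle : (clus ω (Finset.univ \ L) {v}).card ≤ (clus ω (Finset.univ \ L) {(u : Fin n)}).card := by
    rw [← compSize_eq ω _ u, hu, ← compSize_eq ω _ (⟨v, hv⟩ : (↑(Finset.univ \ L) : Set (Fin n)))]
    exact Finset.le_sup (f := fun v => compSize ((graphOf ω).induce ↑(Finset.univ \ L)) v) (Finset.mem_univ _)
  have hle' : ((clus ω (Finset.univ \ L) {v}).card : ℝ) ≤ (clus ω (Finset.univ \ L) {(u : Fin n)}).card := by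
    exact_mod_cast hle
  simp only [bad2, Set.mem_ofPred_eq] at h2
  push Not at h2
  have h3 := h2 u u.2 (hvc.trans hle')
  refine le_trans ?_ h3
  rw [← Set.ncard_coe_finset]
  refine Nat.cast_le.2 (Set.ncard_le_ncard ?_ (Set.toFinite _))
  rintro z ⟨-, hz⟩
  simp only [Finset.coe_filter, Finset.mem_univ, true_and, Set.mem_ofPred_eq]
  rw [Tn, div_le_iff₀ hn', sum_mul_ind]
  refine le_trans (le_of_eq ?_) hz
  have hsub : clus ω (Finset.univ \ L) {(u : Fin n)} ⊆ Finset.univ \ L := clus_sub (Finset.singleton_subset_iff.2 u.2)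
  simp only [reach_iff]
  have e := Finset.sum_coe_sort (Finset.univ \ L) (fun w => if w ∈ clus ω (Finset.univ \ L) {(u : Fin n)} then b z w else 0)
  refine Eq.trans ?_ (e.symm.trans ?_)
  · rw [Finset.sum_ite_mem, Finset.inter_eq_right.2 hsub]
  · exact Finset.sum_congr (by ext; simp) fun w _ => rfl

lemma rate {r J K1 K2 τ c m : ℝ} (hr : 1 ≤ r) (hJ1 : r ^ 3 ≤ J) (hJ2 : J ≤ r ^ 3 + 1) (hK1 : 0 ≤ K1) (hK2 : 0 ≤ K2)
    (hτ : 0 < τ) (hc : 0 < c) (hm : 0 < m) :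
    4 * (r ^ 4 * K1) / (τ * J) ^ 2 + 2 * (r ^ 2 * K2) / (τ * J) +
      ((J + 1) * (4 * (r ^ 4 * K1) / (c * r ^ 4) ^ 2) + 2 * (r ^ 2 * K2) / (c * r ^ 4)) +
      (r ^ 2 * (1 + K1) + r ^ 2 * K2) / (m * r ^ 4) ≤
      (4 * K1 / τ ^ 2 + 2 * K2 / τ + (12 * K1 / c ^ 2 + 2 * K2 / c) + (1 + K1 + K2) / m) / r := by
  have hr0 : 0 < r := by linarith
  have hr3 : 1 ≤ r ^ 3 := one_le_pow₀ hr
  have hJ0 : 0 < J := by linarith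
  have t1 : 4 * (r ^ 4 * K1) / (τ * J) ^ 2 ≤ 4 * K1 / τ ^ 2 / r := by
    calc 4 * (r ^ 4 * K1) / (τ * J) ^ 2 ≤ 4 * (r ^ 4 * K1) / (τ * r ^ 3) ^ 2 := by gcongr
      _ = 4 * K1 / τ ^ 2 / r ^ 2 := by field_simp
      _ ≤ _ := by
        refine div_le_div_of_nonneg_left (by positivity) hr0 ?_
        nlinarith
  have t2 : 2 * (r ^ 2 * K2) / (τ * J) ≤ 2 * K2 / τ / r := by
    calc 2 * (r ^ 2 * K2) / (τ * J) ≤ 2 * (r ^ 2 * K2) / (τ * r ^ 3) := by gcongr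
      _ = _ := by field_simp
  have t3 : (J + 1) * (4 * (r ^ 4 * K1) / (c * r ^ 4) ^ 2) ≤ 12 * K1 / c ^ 2 / r := by
    calc (J + 1) * (4 * (r ^ 4 * K1) / (c * r ^ 4) ^ 2) ≤ (3 * r ^ 3) * (4 * (r ^ 4 * K1) / (c * r ^ 4) ^ 2) := by
          gcongr; linarith
      _ = _ := by field_simp; ring
  have t4 : 2 * (r ^ 2 * K2) / (c * r ^ 4) ≤ 2 * K2 / c / r := by
    calc 2 * (r ^ 2 * K2) / (c * r ^ 4) = 2 * K2 / c / r ^ 2 := by field_simp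
      _ ≤ _ := by
        refine div_le_div_of_nonneg_left (by positivity) hr0 ?_
        nlinarith
  have t5 : (r ^ 2 * (1 + K1) + r ^ 2 * K2) / (m * r ^ 4) ≤ (1 + K1 + K2) / m / r := by
    calc (r ^ 2 * (1 + K1) + r ^ 2 * K2) / (m * r ^ 4) = (1 + K1 + K2) / m / r ^ 2 := by field_simp
      _ ≤ _ := by
        refine div_le_div_of_nonneg_left (by positivity) hr0 ?_
        nlinarith
  calc _ ≤ 4 * K1 / τ ^ 2 / r + 2 * K2 / τ / r + (12 * K1 / c ^ 2 / r + 2 * K2 / c / r) + (1 + K1 + K2) / m / r := by linarith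
    _ = _ := by ring

end GiantAux

namespace GiantAux

open Percolation

lemma prod_bound {n : ℕ} (k : ℕ) (b : Fin n → Fin n → ℝ) (h0 : ∀ i j, 0 ≤ b i j)
    (G : Set (Finset (Fin n) × (Sym2 (Fin n) → Bool))) (F : Finset (Fin n) → ℝ) {ε : ℝ}
    (hG : ∀ L ∈ Pm n k, (percMeasure b (1 / n)).real {ω | (L, ω) ∉ G} ≤ F L)
    (hF : ∫ L, F L ∂(unifSubset n k) ≤ ε) :
    1 - ENNReal.ofReal ε ≤ ((unifSubset n k).prod (percMeasure b (1 / n))) G := by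
  have := perc_prob b h0
  have := unifSubset_prob n k
  have hm : ∀ A : Set (Finset (Fin n) × (Sym2 (Fin n) → Bool)), MeasurableSet A := fun A => (Set.toFinite A).measurableSet
  have hc : ((unifSubset n k).prod (percMeasure b (1 / n))) Gᶜ ≤ ENNReal.ofReal ε := by
    rw [Measure.prod_apply (hm _)]
    have e : ∀ L : Finset (Fin n), (percMeasure b (1 / n)) (Prod.mk L ⁻¹' Gᶜ) =
        ENNReal.ofReal ((percMeasure b (1 / n)).real {ω | (L, ω) ∉ G}) := by
      intro L
      rw [ofReal_measureReal]; rfl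
    simp only [e]
    rw [← ofReal_integral_eq_lintegral_ofReal Integrable.of_finite (Eventually.of_forall fun L => measureReal_nonneg)]
    exact ENNReal.ofReal_le_ofReal ((unif_mono n k hG).trans hF)
  have h1 := prob_add_prob_compl (μ := (unifSubset n k).prod (percMeasure b (1 / n))) (hm G)
  rw [tsub_le_iff_right, ← h1]
  gcongr

lemma final_step {n : ℕ} (hn : 8 ^ 4 ≤ n) (k : ℕ) (hk : 2 ≤ k) (b : Fin n → Fin n → ℝ) (h0 : ∀ i j, 0 ≤ b i j) (hs : ∀ i j, b i j = b j i)
    {B : ℝ} (hB : ∀ i j, b i j ≤ B) (hnB : 2 * B ≤ n)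
    (x : Fin n → ℝ) (hx : ∀ z, 0 ≤ x z) (hxB : ∀ z, x z ≤ B) {l : ℝ} (hl : 0 ≤ l)
    (hev : ∀ z, Tn b x z = l * x z) {h δ τ γ s κ : ℝ} (hh : 0 < h) (hδ : 0 < δ) (hδ4 : δ ≤ 1 / 4) (hτ : 0 < τ) (hκ : 0 < κ)
    (hql : 1 + 2 * h ≤ (1 - 1 / (k:ℝ)) * l) (hBδ : 3 * B * δ ≤ h)
    (hsmall : ((Finset.univ.filter fun z => x z ≤ τ).card : ℝ) ≤ δ * n)
    (H : ∀ c e : Fin n → ℝ, (∀ z, 0 ≤ c z) → (∀ z, c z ≤ 1) → δ * n ≤ ∑ z, c z → (∀ z, 0 ≤ e z) →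
      (∀ z, Tn b (Tn b c) z ≤ ((1 + B) / (1 - 1 / (k:ℝ))) * Tn b c z + e z) → ∑ z, e z ≤ κ * n →
      ((Finset.univ.filter fun z => Tn b c z ≤ γ).card : ℝ) ≤ s * n)
    (G : Set (Finset (Fin n) × (Sym2 (Fin n) → Bool)))
    (hG : ∀ L ω, ω ∉ bad1 δ L → ω ∉ bad2 b δ γ s L → (L, ω) ∈ G) :
    1 - ENNReal.ofReal ((4 * (B ^ 2 * Real.exp (4 * B)) / τ ^ 2 + 2 * (1 + (B ^ 2) ^ 2) / τ +
        (12 * (B ^ 2 * Real.exp (4 * B)) / (h * τ * δ) ^ 2 + 2 * (1 + (B ^ 2) ^ 2) / (h * τ * δ)) +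
        (1 + (B ^ 2 * Real.exp (4 * B)) + (1 + (B ^ 2) ^ 2)) / (δ * κ * (1 - 1 / (k:ℝ)))) / (n:ℝ) ^ ((1:ℝ) / 4)) ≤
      ((unifSubset n k).prod (percMeasure b (1 / n))) G := by
  have hn0 : 0 < n := by norm_num at hn; omega
  have : NeZero n := ⟨hn0.ne'⟩
  have hn' : (0:ℝ) < n := by exact_mod_cast hn0
  have hk' : (2:ℝ) ≤ k := by exact_mod_cast hk
  have hk1 : 1 / (k:ℝ) ≤ 1 / 2 := one_div_le_one_div_of_le (by norm_num) hk'
  set q : ℝ := 1 - 1 / (k:ℝ) with hq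
  have hq0 : 0 < q := by rw [hq]; linarith
  have hqn : q ≤ 1 - ((n / k : ℕ) : ℝ) / n := by
    have : ((n / k : ℕ) : ℝ) / n ≤ 1 / k := by
      rw [div_le_iff₀ hn']
      refine (Nat.cast_div_le).trans (le_of_eq ?_)
      ring
    rw [hq]; linarith
  set r : ℝ := (n:ℝ) ^ ((1:ℝ) / 4) with hr
  have hr4 : r ^ 4 = n := by
    rw [hr, ← Real.rpow_natCast, ← Real.rpow_mul hn'.le]; norm_num
  have hr0 : 0 ≤ r := Real.rpow_nonneg hn'.le _
  have hr8 : 8 ≤ r := by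
    have : (8:ℝ) ^ 4 ≤ r ^ 4 := by rw [hr4]; exact_mod_cast hn
    exact le_of_pow_le_pow_left₀ (by norm_num) hr0 this
  have hsq : Real.sqrt n = r ^ 2 := by
    rw [← hr4, show r ^ 4 = (r ^ 2) ^ 2 by ring, Real.sqrt_sq (by positivity)]
  have hr3 : (1:ℝ) ≤ r ^ 3 := one_le_pow₀ (by linarith)
  set J : ℕ := ⌈r ^ 3⌉₊ with hJ
  have hJ1 : r ^ 3 ≤ J := Nat.le_ceil _
  have hJ2 : (J:ℝ) ≤ r ^ 3 + 1 := (Nat.ceil_lt_add_one (by positivity)).le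
  have hJ0 : 0 < J := Nat.ceil_pos.2 (by positivity)
  have hJn : (J:ℝ) ≤ n / 4 := by
    have : r ^ 4 = r * r ^ 3 := by ring
    rw [← hr4]
    nlinarith
  set K1 : ℝ := B ^ 2 * Real.exp (4 * B) with hK1
  set K2 : ℝ := 1 + (B ^ 2) ^ 2 with hK2
  have hn2 : 2 ≤ n := by norm_num at hn; omega
  refine prod_bound k b h0 G (fun L => (4 * (n * K1) / (τ * J) ^ 2 + 2 * d2 b k x L / (τ * J) +
      ((J + 1) * (4 * (n * K1) / (h * τ * δ * n) ^ 2) + 2 * d2 b k x L / (h * τ * δ * n))) +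
      (Real.sqrt n * (1 + K1) + (∑ z, dz b k L z) / n) / (δ * κ * q * n)) ?_ ?_
  · intro L hL
    have hc : L.card = n / k := by simpa [Pm] using hL
    have := perc_prob b h0
    have hJZ : J ≤ ((Finset.univ \ L).filter fun z => τ < x z).card := by
      have h1 : (Finset.univ \ L).card ≤ ((Finset.univ \ L).filter fun z => τ < x z).card +
          (Finset.univ.filter fun z => x z ≤ τ).card := by
        rw [← Finset.card_filter_add_card_filter_not (s := Finset.univ \ L) (fun z => τ < x z)]
        gcongr
        · intro z hz
          have := (Finset.mem_filter.1 hz).2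
          simpa using this
      have h2 : (n:ℝ) / 2 ≤ (Finset.univ \ L).card := by
        rw [Finset.card_sdiff_of_subset (Finset.subset_univ _), hc, Finset.card_univ, Fintype.card_fin,
          Nat.cast_sub (Nat.div_le_self n k)]
        have h3 : ((n / k : ℕ) : ℝ) ≤ n / k := Nat.cast_div_le
        have h4 : (n:ℝ) / k ≤ n / 2 := by gcongr
        linarith
      have h1' : ((Finset.univ \ L).card : ℝ) ≤ (((Finset.univ \ L).filter fun z => τ < x z).card : ℝ) +
          ((Finset.univ.filter fun z => x z ≤ τ).card : ℝ) := by exact_mod_cast h1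
      have h5 : δ * n ≤ n / 4 := by nlinarith
      have : (J:ℝ) ≤ (((Finset.univ \ L).filter fun z => τ < x z).card : ℝ) := by linarith
      exact_mod_cast this
    have b1 := bad1_bound b h0 hs hB hnB k L hq0 hqn x hx hxB hl hev hh hδ hτ hql hBδ hsmall J hJ0 hJZ
    have b2 := bad2_bound b h0 hs hB hnB k L hq0 hqn hδ hκ H
    have b3 : (percMeasure b (1 / n)).real {ω | (L, ω) ∉ G} ≤
        (percMeasure b (1 / n)).real (bad1 δ L ∪ bad2 b δ γ s L) := by
      refine measureReal_mono ?_
      intro ω hω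
      by_contra hno
      have hno' : ω ∉ bad1 δ L ∧ ω ∉ bad2 b δ γ s L := by simpa using hno
      exact hω (hG L ω hno'.1 hno'.2)
    have b4 := measureReal_union_le (μ := percMeasure b (1 / n)) (bad1 δ L) (bad2 b δ γ s L)
    linarith
  · have := unifSubset_prob n k
    have i1 := d2_mean hn2 b h0 hB k x hx hxB
    have i2 := dz_mean hn2 b h0 hB k
    have hJp : (0:ℝ) < J := by exact_mod_cast hJ0
    have e2 : ∫ L, 2 * d2 b k x L ∂(unifSubset n k) = 2 * ∫ L, d2 b k x L ∂(unifSubset n k) := integral_const_mul _ _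
    calc _ = (4 * (n * K1) / (τ * J) ^ 2 + 2 * (∫ L, d2 b k x L ∂(unifSubset n k)) / (τ * J) +
      ((J + 1) * (4 * (n * K1) / (h * τ * δ * n) ^ 2) + 2 * (∫ L, d2 b k x L ∂(unifSubset n k)) / (h * τ * δ * n))) +
      (Real.sqrt n * (1 + K1) + (∫ L, (∑ z, dz b k L z) / n ∂(unifSubset n k))) / (δ * κ * q * n) := by
          rw [integral_add Integrable.of_finite Integrable.of_finite, integral_add Integrable.of_finite Integrable.of_finite,
            integral_add Integrable.of_finite Integrable.of_finite, integral_add Integrable.of_finite Integrable.of_finite,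
            integral_div, integral_div, integral_div (δ * κ * q * n),
            integral_add Integrable.of_finite Integrable.of_finite, integral_div (h * τ * δ * n), integral_const_mul]
          simp only [integral_const, probReal_univ, smul_eq_mul, one_mul, e2]
      _ ≤ (4 * (n * K1) / (τ * J) ^ 2 + 2 * (Real.sqrt n * K2) / (τ * J) +
      ((J + 1) * (4 * (n * K1) / (h * τ * δ * n) ^ 2) + 2 * (Real.sqrt n * K2) / (h * τ * δ * n))) +
      (Real.sqrt n * (1 + K1) + (Real.sqrt n * K2)) / (δ * κ * q * n) := by gcongr
      _ ≤ _ := by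
          rw [hsq, ← hr4]
          exact rate (by linarith) hJ1 hJ2 (by positivity) (by positivity) hτ (by positivity) (by positivity)

end GiantAux

open scoped Classical in
open Percolation MeasureTheory Filter Topology in
/-- Let `(G_n)` converge to an irreducible graphon `W` with
`‖T_W‖ > 1`, let `k ≥ 2` with `(1-1/k)² ‖T_W‖ > 1`, and let `σ > 0` satisfy
`σ < 10⁻¹⁰/βmax³`, `σ < (1-1/k) ρ((1-1/k)² W)/3`, and the degree condition that for all
large `n` at most `n/(10 βmax)` vertices of `G_n` have weighted degree below
`50 k βmax σ n`. Let `L` be a uniformly random subset of `[n]` of size `n/k`,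
`R = [n] \ L`, and `C₁` the largest component of `G_n(1/n)[R]`. Then there is `γ > 0`
such that whp at most `3σn` vertices `v ∈ L` have `e_G(v, C₁) ≤ γ n`. -/
theorem left_vertices_attached_to_giant
    (β : ∀ n : ℕ, Fin n → Fin n → ℝ) (βmax : ℝ)
    (hsym : ∀ n i j, β n i j = β n j i)
    (hnonneg : ∀ n i j, 0 ≤ β n i j)
    (hdiag : ∀ n i, β n i i = 0)
    (hbound : ∀ n i j, β n i j ≤ βmax)
    (W : ℝ → ℝ → ℝ) (hW : IsGraphon W) (hconv : ConvergesTo β W)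
    (hirr : Percolation.Irreducible W) (hTW : 1 < opNorm W)
    (k : ℕ) (hk : 2 ≤ k) (hkW : 1 < (1 - 1 / (k : ℝ)) ^ 2 * opNorm W)
    (σ : ℝ) (hσ0 : 0 < σ)
    (hσ1 : σ < 1e-10 / βmax ^ 3)
    (hσ2 : σ < (1 - 1 / (k : ℝ)) *
      survival (fun x y => (1 - 1 / (k : ℝ)) ^ 2 * W x y) / 3)
    (hσdeg : ∀ᶠ n : ℕ in atTop,
      (({v : Fin n | (∑ w, β n v w) < 50 * k * βmax * σ * n}.ncard : ℝ)) ≤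
        n / (10 * βmax)) :
    ∃ γ : ℝ, 0 < γ ∧ Tendsto
      (fun n : ℕ => ((unifSubset n k).prod (percMeasure (β n) (1 / n)))
        {ω | ∀ u : (↑(Finset.univ \ ω.1) : Set (Fin n)),
          -- for every vertex `u` whose component in `G_n(1/n)[R]` is largest,
          compSize ((graphOf ω.2).induce ↑(Finset.univ \ ω.1)) u =
            C1 ((graphOf ω.2).induce ↑(Finset.univ \ ω.1)) →
          -- at most `3σn` vertices `v ∈ L` send edge weight at most `γn` into it:
          (({v : Fin n | v ∈ ω.1 ∧
              (∑ w : (↑(Finset.univ \ ω.1) : Set (Fin n)),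
                if ((graphOf ω.2).induce ↑(Finset.univ \ ω.1)).Reachable u w then
                  β n v ↑w else 0) ≤ γ * n}.ncard : ℝ)) ≤ 3 * σ * n})
      atTop (nhds 1) := by
  have hop : 0 < opNorm W := by linarith
  have hk' : (2:ℝ) ≤ k := by exact_mod_cast hk
  have hk1 : 1 / (k:ℝ) ≤ 1 / 2 := one_div_le_one_div_of_le (by norm_num) hk'
  have hk0 : 0 < 1 / (k:ℝ) := by positivity
  set q : ℝ := 1 - 1 / (k:ℝ) with hq
  have hq0 : 0 < q := by rw [hq]; linarith
  have hq1 : q < 1 := by rw [hq]; linarith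
  have ha1 : 1 ≤ 1 / q ^ 2 := by
    rw [one_le_div (by positivity)]; nlinarith
  have haW : 1 / q ^ 2 < opNorm W := by
    rw [div_lt_iff₀ (by positivity)]; linarith
  have hE := GiantAux.eig_final hsym hnonneg hbound hW hconv ha1 haW
  have hβ : 0 < βmax := by
    obtain ⟨n, l, x, h1, h2, -⟩ := hE.exists
    linarith
  set h : ℝ := (1 / q - 1) / 2 with hh
  have h1q : 1 < 1 / q := by rw [lt_div_iff₀ hq0]; linarith
  have hh0 : 0 < h := by rw [hh]; linarith
  set δ : ℝ := min (h / (3 * βmax)) (1 / 4) with hδ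
  have hδ0 : 0 < δ := lt_min (by positivity) (by norm_num)
  have hδ4 : δ ≤ 1 / 4 := min_le_right _ _
  have hBδ : 3 * βmax * δ ≤ h := by
    have : δ ≤ h / (3 * βmax) := min_le_left _ _
    rw [le_div_iff₀ (by positivity)] at this
    linarith
  obtain ⟨τ, hτ, hL⟩ := GiantAux.eig_lower hsym hnonneg hbound hβ hW hconv hirr hop δ hδ0
  obtain ⟨γ, hγ, κ, hκ, hA⟩ := GiantAux.attach_det hsym hnonneg hbound hβ hW hconv hirr hop (3 * σ) δ
    ((1 + βmax) / q) (by positivity) hδ0 (by positivity)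
  refine ⟨γ, hγ, ?_⟩
  set D : ℝ := (4 * (βmax ^ 2 * Real.exp (4 * βmax)) / τ ^ 2 + 2 * (1 + (βmax ^ 2) ^ 2) / τ +
        (12 * (βmax ^ 2 * Real.exp (4 * βmax)) / (h * τ * δ) ^ 2 + 2 * (1 + (βmax ^ 2) ^ 2) / (h * τ * δ)) +
        (1 + (βmax ^ 2 * Real.exp (4 * βmax)) + (1 + (βmax ^ 2) ^ 2)) / (δ * κ * q)) with hD
  have hlim : Tendsto (fun n : ℕ => 1 - ENNReal.ofReal (D / (n:ℝ) ^ ((1:ℝ) / 4))) atTop (nhds 1) := by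
    have h1 : Tendsto (fun n : ℕ => (n:ℝ) ^ ((1:ℝ) / 4)) atTop atTop :=
      (tendsto_rpow_atTop (by norm_num)).comp tendsto_natCast_atTop_atTop
    have h2 : Tendsto (fun n : ℕ => D / (n:ℝ) ^ ((1:ℝ) / 4)) atTop (nhds 0) := h1.const_div_atTop D
    have h3 := ENNReal.tendsto_ofReal h2
    have h4 := ENNReal.Tendsto.sub (tendsto_const_nhds (x := (1 : ENNReal)) (f := atTop)) h3 (Or.inl ENNReal.one_ne_top)
    simpa using h4
  refine tendsto_of_tendsto_of_tendsto_of_le_of_le' hlim tendsto_const_nhds ?_ ?_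
  · filter_upwards [hE, hL, hA, eventually_ge_atTop (8 ^ 4), eventually_ge_atTop ⌈2 * βmax⌉₊] with n hEn hLn hAn hn8 hnB
    obtain ⟨l, x, hl1, hl2, hx0, hxB, hxs, hev⟩ := hEn
    have hn0 : NeZero n := ⟨by norm_num at hn8; omega⟩
    have hl0 : 0 ≤ l := by linarith
    refine GiantAux.final_step hn8 k hk (β n) (hnonneg n) (hsym n) (hbound n)
      ((Nat.le_ceil _).trans (by exact_mod_cast hnB)) x hx0 hxB hl0 hev hh0 hδ0 hδ4 hτ hκ ?_ hBδ
      (hLn l x hl0 hl2 hx0 hxB hxs hev) hAn _ ?_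
    · have : q * (1 / q ^ 2) ≤ q * l := mul_le_mul_of_nonneg_left hl1 hq0.le
      have e : q * (1 / q ^ 2) = 1 / q := by field_simp
      rw [← hq, hh]; linarith
    · intro L ω h1 h2 u hu
      exact GiantAux.good_of_not_bad (β n) L ω h1 h2 u hu
  · refine Eventually.of_forall fun n => ?_
    have := GiantAux.perc_prob (β n) (hnonneg n)
    have := GiantAux.unifSubset_prob n k
    exact prob_le_one
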